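/- Let A be a finite dimensional positively graded k-algebra such that S_e has a linear graded projective resolution. If the global dimensions of A and of Γ := (1-e)A(1-e) are both finite, then the Yoneda ring Y(e) has finite global dimension. -/

import Mathlib

set_option linter.unusedVariables false
set_option maxHeartbeats 1000000

/-! Common setup: corner rings, the simple module `S_e`, Ext-algebras (Yoneda rings),
semiperfect and basic rings, finite global dimension. -/

open CategoryTheory CategoryTheory.Abelian
open scoped DirectSum

noncomputable section

/-- Smallness of Ext groups for module categories. -/
instance hasExtModuleCat (R : Type u) [Ring R] : HasExt.{u + 1} (ModuleCat.{u} R) :=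
  letI := HasDerivedCategory.standard (ModuleCat.{u} R)
  hasExt_of_hasDerivedCategory _

/-! ### Corner rings `eAe` -/

/-- The corner ring `eAe = {x : A | e * x = x ∧ x * e = x}` of an idempotent `e : A`. -/
def CornerRing {A : Type*} [Ring A] (e : A) (_ : IsIdempotentElem e) : Type _ :=
  {x : A // e * x = x ∧ x * e = x}

namespace CornerRing

variable {A : Type*} [Ring A] {e : A} {he : IsIdempotentElem e}

instance : Zero (CornerRing e he) := ⟨⟨0, by simp, by simp⟩⟩
instance : One (CornerRing e he) := ⟨⟨e, he, he⟩⟩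
instance : Add (CornerRing e he) :=
  ⟨fun x y => ⟨x.1 + y.1, by rw [mul_add, x.2.1, y.2.1], by rw [add_mul, x.2.2, y.2.2]⟩⟩
instance : Neg (CornerRing e he) :=
  ⟨fun x => ⟨-x.1, by rw [mul_neg, x.2.1], by rw [neg_mul, x.2.2]⟩⟩
instance : Mul (CornerRing e he) :=
  ⟨fun x y => ⟨x.1 * y.1, by rw [← mul_assoc, x.2.1], by rw [mul_assoc, y.2.2]⟩⟩

instance instRing : Ring (CornerRing e he) where
  add_assoc x y z := Subtype.ext (add_assoc _ _ _)
  zero_add x := Subtype.ext (zero_add _)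
  add_zero x := Subtype.ext (add_zero _)
  add_comm x y := Subtype.ext (add_comm _ _)
  neg_add_cancel x := Subtype.ext (neg_add_cancel _)
  mul_assoc x y z := Subtype.ext (mul_assoc _ _ _)
  one_mul x := Subtype.ext x.2.1
  mul_one x := Subtype.ext x.2.2
  left_distrib x y z := Subtype.ext (left_distrib _ _ _)
  right_distrib x y z := Subtype.ext (right_distrib _ _ _)
  zero_mul x := Subtype.ext (zero_mul _)
  mul_zero x := Subtype.ext (mul_zero _)
  nsmul := nsmulRec
  zsmul := zsmulRec

end CornerRing

/-! ### The semisimple module `S_e = eA / e rad A` -/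

/-- The Jacobson radical of the ring `A`, as a set. -/
def ringRadical (A : Type*) [Ring A] : Set A :=
  ((⊥ : TwoSidedIdeal A).jacobson : Set A)

/-- The right ideal `eA`, as a right `A`-module (i.e. an `Aᵐᵒᵖ`-module). -/
def rightIdeal (A : Type*) [Ring A] (e : A) : Submodule Aᵐᵒᵖ A :=
  Submodule.span Aᵐᵒᵖ {e}

/-- The right submodule `e (rad A)` of `A`. -/
def eRad (A : Type*) [Ring A] (e : A) : Submodule Aᵐᵒᵖ A :=
  Submodule.span Aᵐᵒᵖ ((e * ·) '' ringRadical A)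

/-- The semisimple right `A`-module `S_e = eA / e rad A` associated with an idempotent `e`. -/
def SeModule (A : Type*) [Ring A] (e : A) : Type _ :=
  rightIdeal A e ⧸ (eRad A e).comap (rightIdeal A e).subtype

instance (A : Type*) [Ring A] (e : A) : AddCommGroup (SeModule A e) :=
  inferInstanceAs (AddCommGroup (rightIdeal A e ⧸ (eRad A e).comap (rightIdeal A e).subtype))

instance (A : Type*) [Ring A] (e : A) : Module Aᵐᵒᵖ (SeModule A e) :=
  inferInstanceAs (Module Aᵐᵒᵖ (rightIdeal A e ⧸ (eRad A e).comap (rightIdeal A e).subtype))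

/-- `S_e` as an object of the category of right `A`-modules. -/
def Se (A : Type) [Ring A] (e : A) : ModuleCat Aᵐᵒᵖ :=
  ModuleCat.of Aᵐᵒᵖ (SeModule A e)

/-! ### The Ext-algebra (Yoneda ring) of an object of an abelian category -/

namespace ExtYoneda

universe w v u
variable {C : Type u} [Category.{v} C] [Abelian C] [HasExt.{w} C]

lemma comp_heq {X Y Z : C} {a b c : ℕ} (h : a + b = c) (α : Ext X Y a) (β : Ext Y Z b) :
    HEq (α.comp β rfl) (α.comp β h) := by subst h; rfl

variable (X : C)

def gmul : GradedMonoid.GMul (fun i : ℕ => Ext X X i) where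
  mul {i j} α β := α.comp β rfl

def gone : GradedMonoid.GOne (fun i : ℕ => Ext X X i) where
  one := Ext.mk₀ (𝟙 X)

def gmonoid : GradedMonoid.GMonoid (fun i : ℕ => Ext X X i) :=
  letI := gmul X
  letI := gone X
  { one_mul := fun a => by
      obtain ⟨i, α⟩ := a
      exact Sigma.ext (zero_add i)
        ((comp_heq (zero_add i) _ _).trans (heq_of_eq (Ext.mk₀_id_comp α)))
    mul_one := fun a => by
      obtain ⟨i, α⟩ := a
      exact Sigma.ext (add_zero i)
        ((comp_heq (add_zero i) _ _).trans (heq_of_eq (Ext.comp_mk₀_id α)))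
    mul_assoc := fun a b c => by
      obtain ⟨i, α⟩ := a
      obtain ⟨j, β⟩ := b
      obtain ⟨k, γ⟩ := c
      refine Sigma.ext (add_assoc i j k) ?_
      refine (heq_of_eq (Ext.comp_assoc α β γ rfl rfl rfl)).trans ?_
      exact (comp_heq (h := (add_assoc i j k).symm ▸ rfl) _ _).symm }

/-- The graded ring structure on `fun i => Ext X X i` given by the Yoneda product. -/
def gring : DirectSum.GRing (fun i : ℕ => Ext X X i) :=
  letI := gmonoid X
  { __ := gmonoid X
    mul_zero := fun {i j} α => Ext.comp_zero α _ _ _ rfl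
    zero_mul := fun {i j} β => Ext.zero_comp _ _ β _ rfl
    mul_add := fun {_ _} α β γ => Ext.comp_add _ _ _ rfl
    add_mul := fun {_ _} α β γ => Ext.add_comp _ _ _ rfl
    natCast := fun n => n • Ext.mk₀ (𝟙 X)
    natCast_zero := zero_smul _ _
    natCast_succ := fun n => succ_nsmul _ _
    intCast := fun z => z • Ext.mk₀ (𝟙 X)
    intCast_ofNat := fun n => natCast_zsmul _ _
    intCast_negSucc_ofNat := fun n => negSucc_zsmul _ _ }

end ExtYoneda

/-- The Yoneda (Ext-) ring `⨁ i, Ext X X i` of an object `X` of an abelian category,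
with multiplication induced by the Yoneda product. -/
def ExtRing {C : Type u} [Category.{v} C] [Abelian C] [HasExt.{w} C] (X : C) : Type w :=
  ⨁ i : ℕ, Ext X X i

instance {C : Type u} [Category.{v} C] [Abelian C] [HasExt.{w} C] (X : C) :
    Ring (ExtRing X) :=
  letI := ExtYoneda.gring X
  inferInstanceAs (Ring (⨁ i : ℕ, Ext X X i))

/-- The Yoneda ring `Y(e) = Ext_A^*(S_e, S_e)` of an idempotent `e` of the ring `A`. -/
def YonedaRing (A : Type) [Ring A] (e : A) : Type 1 :=
  ExtRing (Se A e)

instance (A : Type) [Ring A] (e : A) : Ring (YonedaRing A e) :=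
  inferInstanceAs (Ring (ExtRing (Se A e)))

/-! ### Homological and ring-theoretic conditions -/

/-- A ring `R` has finite (right) global dimension if there is a uniform bound `n` such that
`Ext^i(M, N)` vanishes for all right `R`-modules `M`, `N` and all `i > n`. -/
def HasFiniteGlobalDimension (R : Type u) [Ring R] : Prop :=
  ∃ n : ℕ, ∀ (M N : ModuleCat.{u} Rᵐᵒᵖ) (i : ℕ), n < i → Subsingleton (Ext M N i)

/-- A ring is Artinian on both sides. -/
def IsTwoSidedArtinian (R : Type u) [Ring R] : Prop :=
  IsArtinianRing R ∧ IsArtinianRing Rᵐᵒᵖ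

/-- A ring is Noetherian on both sides. -/
def IsTwoSidedNoetherian (R : Type u) [Ring R] : Prop :=
  IsNoetherianRing R ∧ IsNoetherianRing Rᵐᵒᵖ

/-- A ring is semiperfect iff `1` decomposes as a finite sum of pairwise orthogonal
idempotents each of whose corner rings is local. -/
def IsSemiperfectRing (A : Type*) [Ring A] : Prop :=
  ∃ (n : ℕ) (f : Fin n → A) (hf : ∀ i, IsIdempotentElem (f i)),
    (∀ i j, i ≠ j → f i * f j = 0) ∧ (∑ i, f i = 1) ∧
      ∀ i, IsLocalRing (CornerRing (f i) (hf i))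

/-- An idempotent is primitive if it is nonzero and cannot be written as the sum of two
nonzero orthogonal idempotents. -/
def IsPrimitiveIdempotent {A : Type*} [Ring A] (e : A) : Prop :=
  IsIdempotentElem e ∧ e ≠ 0 ∧
    ∀ f g : A, IsIdempotentElem f → IsIdempotentElem g → f * g = 0 → g * f = 0 →
      f + g = e → f = 0 ∨ g = 0

/-- A ring is basic if `1` decomposes as a finite sum of pairwise orthogonal primitive
idempotents whose associated indecomposable projective right modules are pairwise
non-isomorphic. -/
def IsBasicRing (A : Type*) [Ring A] : Prop :=
  ∃ (n : ℕ) (f : Fin n → A),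
    (∀ i, IsPrimitiveIdempotent (f i)) ∧ (∀ i j, i ≠ j → f i * f j = 0) ∧ (∑ i, f i = 1) ∧
      ∀ i j, i ≠ j → IsEmpty ((rightIdeal A (f i)) ≃ₗ[Aᵐᵒᵖ] (rightIdeal A (f j)))

end
/-! ### Positively graded finite dimensional algebras and linear resolutions -/

section Graded

variable {k : Type} [Field k] {A : Type} [Ring A] [Algebra k A]

/-- The degree-zero part of a positively graded algebra, as a subalgebra. -/
def gradeZeroSubalgebra (𝒜 : ℕ → Submodule k A) [GradedRing 𝒜] : Subalgebra k A where
  carrier := 𝒜 0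
  mul_mem' {a b} ha hb := by simpa using SetLike.mul_mem_graded ha hb
  add_mem' {a b} ha hb := add_mem ha hb
  algebraMap_mem' c := by
    show algebraMap k A c ∈ 𝒜 0
    rw [Algebra.algebraMap_eq_smul_one]
    exact (𝒜 0).smul_mem c (SetLike.one_mem_graded 𝒜)

/-- The property that the degree-zero part of the grading `𝒜` of `A` is isomorphic, as a
`k`-algebra, to a finite product of copies of `k`. -/
def GradeZeroIsProductOfField (𝒜 : ℕ → Submodule k A) [GradedRing 𝒜] : Prop :=
  ∃ m : ℕ, Nonempty (gradeZeroSubalgebra 𝒜 ≃ₐ[k] (Fin m → k))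

/-- A right `A`-module `M` has a linear graded projective resolution with respect to the
grading `𝒜` of `A` if it admits a projective resolution `P` such that each term `P_n`
carries an (internal direct sum) grading compatible with `𝒜` for which the differentials
are homogeneous of degree zero and `P_n` is generated in degree `n`. -/
def HasLinearGradedProjectiveResolution (𝒜 : ℕ → Submodule k A) [GradedRing 𝒜]
    (M : ModuleCat Aᵐᵒᵖ) : Prop :=
  ∃ (P : CategoryTheory.ProjectiveResolution M)
    (g : ∀ n : ℕ, ℕ → AddSubgroup (P.complex.X n)),
    -- each `P_n` is the internal direct sum of its homogeneous components
    (∀ n : ℕ, DirectSum.IsInternal (g n)) ∧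
    -- the grading of each `P_n` is compatible with the grading of `A`
    (∀ (n d j : ℕ) (a : A), a ∈ 𝒜 j → ∀ x ∈ g n d,
      (MulOpposite.op a) • x ∈ g n (d + j)) ∧
    -- the differentials are homogeneous of degree zero
    (∀ (n d : ℕ), ∀ x ∈ g (n + 1) d, P.complex.d (n + 1) n x ∈ g n d) ∧
    -- `P_n` is generated in degree `n`
    (∀ n : ℕ, Submodule.span Aᵐᵒᵖ ((g n n : Set (P.complex.X n))) = ⊤)

end Graded

namespace YExt
set_option linter.unusedSectionVars false
open CochainComplex HomComplex
universe w v u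

lemma shifted_aux {C : Type u} [Category.{v} C] [HasShift C ℤ] {S Q Q' Z Z' : C} (α : S ⟶ Q) (p : Q ⟶ Q') (β : Q' ⟶ S) (γ : Z ⟶ Z')
    (h : p ≫ β ≫ α = 𝟙 Q) {a b c : ℤ} (t : ShiftedHom Q Q a) (g : ShiftedHom Q Z b)
    (hc : b + a = c) (h1 : 0 + c = c) (h2 : c + 0 = c) (h' : b + a = c) :
    ((ShiftedHom.mk₀ (0 : ℤ) rfl α).comp ((t.comp (ShiftedHom.mk₀ (0 : ℤ) rfl p) (zero_add a)).comp
      (ShiftedHom.mk₀ (0 : ℤ) rfl β) (zero_add a)) (add_zero a)).comp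
      ((ShiftedHom.mk₀ (0 : ℤ) rfl α).comp (g.comp (ShiftedHom.mk₀ (0 : ℤ) rfl γ) (zero_add b))
        (add_zero b)) hc =
    (ShiftedHom.mk₀ (0 : ℤ) rfl α).comp ((t.comp g h').comp (ShiftedHom.mk₀ (0 : ℤ) rfl γ) h1) h2 := by
  subst hc
  rw [ShiftedHom.comp_assoc (ShiftedHom.mk₀ (0 : ℤ) rfl α) _ _ _ (rfl : b + a = b + a) (by simp)]
  congr 1
  rw [ShiftedHom.comp_assoc t _ _ (zero_add a) (zero_add 0) (by simp),
      ShiftedHom.mk₀_comp_mk₀,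
      ShiftedHom.comp_assoc t _ _ (zero_add a) (add_zero b) (by simp),
      ← ShiftedHom.comp_assoc _ _ (g.comp _ _) (zero_add 0) (add_zero b) (by simp),
      ShiftedHom.mk₀_comp_mk₀, Category.assoc, h, ShiftedHom.mk₀_id_comp,
      ShiftedHom.comp_assoc t _ _ _ (zero_add b) (by simp)]

lemma iso_aux {C : Type u} [Category.{v} C] {A A' B B' D E : C} (i : A ≅ A') (t : A' ⟶ B) (j : B' ≅ B) (g : B ⟶ D) (s : D ⟶ E) :
    (i.hom ≫ t ≫ j.inv) ≫ j.hom ≫ g ≫ s = i.hom ≫ (t ≫ g) ≫ s := by simp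

section
variable {C : Type u} [Category.{v} C] [Preadditive C]

/-- composition of cocycles -/
noncomputable def cocComp {K L M : CochainComplex C ℤ} {a b c : ℤ} (z : Cocycle K L a) (y : Cocycle L M b)
    (h : a + b = c) : Cocycle K M c :=
  Cocycle.mk (z.1.comp y.1 h) (c+1) rfl (by
    rw [δ_comp z.1 y.1 h (a+1) (b+1) (c+1) rfl rfl rfl, z.δ_eq_zero, y.δ_eq_zero]
    simp)

lemma equivHomShift_symm_f {K L : CochainComplex C ℤ} {a : ℤ} (z : Cocycle K L a) (p : ℤ) :
    (Cocycle.equivHomShift.symm z).f p = z.1.v p (p + a) rfl := by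
  have : (Cocycle.equivHomShift.symm z).f p =
    (z.1.rightShift a 0 (zero_add a)).v p p (add_zero p) := by
    rfl
  rw [this, Cochain.rightShift_v z.1 a 0 (zero_add a) p p (add_zero p) (p+a) rfl]
  exact Category.comp_id _

lemma shiftedHom_comp_f {K L M : CochainComplex C ℤ} {a b c : ℤ} (f : K ⟶ L⟦a⟧) (g : L ⟶ M⟦b⟧)
    (h : b + a = c) (p q : ℤ) (hq : p + a = q) :
    (ShiftedHom.comp (X := K) (Y := L) (Z := M) f g h).f p =
      f.f p ≫ g.f (p + a) ≫ (M.XIsoOfEq (show p + a + b = p + c by lia)).hom := by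
  unfold ShiftedHom.comp
  rw [HomologicalComplex.comp_f, HomologicalComplex.comp_f,
    CochainComplex.shiftFunctorAdd'_inv_app_f']
  rfl

lemma equivHomShift_symm_cocComp {K L M : CochainComplex C ℤ} {a b c : ℤ} (z : Cocycle K L a)
    (y : Cocycle L M b) (h : a + b = c) :
    Cocycle.equivHomShift.symm (cocComp z y h) =
      ShiftedHom.comp (X := K) (Y := L) (Z := M) (Cocycle.equivHomShift.symm z)
        (Cocycle.equivHomShift.symm y) (by lia) := by
  apply HomologicalComplex.hom_ext
  intro p
  refine Eq.trans ?_ (shiftedHom_comp_f (Cocycle.equivHomShift.symm z) (Cocycle.equivHomShift.symm y) (by lia) p _ rfl).symm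
  rw [equivHomShift_symm_f, equivHomShift_symm_f, equivHomShift_symm_f]
  subst h
  change (z.1.comp y.1 rfl).v p (p + (a + b)) rfl = _
  rw [Cochain.comp_v _ _ _ p (p+a) (p + (a+b)) rfl (by lia)]
  congr 1
  exact (Cochain.v_comp_XIsoOfEq_hom _ _ _ _ _ _).symm
end

variable {C : Type u} [Category.{v} C] [Abelian C] [HasExt.{w} C]
  {X Y : C} (P : ProjectiveResolution X)

noncomputable def lifts_cochain (a : ℕ) (θ : ∀ n, P.complex.X (a+n) ⟶ P.complex.X n) :
    Cochain P.cochainComplex P.cochainComplex a :=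
  Cochain.mk fun p q hpq =>
    if hq : q ≤ 0 then
      (P.cochainComplexXIso p (a + (-q).toNat) (by lia)).hom ≫ θ ((-q).toNat) ≫
        (P.cochainComplexXIso q ((-q).toNat) (by lia)).inv
    else 0

lemma lifts_cochain_v (a : ℕ) (θ : ∀ n, P.complex.X (a+n) ⟶ P.complex.X n) (p q : ℤ)
    (hpq : p + a = q) (n : ℕ) (hp : -((a+n : ℕ) : ℤ) = p) (hn : -(n:ℤ) = q) :
    (lifts_cochain P a θ).v p q hpq =
      (P.cochainComplexXIso p (a + n) hp).hom ≫ θ n ≫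
        (P.cochainComplexXIso q n hn).inv := by
  obtain rfl : n = (-q).toNat := by lia
  exact dif_pos (by lia)

noncomputable def lifts_cocycle (a : ℕ) (θ : ∀ n, P.complex.X (a+n) ⟶ P.complex.X n)
    (hθ : ∀ n, θ (n+1) ≫ P.complex.d (n+1) n =
      ((a:ℤ).negOnePow) • P.complex.d (a+n+1) (a+n) ≫ θ n) :
    Cocycle P.cochainComplex P.cochainComplex a :=
  Cocycle.mk (lifts_cochain P a θ) (a+1) rfl (by
    ext p q hpq
    by_cases hq : q ≤ 0
    · obtain ⟨n, rfl⟩ : ∃ n : ℕ, q = -n := ⟨(-q).toNat, by lia⟩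
      rw [δ_v _ _ rfl _ _ _ hpq (-((n+1 : ℕ):ℤ)) (-((a+n : ℕ):ℤ)) (by lia) (by lia),
        lifts_cochain_v P a θ _ _ _ (n+1) (by lia) (by lia),
        lifts_cochain_v P a θ _ _ _ n (by lia) (by lia),
        P.cochainComplex_d _ _ (n+1) n (by lia) (by lia),
        P.cochainComplex_d _ _ (a+n+1) (a+n) (by lia) (by lia)]
      simp only [Category.assoc, Iso.inv_hom_id_assoc, Cochain.zero_v]
      have h1 := hθ n
      have h2 := reassoc_of% h1
      rw [h2, Int.negOnePow_succ]
      simp only [Units.neg_smul, Linear.units_smul_comp, Linear.comp_units_smul, Category.assoc]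
      exact add_neg_cancel _
    · exact (CochainComplex.isZero_of_isStrictlyLE _ 0 _ (by lia)).eq_of_tgt _ _)

lemma extMk_hom' [HasDerivedCategory C] {n : ℕ} (f : P.complex.X n ⟶ Y) (m : ℕ) (hm : n + 1 = m)
    (hf : P.complex.d m n ≫ f = 0) (z : Cocycle P.cochainComplex ((singleFunctor C 0).obj Y) n)
    (hz : z.1.v (-n) 0 (by lia) = (P.cochainComplexXIso (-n) n rfl).hom ≫ f ≫
      (HomologicalComplex.singleObjXSelf (.up ℤ) 0 Y).inv) :
    (P.extMk f m hm hf).hom =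
    (ShiftedHom.mk₀ _ rfl ((DerivedCategory.singleFunctorIsoCompQ C 0).hom.app X ≫
      inv (DerivedCategory.Q.map P.π'))).comp
        ((ShiftedHom.map (Cocycle.equivHomShift.symm z) _).comp
              (.mk₀ _ rfl ((DerivedCategory.singleFunctorIsoCompQ C 0).inv.app Y))
                (zero_add _)) (add_zero _) := by
  rw [P.extMk_hom]
  congr 4
  obtain ⟨f', hf', rfl⟩ := Cocycle.toSingleMk_surjective z (-n) (by lia) (-m) (by lia)
  rw [Cocycle.toSingleMk_coe, Cochain.toSingleMk_v] at hz
  congr 1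
  rw [← cancel_mono (HomologicalComplex.singleObjXSelf (.up ℤ) 0 Y).inv]
  exact (Category.assoc _ _ _).trans hz.symm

lemma comp_extMk (a : ℕ) (θ : ∀ n, P.complex.X (a+n) ⟶ P.complex.X n)
    (hθ : ∀ n, θ (n+1) ≫ P.complex.d (n+1) n =
      ((a:ℤ).negOnePow) • P.complex.d (a+n+1) (a+n) ≫ θ n) (b : ℕ) (g : P.complex.X b ⟶ Y)
    (hg : P.complex.d (b+1) b ≫ g = 0)
    (f : P.complex.X a ⟶ X) (hf : P.complex.d (a+1) a ≫ f = 0)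
    (hfθ : f = θ 0 ≫ P.π.f 0)
    (hθg : P.complex.d (a+b+1) (a+b) ≫ θ b ≫ g = 0) :
    (P.extMk f (a+1) rfl hf).comp (P.extMk g (b+1) rfl hg) rfl =
      P.extMk (θ b ≫ g) (a+b+1) rfl hθg := by
  have := HasDerivedCategory.standard C
  ext
  set zg : Cocycle P.cochainComplex ((singleFunctor C 0).obj Y) b :=
    Cocycle.toSingleMk ((P.cochainComplexXIso (-b) b rfl).hom ≫ g) (by simp) (-(b+1 : ℕ))
            (by lia) (by rw [P.cochainComplex_d _ _ (b+1) b rfl rfl]; simp [hg]) with hzg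
  have e1 := extMk_hom' P f (a+1) rfl hf ((lifts_cocycle P a θ hθ).postcomp P.π') (by
    change ((lifts_cochain P a θ).comp (Cochain.ofHom P.π') (add_zero _)).v (-a) 0 (by lia) = _
    rw [Cochain.comp_v _ _ _ (-a) 0 0 (by lia) (by lia),
      lifts_cochain_v P a θ _ _ _ 0 (by lia) (by lia), Cochain.ofHom_v, P.π'_f_zero, hfθ]
    exact iso_aux _ _ _ _ _)
  have e2 := extMk_hom' P g (b+1) rfl hg zg (by
    rw [hzg, Cocycle.toSingleMk_coe, Cochain.toSingleMk_v]
    simp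
    rfl)
  have e3 := extMk_hom' P (θ b ≫ g) (a+b+1) rfl hθg (cocComp (lifts_cocycle P a θ hθ) zg (by simp)) (by
    change ((lifts_cochain P a θ).comp zg.1 (by simp)).v (-(a+b:ℕ)) 0 (by lia) = _
    rw [Cochain.comp_v _ _ _ (-(a+b:ℕ)) (-b) 0 (by lia) (by lia),
      lifts_cochain_v P a θ _ _ _ b (by lia) (by lia), hzg, Cocycle.toSingleMk_coe,
      Cochain.toSingleMk_v]
    refine Eq.trans ?_ (iso_aux _ (θ b) (P.cochainComplexXIso (-b) b rfl) g _)
    congr 1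
    exact Category.assoc _ _ _)
  rw [Ext.comp_hom, e1, e2, e3, equivHomShift_symm_cocComp,
    Cocycle.equivHomShift_symm_postcomp, ← ShiftedHom.comp_mk₀ _ 0 rfl,
    ShiftedHom.map_comp, ShiftedHom.map_comp, ShiftedHom.map_mk₀]
  generalize (ShiftedHom.map (Cocycle.equivHomShift.symm zg) DerivedCategory.Q) = gg
  generalize (ShiftedHom.map (Cocycle.equivHomShift.symm (lifts_cocycle P a θ hθ)) DerivedCategory.Q) = tt
  exact shifted_aux _ _ _ _ (by simp) tt gg _ _ _ (by push_cast; ring)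

lemma extMk_pi (h : P.complex.d 1 0 ≫ P.π.f 0 = 0) :
    P.extMk (P.π.f 0) 1 rfl h = Ext.mk₀ (𝟙 X) := by
  obtain ⟨g, hg, hg'⟩ := P.extMk_surjective (Ext.mk₀ (𝟙 X)) 1 rfl
  have key := comp_extMk P 0 (fun n => (P.complex.XIsoOfEq (zero_add n)).hom) (by intro n; simp; rfl) 0 g hg
    (P.π.f 0) h (Category.id_comp _).symm (by simpa [HomologicalComplex.XIsoOfEq] using hg)
  rw [hg'] at key
  refine (Ext.comp_mk₀_id _).symm.trans (key.trans ?_)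
  rw [← hg']
  congr 1
  simp [HomologicalComplex.XIsoOfEq]

lemma extMk_inj_zero (f : P.complex.X 0 ⟶ Y) (hf : P.complex.d 1 0 ≫ f = 0)
    (h : P.extMk f 1 rfl hf = 0) : f = 0 := by
  simp only [← P.extEquivCohomologyClass.apply_eq_iff_eq,
    ProjectiveResolution.extEquivCohomologyClass_extMk, ProjectiveResolution.extEquivCohomologyClass_zero,
    CohomologyClass.mk_eq_zero_iff] at h
  rw [Cocycle.toSingleMk_mem_coboundaries_iff _ _ _ _ _ 1 (by lia)] at h
  obtain ⟨g, hg⟩ := h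
  have : g = 0 := (CochainComplex.isZero_of_isStrictlyLE _ 0 _ (by lia)).eq_of_src _ _
  rw [this, Limits.comp_zero] at hg
  rw [← cancel_epi (P.cochainComplexXIso (-(0:ℕ)) 0 rfl).hom, ← hg]
  simp

end YExt

namespace YDg
set_option linter.unusedSectionVars false
open CategoryTheory.Pretriangulated CategoryTheory.Limits DerivedCategory
universe w v u

section Tri
variable {C : Type u} [Category.{v} C] [Abelian C] [HasDerivedCategory.{w} C]

/-- Vanishing of maps from objects of the heart to large shifts of `B`. -/
def Van (B : DerivedCategory C) (n0 : ℤ) : Prop :=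
  ∀ (X : C) (n : ℤ), n0 < n → ∀ f : (singleFunctor C 0).obj X ⟶ B⟦n⟧, f = 0

lemma Van.of_iso {B B' : DerivedCategory C} (i : B ≅ B') {n0 : ℤ} (h : Van B n0) : Van B' n0 := by
  intro X n hn f
  have h1 := h X n hn (f ≫ (shiftFunctor _ n).map i.inv)
  have h2 : f = (f ≫ (shiftFunctor _ n).map i.inv) ≫ (shiftFunctor _ n).map i.hom := by
    rw [Category.assoc, ← Functor.map_comp, i.inv_hom_id, CategoryTheory.Functor.map_id, Category.comp_id]
  rw [h2, h1, zero_comp]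

lemma Van.of_isZero {B : DerivedCategory C} (h : IsZero B) (n0 : ℤ) : Van B n0 := by
  intro X n hn f
  exact (Functor.map_isZero (shiftFunctor (DerivedCategory C) n) h).eq_of_tgt _ _

lemma Van.mono {B : DerivedCategory C} {n0 n1 : ℤ} (h : Van B n0) (h1 : n0 ≤ n1) : Van B n1 :=
  fun X n hn f => h X n (by omega) f

lemma Van.shift_one {B : DerivedCategory C} {n0 : ℤ} (h : Van B n0) :
    Van (B⟦(1 : ℤ)⟧) n0 := by
  intro X n hn f
  have h1 := h X (1 + n) (by omega) (f ≫ (shiftFunctorAdd (DerivedCategory C) 1 n).inv.app B)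
  have h2 : f = (f ≫ (shiftFunctorAdd (DerivedCategory C) 1 n).inv.app B) ≫
      (shiftFunctorAdd (DerivedCategory C) 1 n).hom.app B := by
    rw [Category.assoc, Iso.inv_hom_id_app]
    exact (Category.comp_id f).symm
  rw [h2, h1, zero_comp]

lemma Van.tri₂ (T : Triangle (DerivedCategory C)) (hT : T ∈ distTriang (DerivedCategory C))
    {n0 : ℤ} (h1 : Van T.obj₁ n0) (h3 : Van T.obj₃ n0) : Van T.obj₂ n0 := by
  intro X n hn f
  have hT' := Triangle.shift_distinguished T hT n
  obtain ⟨g, hg⟩ := Triangle.coyoneda_exact₂ _ hT' f (h3 X n hn _)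
  have : g = 0 := h1 X n hn g
  rw [hg, this]
  exact zero_comp

lemma Van.tri₃ (T : Triangle (DerivedCategory C)) (hT : T ∈ distTriang (DerivedCategory C))
    {n0 : ℤ} (h1 : Van T.obj₁ n0) (h2 : Van T.obj₂ n0) : Van T.obj₃ n0 :=
  Van.tri₂ T.rotate (rot_of_distTriang T hT) h2 h1.shift_one

lemma isZero_Q_of_exactAt (K : CochainComplex C ℤ) (hK : ∀ i, K.ExactAt i) :
    IsZero (Q.obj K) := by
  have : QuasiIso (0 : K ⟶ K) := by
    rw [quasiIso_iff]
    intro i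
    rw [quasiIsoAt_iff_exactAt _ _ (hK i)]
    exact hK i
  have h : IsIso (Q.map (0 : K ⟶ K)) := inferInstance
  rw [IsZero.iff_id_eq_zero]
  have h2 := IsIso.hom_inv_id (Q.map (0 : K ⟶ K))
  rw [← h2]
  have h3 : Q.map (0 : K ⟶ K) = 0 := Functor.map_zero _ _ _
  calc _ = (0 : Q.obj K ⟶ Q.obj K) ≫ inv (Q.map (0 : K ⟶ K)) := by congr 1
    _ = 0 := zero_comp

lemma ext_iff_van [HasExt.{w} C] (I X : C) (n : ℕ)
    (h : ∀ f : (singleFunctor C 0).obj X ⟶ ((singleFunctor C 0).obj I)⟦(n : ℤ)⟧, f = 0) :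
    Subsingleton (Ext X I n) := by
  have : Subsingleton (ShiftedHom ((singleFunctor C 0).obj X) ((singleFunctor C 0).obj I) (n : ℤ)) :=
    ⟨fun a b => (h a).trans (h b).symm⟩
  exact Ext.homEquiv.subsingleton

lemma van_single [HasExt.{w} C] (I : C) [Injective I] : Van ((singleFunctor C 0).obj I) 0 := by
  intro X n hn f
  obtain ⟨m, rfl⟩ : ∃ m : ℕ, n = (m : ℤ) := ⟨n.toNat, by omega⟩
  have : Subsingleton (Ext X I m) := by
    have : HasInjectiveDimensionLT I 1 := by
      rw [← injective_iff_hasInjectiveDimensionLT_one]; infer_instance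
    exact HasInjectiveDimensionLT.subsingleton I 1 m (by omega) X
  have h2 : Subsingleton (ShiftedHom ((singleFunctor C 0).obj X) ((singleFunctor C 0).obj I)
      (m : ℤ)) := (Ext.homEquiv (C := C)).symm.subsingleton
  exact Subsingleton.elim (α := ShiftedHom ((singleFunctor C 0).obj X) ((singleFunctor C 0).obj I)
      (m : ℤ)) f 0

lemma van_of_single_shift (I : C) (B : DerivedCategory C) (j : ℤ) (i : B ≅ (singleFunctor C j).obj I)
    {n0 : ℤ} (h : Van ((singleFunctor C 0).obj I) n0) : Van B (n0 + j) := by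
  refine Van.of_iso i.symm ?_
  intro X n hn f
  let e1 := ((singleFunctors C).shiftIso (-j) j 0 (by omega)).app I
  have hh : ∀ g : (singleFunctor C 0).obj X ⟶ (((singleFunctor C 0).obj I)⟦-j⟧)⟦n⟧, g = 0 := by
    intro g
    have h1 := h X (-j + n) (by omega)
      (g ≫ (shiftFunctorAdd (DerivedCategory C) (-j) n).inv.app _)
    have h2 : g = (g ≫ (shiftFunctorAdd (DerivedCategory C) (-j) n).inv.app _) ≫
      (shiftFunctorAdd (DerivedCategory C) (-j) n).hom.app _ := by
      rw [Category.assoc, Iso.inv_hom_id_app]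
      exact (Category.comp_id g).symm
    rw [h2, h1, zero_comp]
  have h1 := hh (f ≫ (shiftFunctor _ n).map e1.inv)
  have h2 : f = (f ≫ (shiftFunctor _ n).map e1.inv) ≫ (shiftFunctor _ n).map e1.hom := by
    rw [Category.assoc, ← Functor.map_comp, e1.inv_hom_id, CategoryTheory.Functor.map_id]
    exact (Category.comp_id f).symm
  rw [h2, h1, zero_comp]

lemma van_of_concentrated [HasExt.{w} C] (K : CochainComplex C ℤ) (j : ℤ)
    (h0 : ∀ i, i ≠ j → IsZero (K.X i)) (hI : Injective (K.X j)) : Van (Q.obj K) j := by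
  have : K.IsStrictlyGE j := by
    rw [CochainComplex.isStrictlyGE_iff]; intro i hi; exact h0 i (by omega)
  have : K.IsStrictlyLE j := by
    rw [CochainComplex.isStrictlyLE_iff]; intro i hi; exact h0 i (by omega)
  obtain ⟨I, ⟨i⟩⟩ := CochainComplex.exists_iso_single K j
  have hI' : Injective I := Injective.of_iso
    ((HomologicalComplex.eval _ _ j).mapIso i ≪≫ HomologicalComplex.singleObjXSelf (ComplexShape.up ℤ) j I) hI
  have := van_of_single_shift I (Q.obj K) j
    (Q.mapIso i ≪≫ ((singleFunctorIsoCompQ C j).symm.app I)) (van_single I)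
  simpa using this

end Tri

end YDg

namespace YDg
set_option linter.unusedSectionVars false
open CategoryTheory.Pretriangulated CategoryTheory.Limits DerivedCategory
universe w v u

/-- A differential graded module presented by its total module, with projectors. -/
structure DGM (Λ : Type u) [Ring Λ] where
  G : Type u
  [ac : AddCommGroup G]
  [mod : Module Λ G]
  pr : ℤ → G →ₗ[Λ] G
  D : G →ₗ[Λ] G
  orth : ∀ i j x, pr i (pr j x) = if i = j then pr j x else 0
  Dpr : ∀ j x, D (pr j x) = pr (j + 1) (D x)
  DD : ∀ x, D (D x) = 0

attribute [instance] DGM.ac DGM.mod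

namespace DGM
variable {Λ : Type u} [Ring Λ]

/-- The homogeneous component of degree `j`. -/
def deg (M : DGM Λ) (j : ℤ) : Submodule Λ M.G where
  carrier := {x | M.pr j x = x}
  add_mem' {a b} ha hb := by
    simp only [Set.mem_ofPred_eq] at *
    rw [map_add, ha, hb]
  zero_mem' := map_zero _
  smul_mem' c x hx := by
    simp only [Set.mem_ofPred_eq] at *
    rw [map_smul, hx]

lemma mem_deg {M : DGM Λ} {j : ℤ} {x : M.G} : x ∈ M.deg j ↔ M.pr j x = x := Iff.rfl

lemma pr_mem (M : DGM Λ) (j : ℤ) (x : M.G) : M.pr j x ∈ M.deg j := by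
  rw [mem_deg, M.orth, if_pos rfl]

lemma D_mem (M : DGM Λ) {j : ℤ} {x : M.G} (hx : x ∈ M.deg j) : M.D x ∈ M.deg (j + 1) := by
  rw [mem_deg, ← M.Dpr, mem_deg.1 hx]

/-- the differential -/
def dd (M : DGM Λ) (i j : ℤ) : M.deg i →ₗ[Λ] M.deg j :=
  ((M.pr j ∘ₗ M.D) ∘ₗ (M.deg i).subtype).codRestrict _ (fun x => M.pr_mem j _)

lemma dd_apply (M : DGM Λ) (i j : ℤ) (x : M.deg i) : (M.dd i j x : M.G) = M.pr j (M.D x) := rfl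

lemma dd_apply' (M : DGM Λ) (i j : ℤ) (h : i + 1 = j) (x : M.deg i) :
    (M.dd i j x : M.G) = M.D x := by
  subst h
  rw [dd_apply]
  exact M.D_mem x.2

/-- The associated cochain complex. -/
noncomputable def toCx (M : DGM Λ) : CochainComplex (ModuleCat.{u} Λ) ℤ where
  X j := ModuleCat.of Λ (M.deg j)
  d i j := ModuleCat.ofHom (M.dd i j)
  shape i j h := by
    ext x
    change M.pr j (M.D x.1) = 0
    have h1 : M.pr (i + 1) (M.D x.1) = M.D x.1 := M.D_mem x.2
    rw [← h1, M.orth, if_neg]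
    exact fun h' => h h'.symm
  d_comp_d' i j l hij hjl := by
    ext x
    change M.pr l (M.D (M.pr j (M.D x.1))) = 0
    rw [M.Dpr, M.DD, map_zero, map_zero]

/-- Morphisms. -/
structure Mor (M N : DGM Λ) where
  f : M.G →ₗ[Λ] N.G
  fpr : ∀ j x, f (M.pr j x) = N.pr j (f x)
  fD : ∀ x, f (M.D x) = N.D (f x)

lemma Mor.mem {M N : DGM Λ} (φ : Mor M N) {j : ℤ} {x : M.G} (hx : x ∈ M.deg j) :
    φ.f x ∈ N.deg j := by
  rw [mem_deg, ← φ.fpr, mem_deg.1 hx]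

/-- restriction of a morphism to a degree -/
def Mor.res {M N : DGM Λ} (φ : Mor M N) (j : ℤ) : M.deg j →ₗ[Λ] N.deg j :=
  φ.f.restrict (fun _ h => φ.mem h)

/-- The induced map of complexes. -/
noncomputable def Mor.toCx {M N : DGM Λ} (φ : Mor M N) : M.toCx ⟶ N.toCx where
  f j := ModuleCat.ofHom (φ.res j)
  comm' i j h := by
    ext x
    refine Subtype.ext ?_
    change N.pr j (N.D (φ.f x.1)) = φ.f (M.pr j (M.D x.1))
    rw [φ.fpr, φ.fD]

/-- Short complexes of complexes from exact sequences. -/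
noncomputable def sc {M N L : DGM Λ} (φ : Mor M N) (ψ : Mor N L) (h : ∀ x, ψ.f (φ.f x) = 0) :
    ShortComplex (CochainComplex (ModuleCat.{u} Λ) ℤ) :=
  ShortComplex.mk φ.toCx ψ.toCx (by
    ext i x
    refine Subtype.ext ?_
    exact h x.1)

lemma sc_shortExact {M N L : DGM Λ} (φ : Mor M N) (ψ : Mor N L) (h : ∀ x, ψ.f (φ.f x) = 0)
    (hinj : Function.Injective φ.f) (hsurj : Function.Surjective ψ.f)
    (hex : ∀ y, ψ.f y = 0 → ∃ x, φ.f x = y) : (sc φ ψ h).ShortExact := by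
  apply HomologicalComplex.shortExact_of_degreewise_shortExact
  intro i
  refine ShortComplex.ShortExact.mk' ?_ ?_ ?_
  · rw [ShortComplex.moduleCat_exact_iff]
    intro y hy
    have hy' : ψ.f (y : N.deg i).1 = 0 := congrArg Subtype.val hy
    obtain ⟨x, hx⟩ := hex _ hy'
    refine ⟨(⟨x, ?_⟩ : M.deg i), Subtype.ext hx⟩
    apply hinj
    rw [φ.fpr, hx]
    exact (y : N.deg i).2
  · rw [ModuleCat.mono_iff_injective]
    intro a b hab
    exact Subtype.ext (hinj (congrArg Subtype.val hab))
  · rw [ModuleCat.epi_iff_surjective]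
    intro y
    obtain ⟨x, hx⟩ := hsurj (y : L.deg i).1
    refine ⟨(⟨N.pr i x, N.pr_mem i x⟩ : N.deg i), Subtype.ext ?_⟩
    change ψ.f (N.pr i x) = _
    rw [ψ.fpr, hx]
    exact (y : L.deg i).2

lemma exactAt (M : DGM Λ) (j : ℤ)
    (h : ∀ x ∈ M.deg j, M.D x = 0 → ∃ y, M.D y = x) : M.toCx.ExactAt j := by
  rw [HomologicalComplex.exactAt_iff' _ (j - 1) j (j + 1) (by simp) (by simp),
    ShortComplex.moduleCat_exact_iff]
  intro x hx
  have hx' : M.D (x : M.deg j).1 = 0 := by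
    have := congrArg Subtype.val hx
    exact (M.dd_apply' j (j + 1) rfl x).symm.trans this
  obtain ⟨y, hy⟩ := h _ (x : M.deg j).2 hx'
  refine ⟨(⟨M.pr (j - 1) y, M.pr_mem _ y⟩ : M.deg (j - 1)), Subtype.ext ?_⟩
  change M.pr j (M.D (M.pr (j - 1) y)) = (x : M.deg j).1
  rw [M.Dpr, hy, M.orth, if_pos (by omega), sub_add_cancel]
  exact (x : M.deg j).2

variable [HasDerivedCategory.{w} (ModuleCat.{u} Λ)]

/-- uniform vanishing for a DGM -/
def VanD (M : DGM Λ) (n0 : ℤ) : Prop := Van (Q.obj M.toCx) n0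

lemma VanD.mono {M : DGM Λ} {n0 n1 : ℤ} (h : VanD M n0) (h1 : n0 ≤ n1) : VanD M n1 := Van.mono h h1

lemma VanD.ses₂ {M N L : DGM Λ} (φ : Mor M N) (ψ : Mor N L) (h : ∀ x, ψ.f (φ.f x) = 0)
    (hinj : Function.Injective φ.f) (hsurj : Function.Surjective ψ.f)
    (hex : ∀ y, ψ.f y = 0 → ∃ x, φ.f x = y) {n0 : ℤ} (h1 : VanD M n0) (h3 : VanD L n0) :
    VanD N n0 :=
  Van.tri₂ _ (triangleOfSES_distinguished (sc_shortExact φ ψ h hinj hsurj hex)) h1 h3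

lemma VanD.ses₃ {M N L : DGM Λ} (φ : Mor M N) (ψ : Mor N L) (h : ∀ x, ψ.f (φ.f x) = 0)
    (hinj : Function.Injective φ.f) (hsurj : Function.Surjective ψ.f)
    (hex : ∀ y, ψ.f y = 0 → ∃ x, φ.f x = y) {n0 : ℤ} (h1 : VanD M n0) (h2 : VanD N n0) :
    VanD L n0 :=
  Van.tri₃ _ (triangleOfSES_distinguished (sc_shortExact φ ψ h hinj hsurj hex)) h1 h2

lemma VanD.acyclic (M : DGM Λ) (h : ∀ x, M.D x = 0 → ∃ y, M.D y = x) (n0 : ℤ) : VanD M n0 :=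
  Van.of_isZero (isZero_Q_of_exactAt _ (fun j => M.exactAt j (fun x _ hx => h x hx))) n0

lemma VanD.conc [HasExt.{w} (ModuleCat.{u} Λ)] (M : DGM Λ) (j : ℤ)
    (h : ∀ x, M.pr j x = x) (hI : Injective (ModuleCat.of Λ M.G)) : VanD M j := by
  refine van_of_concentrated _ j ?_ ?_
  · intro i hi
    have : Subsingleton (M.deg i) := by
      refine ⟨fun a b => Subtype.ext ?_⟩
      have key : ∀ x ∈ M.deg i, x = 0 := by
        intro x hx
        rw [← mem_deg.1 hx, ← h x, M.orth, if_neg hi]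
      rw [key _ a.2, key _ b.2]
    exact ModuleCat.isZero_of_subsingleton (ModuleCat.of Λ (M.deg i))
  · refine Injective.of_iso (P := ModuleCat.of Λ M.G) ?_ hI
    have e : M.deg j ≃ₗ[Λ] M.G := LinearEquiv.ofBijective (M.deg j).subtype
      ⟨Subtype.val_injective, fun x => ⟨⟨x, h x⟩, rfl⟩⟩
    exact e.symm.toModuleIso

/-- The part of degree zero killed by the differential. -/
def Z (M : DGM Λ) : Submodule Λ M.G := M.deg 0 ⊓ LinearMap.ker M.D

/-- `Z` as a DGM -/
def ZD (M : DGM Λ) : DGM Λ where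
  G := M.Z
  pr i := if i = 0 then LinearMap.id else 0
  D := 0
  orth i j x := by
    by_cases hi : i = 0 <;> by_cases hj : j = 0
    · subst hi; subst hj; simp
    · subst hi; simp [hj]
    · subst hj; simp [hi]
    · simp [hi, hj]
  Dpr j x := by simp
  DD x := by simp

lemma Z_le_D (M : DGM Λ) : M.Z ≤ M.Z.comap M.D := by
  intro x hx
  have : M.D x = 0 := hx.2
  rw [Submodule.mem_comap, this]
  exact zero_mem _

lemma Z_le_pr (M : DGM Λ) (j : ℤ) : M.Z ≤ M.Z.comap (M.pr j) := by
  intro x hx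
  have h0 : M.pr 0 x = x := hx.1
  rw [Submodule.mem_comap, ← h0, M.orth]
  split_ifs with h
  · rw [h0]; exact hx
  · exact zero_mem _

/-- The quotient `M/Z`. -/
def QD (M : DGM Λ) : DGM Λ where
  G := M.G ⧸ M.Z
  pr j := M.Z.mapQ M.Z (M.pr j) (M.Z_le_pr j)
  D := M.Z.mapQ M.Z M.D M.Z_le_D
  orth i j x := by
    obtain ⟨x, rfl⟩ := Submodule.Quotient.mk_surjective _ x
    rw [Submodule.mapQ_apply, Submodule.mapQ_apply, M.orth]
    split_ifs <;> rfl
  Dpr j x := by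
    obtain ⟨x, rfl⟩ := Submodule.Quotient.mk_surjective _ x
    simp only [Submodule.mapQ_apply, M.Dpr]
  DD x := by
    obtain ⟨x, rfl⟩ := Submodule.Quotient.mk_surjective _ x
    simp only [Submodule.mapQ_apply, M.DD]
    rfl

/-- inclusion -/
def Zi (M : DGM Λ) : Mor M.ZD M where
  f := M.Z.subtype
  fpr j x := by
    have h0 : M.pr 0 x.1 = x.1 := x.2.1
    change ((if j = 0 then LinearMap.id else 0 : M.Z →ₗ[Λ] M.Z) x).1 = M.pr j x.1
    rw [← h0, M.orth]
    split_ifs with h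
    · exact h0.symm
    · rfl
  fD x := by
    have : M.D x.1 = 0 := x.2.2
    exact this.symm

/-- projection -/
def Zp (M : DGM Λ) : Mor M M.QD where
  f := M.Z.mkQ
  fpr j x := rfl
  fD x := rfl

lemma QD_exact (M : DGM Λ) (hneg : ∀ j x, j < 0 → M.pr j x = 0)
    (hex : ∀ j x, 0 < j → x ∈ M.deg j → M.D x = 0 → ∃ y, M.D y = x) (j : ℤ) :
    M.QD.toCx.ExactAt j := by
  apply exactAt
  intro x hx hD
  obtain ⟨x, rfl⟩ := Submodule.Quotient.mk_surjective _ x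
  have hx1 : (Submodule.Quotient.mk (M.pr j x) : M.G ⧸ M.Z) = Submodule.Quotient.mk x := hx
  have hD1 : (Submodule.Quotient.mk (M.D (M.pr j x)) : M.G ⧸ M.Z) = 0 := by
    have h2 := congrArg (M.Z.mapQ M.Z M.D M.Z_le_D) hx1
    rw [Submodule.mapQ_apply] at h2
    exact h2.trans hD
  rw [Submodule.Quotient.mk_eq_zero] at hD1
  suffices h : ∃ y, M.D y - M.pr j x ∈ M.Z by
    obtain ⟨y, hy⟩ := h
    refine ⟨Submodule.Quotient.mk y, ?_⟩
    rw [← hx1]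
    exact (Submodule.Quotient.eq _).2 hy
  rcases lt_trichotomy j 0 with h | h | h
  · exact ⟨0, by rw [hneg j x h]; simp⟩
  · subst h
    have : M.D (M.pr 0 x) = 0 := by
      have h3 := hD1.1
      have h4 : M.pr 0 (M.D (M.pr 0 x)) = M.D (M.pr 0 x) := h3
      rw [← h4, M.Dpr, M.orth, if_neg (by omega)]
    refine ⟨0, ?_⟩
    rw [map_zero, zero_sub]
    exact neg_mem ⟨M.pr_mem 0 x, this⟩
  · have : M.D (M.pr j x) = 0 := by
      have h3 := hD1.1
      have h4 : M.pr 0 (M.D (M.pr j x)) = M.D (M.pr j x) := h3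
      rw [← h4, M.Dpr, M.orth, if_neg (by omega)]
    obtain ⟨y, hy⟩ := hex j _ h (M.pr_mem j x) this
    exact ⟨y, by rw [hy, sub_self]; exact zero_mem _⟩

lemma Z_injdim [HasExt.{w} (ModuleCat.{u} Λ)] (M : DGM Λ) (hneg : ∀ j x, j < 0 → M.pr j x = 0)
    (hex : ∀ j x, 0 < j → x ∈ M.deg j → M.D x = 0 → ∃ y, M.D y = x) (n0 : ℕ)
    (h : VanD M n0) (X : ModuleCat.{u} Λ) (n : ℕ) (hn : n0 < n) :
    Subsingleton (Ext X (ModuleCat.of Λ M.Z) n) := by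
  have hS := sc_shortExact M.Zi M.Zp (fun x => by
      change (Submodule.Quotient.mk x.1 : M.G ⧸ M.Z) = 0
      rw [Submodule.Quotient.mk_eq_zero]; exact x.2) Subtype.val_injective
    (Submodule.Quotient.mk_surjective _) (fun y hy => by
      have hy' : (Submodule.Quotient.mk y : M.G ⧸ M.Z) = 0 := hy
      rw [Submodule.Quotient.mk_eq_zero] at hy'
      exact ⟨⟨y, hy'⟩, rfl⟩)
  have hT := triangleOfSES_distinguished hS
  have hz : IsZero (triangleOfSES hS).obj₃ := isZero_Q_of_exactAt _ (M.QD_exact hneg hex)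
  have hi : IsIso (triangleOfSES hS).mor₁ := (Triangle.isZero₃_iff_isIso₁ _ hT).1 hz
  have hv : Van (Q.obj M.ZD.toCx) n0 := Van.of_iso (asIso (triangleOfSES hS).mor₁).symm h
  have h0 : ∀ i, i ≠ 0 → IsZero (M.ZD.toCx.X i) := by
    intro i hi
    have : Subsingleton (M.ZD.deg i) := by
      refine ⟨fun a b => Subtype.ext ?_⟩
      have key : ∀ x ∈ M.ZD.deg i, x = 0 := by
        intro x hx
        rw [← mem_deg.1 hx]
        change (if i = 0 then LinearMap.id else 0 : M.Z →ₗ[Λ] M.Z) x = 0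
        rw [if_neg hi]; rfl
      rw [key _ a.2, key _ b.2]
    exact ModuleCat.isZero_of_subsingleton (ModuleCat.of Λ (M.ZD.deg i))
  have : (M.ZD.toCx).IsStrictlyGE 0 := by
    rw [CochainComplex.isStrictlyGE_iff]; intro i hi; exact h0 i (by omega)
  have : (M.ZD.toCx).IsStrictlyLE 0 := by
    rw [CochainComplex.isStrictlyLE_iff]; intro i hi; exact h0 i (by omega)
  obtain ⟨I, ⟨i⟩⟩ := CochainComplex.exists_iso_single M.ZD.toCx 0
  have e : M.ZD.deg 0 ≃ₗ[Λ] M.Z := LinearEquiv.ofBijective (M.ZD.deg 0).subtype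
      ⟨Subtype.val_injective, fun x => ⟨⟨x, rfl⟩, rfl⟩⟩
  let iI : ModuleCat.of Λ M.Z ≅ I := e.symm.toModuleIso ≪≫
    ((HomologicalComplex.eval _ _ 0).mapIso i ≪≫
      HomologicalComplex.singleObjXSelf (ComplexShape.up ℤ) 0 I)
  have hv2 : Van ((singleFunctor (ModuleCat.{u} Λ) 0).obj (ModuleCat.of Λ M.Z)) n0 :=
    Van.of_iso ((Q.mapIso i ≪≫ ((singleFunctorIsoCompQ _ 0).symm.app I)) ≪≫
      (singleFunctor _ 0).mapIso iI.symm) hv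
  exact ext_iff_van _ _ _ (fun f => hv2 X n (by exact_mod_cast hn) f)

end DGM

/-- Coinduction criterion for injectivity. -/
lemma injective_of_coind {k : Type*} [Field k] {Λ : Type u} [Ring Λ] (κ : k →+* Λ)
    {G : Type u} [AddCommGroup G] [Module Λ G] {W : Type*} [AddCommGroup W] [Module k W]
    (ev : G →+ W) (hev : ∀ c g, ev (κ c • g) = c • ev g)
    (hsurj : ∀ u : Λ →+ W, (∀ c l, u (κ c * l) = c • u l) → ∃ g : G, ∀ l, ev (l • g) = u l)
    (huniq : ∀ g : G, (∀ l : Λ, ev (l • g) = 0) → g = 0) :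
    Injective (ModuleCat.of Λ G) := by
  have hb : Module.Baer Λ G := by
    intro I φ
    letI : Module k Λ := Module.compHom Λ κ
    let I' : Submodule k Λ :=
      { carrier := I
        add_mem' := fun ha hb => I.add_mem ha hb
        zero_mem' := I.zero_mem
        smul_mem' := fun c x hx => I.mul_mem_left (κ c) hx }
    let u0 : I' →ₗ[k] W :=
      { toFun := fun x => ev (φ ⟨x.1, x.2⟩)
        map_add' := fun x y => by
          rw [← map_add, ← map_add]; rfl
        map_smul' := fun c x => by
          rw [RingHom.id_apply, ← hev, ← map_smul]; rfl }
    obtain ⟨u, hu⟩ := LinearMap.exists_extend u0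
    have hu' : ∀ x (hx : x ∈ I), u x = ev (φ ⟨x, hx⟩) := fun x hx =>
      LinearMap.congr_fun hu ⟨x, hx⟩
    obtain ⟨g, hg⟩ := hsurj u.toAddMonoidHom (fun c l => u.map_smul c l)
    refine ⟨LinearMap.toSpanSingleton Λ G g, fun x hx => ?_⟩
    rw [LinearMap.toSpanSingleton_apply, ← sub_eq_zero]
    apply huniq
    intro l
    rw [smul_sub, map_sub, ← mul_smul, hg, ← map_smul]
    have h2 := hu' (l * x) (I.mul_mem_left l hx)
    change u (l * x) - _ = 0
    rw [h2]
    exact sub_self _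
  exact (Module.injective_iff_injective_object Λ G).1 hb.injective
end YDg

noncomputable section
namespace YGr
set_option linter.unusedSectionVars false

/-- A bounded grading by integers, presented by projectors. -/
structure Grd (k M : Type) [Field k] [AddCommGroup M] [Module k M] where
  π : ℤ → M →ₗ[k] M
  b : ℕ
  orth : ∀ i j x, π i (π j x) = if i = j then π j x else 0
  supp : ∀ i x, i ∉ Finset.Icc (-(b : ℤ)) b → π i x = 0
  tot : ∀ x, ∑ i ∈ Finset.Icc (-(b : ℤ)) b, π i x = x

namespace Grd
variable {k M N : Type} [Field k] [AddCommGroup M] [Module k M] [AddCommGroup N] [Module k N]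

lemma same (g : Grd k M) (i : ℤ) (x : M) : g.π i (g.π i x) = g.π i x := by
  rw [g.orth, if_pos rfl]

lemma ext' (g : Grd k M) {x y : M} (h : ∀ i, g.π i x = g.π i y) : x = y := by
  rw [← g.tot x, ← g.tot y]
  exact Finset.sum_congr rfl (fun i _ => h i)

lemma tot_of_subset (g : Grd k M) (s : Finset ℤ) (hs : Finset.Icc (-(g.b : ℤ)) g.b ⊆ s) (x : M) :
    ∑ i ∈ s, g.π i x = x := by
  rw [← Finset.sum_subset hs (fun i _ hi => g.supp i x hi), g.tot]

lemma induct (g : Grd k M) {p : M → Prop} (hadd : ∀ x y, p x → p y → p (x + y)) (h0 : p 0)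
    (hh : ∀ i x, p (g.π i x)) (x : M) : p x := by
  rw [← g.tot x]
  exact Finset.sum_induction _ p hadd h0 (fun i _ => hh i x)

/-- homogeneous component of a linear map -/
def comp (g : Grd k M) (h : Grd k N) (j : ℤ) : (M →ₗ[k] N) →ₗ[k] (M →ₗ[k] N) where
  toFun φ := ∑ w ∈ Finset.Icc (-(g.b : ℤ)) g.b, (h.π (j + w) ∘ₗ φ) ∘ₗ g.π w
  map_add' φ ψ := by
    rw [← Finset.sum_add_distrib]
    refine Finset.sum_congr rfl (fun w _ => ?_)
    ext x; simp
  map_smul' c φ := by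
    rw [RingHom.id_apply, Finset.smul_sum]
    refine Finset.sum_congr rfl (fun w _ => ?_)
    ext x; simp

lemma comp_apply (g : Grd k M) (h : Grd k N) (j : ℤ) (φ : M →ₗ[k] N) (x : M) :
    comp g h j φ x = ∑ w ∈ Finset.Icc (-(g.b : ℤ)) g.b, h.π (j + w) (φ (g.π w x)) := by
  simp [comp, LinearMap.sum_apply]

lemma pi_comp (g : Grd k M) (h : Grd k N) (j m : ℤ) (φ : M →ₗ[k] N) (x : M) :
    h.π m (comp g h j φ x) = h.π m (φ (g.π (m - j) x)) := by
  rw [comp_apply, map_sum]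
  have : ∀ w ∈ Finset.Icc (-(g.b : ℤ)) g.b, h.π m (h.π (j + w) (φ (g.π w x))) =
      if w = m - j then h.π m (φ (g.π (m - j) x)) else 0 := by
    intro w _
    rw [h.orth]
    by_cases hw : w = m - j
    · subst hw
      rw [if_pos (by ring), if_pos rfl, add_sub_cancel]
    · rw [if_neg (by omega), if_neg hw]
  rw [Finset.sum_congr rfl this, Finset.sum_ite_eq']
  split_ifs with h1
  · rfl
  · rw [g.supp _ _ h1, map_zero, map_zero]

lemma comp_hom (g : Grd k M) (h : Grd k N) (j w : ℤ) (φ : M →ₗ[k] N) (x : M) :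
    comp g h j φ (g.π w x) = h.π (j + w) (φ (g.π w x)) := by
  apply h.ext'
  intro m
  rw [pi_comp, g.orth, h.orth]
  by_cases hm : m = j + w
  · subst hm
    rw [if_pos (by ring), if_pos rfl]
  · rw [if_neg (by omega), if_neg hm, map_zero, map_zero]

/-- grading on the space of linear maps -/
def hom (g : Grd k M) (h : Grd k N) : Grd k (M →ₗ[k] N) where
  π j := comp g h j
  b := g.b + h.b
  orth i j φ := by
    ext x
    apply h.ext'
    intro m
    rw [pi_comp, pi_comp, g.orth]
    by_cases hij : i = j
    · subst hij
      rw [if_pos rfl, if_pos rfl, pi_comp]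
    · rw [if_neg (by omega), if_neg hij, map_zero, map_zero, LinearMap.zero_apply, map_zero]
  supp i φ hi := by
    ext x
    rw [comp_apply, LinearMap.zero_apply]
    apply Finset.sum_eq_zero
    intro w hw
    apply h.supp
    rw [Finset.mem_Icc] at *
    push_cast at hi
    omega
  tot φ := by
    ext x
    apply h.ext'
    intro m
    rw [LinearMap.sum_apply, map_sum]
    simp only [pi_comp]
    by_cases hm : m ∈ Finset.Icc (-(h.b : ℤ)) h.b
    · have h1 : ∑ w ∈ (Finset.Icc (-((g.b + h.b : ℕ) : ℤ)) ((g.b + h.b : ℕ) : ℤ)).image (fun i => m - i),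
          g.π w x = x := by
        apply g.tot_of_subset
        intro w hw
        rw [Finset.mem_image]
        refine ⟨m - w, ?_, by ring⟩
        rw [Finset.mem_Icc] at *
        push_cast
        omega
      rw [Finset.sum_image (fun a _ b _ hab => by simpa using hab)] at h1
      conv_rhs => rw [← h1]
      rw [map_sum, map_sum]
    · rw [h.supp m _ hm]
      exact Finset.sum_eq_zero (fun i _ => h.supp m _ hm)

/-- restriction to a homogeneous subspace -/
def sub (g : Grd k M) (S : Submodule k M) (hS : ∀ i, ∀ x ∈ S, g.π i x ∈ S) : Grd k S where
  π i := (g.π i).restrict (hS i)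
  b := g.b
  orth i j x := by
    apply Subtype.ext
    have := g.orth i j x.1
    split_ifs at this ⊢ with h
    · exact this
    · exact this
  supp i x hi := Subtype.ext (g.supp i x.1 hi)
  tot x := by
    apply Subtype.ext
    rw [AddSubmonoidClass.coe_finsetSum]
    exact g.tot x.1

/-- quotient by a homogeneous subspace -/
def quot (g : Grd k M) (S : Submodule k M) (hS : ∀ i, ∀ x ∈ S, g.π i x ∈ S) : Grd k (M ⧸ S) where
  π i := S.mapQ S (g.π i) (hS i)
  b := g.b
  orth i j x := by
    obtain ⟨x, rfl⟩ := Submodule.Quotient.mk_surjective _ x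
    rw [Submodule.mapQ_apply, Submodule.mapQ_apply, g.orth]
    split_ifs <;> rfl
  supp i x hi := by
    obtain ⟨x, rfl⟩ := Submodule.Quotient.mk_surjective _ x
    rw [Submodule.mapQ_apply, g.supp i x hi]; rfl
  tot x := by
    obtain ⟨x, rfl⟩ := Submodule.Quotient.mk_surjective _ x
    conv_rhs => rw [← g.tot x]
    simp only [Submodule.mapQ_apply]
    exact (map_sum S.mkQ _ _).symm

end Grd

/-- A compatible graded ring structure. -/
structure GRg (k R : Type) [Field k] [Ring R] [Algebra k R] extends Grd k R where
  cpt : ∀ i j a x, π (i + j) (π i a * x) = π i a * π j x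
  neg : ∀ i x, i < 0 → π i x = 0
  one : π 0 1 = 1

variable {k R : Type} [Field k] [Ring R] [Algebra k R]

/-- compatibility of gradings -/
def Cpt (gR : GRg k R) {M : Type} [AddCommGroup M] [Module k M] [Module R M]
    (g : Grd k M) : Prop :=
  ∀ i j a x, g.π (i + j) (gR.π i a • x) = gR.π i a • g.π j x

section Cp
variable {gR : GRg k R} {M : Type} [AddCommGroup M] [Module k M] [Module R M]
    [IsScalarTower k R M] {g : Grd k M}

lemma Cpt.c (h : Cpt gR g) (i m : ℤ) (a : R) (x : M) :
    g.π m (gR.π i a • x) = gR.π i a • g.π (m - i) x := by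
  rw [← h, add_sub_cancel]

lemma Cpt.zero (h : Cpt gR g) (m : ℤ) {a : R} (ha : gR.π 0 a = a) (x : M) :
    g.π m (a • x) = a • g.π m x := by
  have := h.c 0 m a x
  rwa [ha, sub_zero] at this

variable {N : Type} [AddCommGroup N] [Module k N] [Module R N]
    [IsScalarTower k R N] {g' : Grd k N}

/-- components of an `R`-linear map are linear -/
def compR (hg : Cpt gR g) (hg' : Cpt gR g') (j : ℤ) (φ : M →ₗ[R] N) : M →ₗ[R] N where
  toFun := Grd.comp g g' j (φ.restrictScalars k)
  map_add' := map_add _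
  map_smul' r x := by
    rw [RingHom.id_apply]
    refine gR.induct (p := fun r => Grd.comp g g' j (φ.restrictScalars k) (r • x) =
      r • Grd.comp g g' j (φ.restrictScalars k) x) ?_ ?_ ?_ r
    · intro a b ha hb
      rw [add_smul, map_add, ha, hb, add_smul]
    · simp
    · intro i r
      apply g'.ext'
      intro m
      rw [Grd.pi_comp, hg.c, LinearMap.restrictScalars_apply, map_smul, hg'.c, hg'.c, Grd.pi_comp,
        LinearMap.restrictScalars_apply, sub_right_comm]

lemma compR_pi (hg : Cpt gR g) (hg' : Cpt gR g') (j m : ℤ) (φ : M →ₗ[R] N) (x : M) :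
    g'.π m (compR hg hg' j φ x) = g'.π m (φ (g.π (m - j) x)) :=
  Grd.pi_comp g g' j m (φ.restrictScalars k) x

lemma compR_eq_zero (hg : Cpt gR g) (hg' : Cpt gR g') (j : ℤ) (φ : M →ₗ[R] N)
    (h : ∀ m x, g'.π m (φ (g.π (m - j) x)) = 0) : compR hg hg' j φ = 0 := by
  ext x
  apply g'.ext'
  intro m
  rw [compR_pi, h, LinearMap.zero_apply, map_zero]

end Cp

/-- Finite dimensional graded modules. -/
structure GMod (gR : GRg k R) where
  M : Type
  [ac : AddCommGroup M]
  [mK : Module k M]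
  [mR : Module R M]
  [tw : IsScalarTower k R M]
  [fd : Module.Finite k M]
  g : Grd k M
  cp : Cpt gR g

attribute [instance] GMod.ac GMod.mK GMod.mR GMod.tw GMod.fd

namespace GMod
variable {gR : GRg k R}

/-- graded submodule -/
def sub (X : GMod gR) (S : Submodule R X.M) (hS : ∀ i, ∀ x ∈ S, X.g.π i x ∈ S) : GMod gR where
  M := S
  ac := S.addCommGroup
  mK := S.module'
  mR := S.module
  tw := S.isScalarTower
  fd := inferInstanceAs (Module.Finite k (S.restrictScalars k))
  g := X.g.sub (S.restrictScalars k) hS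
  cp i j a x := Subtype.ext (X.cp i j a x.1)

/-- graded quotient -/
def quot (X : GMod gR) (S : Submodule R X.M) (hS : ∀ i, ∀ x ∈ S, X.g.π i x ∈ S) : GMod gR where
  M := X.M ⧸ S
  fd := Module.Finite.of_surjective (S.mkQ.restrictScalars k) (Submodule.mkQ_surjective S)
  g := X.g.quot (S.restrictScalars k) hS
  cp i j a x := by
    obtain ⟨x, rfl⟩ := Submodule.Quotient.mk_surjective _ x
    exact congrArg S.mkQ (X.cp i j a x)

end GMod

end YGr
end

noncomputable section
namespace YGr
set_option linter.unusedSectionVars false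
open YDg

/-- The abstract setup: a linear resolution with the action of the Yoneda ring. -/
structure Stp {k R : Type} [Field k] [Ring R] [Algebra k R] (gR : GRg k R)
    (Λ : Type 1) [Ring Λ] where
  PP : Type
  [ac : AddCommGroup PP]
  [mK : Module k PP]
  [mR : Module R PP]
  [tw : IsScalarTower k R PP]
  [proj : Module.Projective R PP]
  gP : Grd k PP
  cP : Cpt gR gP
  act : Λ →+* Module.End R PP
  act_w : ∀ l i x, gP.π i (act l x) = act l (gP.π i x)
  δ : PP →ₗ[R] PP
  δδ : ∀ x, δ (δ x) = 0
  δ_w : ∀ i x, δ (gP.π i x) = gP.π (i + 1) (δ x)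
  δ_act : ∀ l x, δ (act l x) = act l (δ x)
  pos : ∀ i x, i < 0 → gP.π i x = 0
  gen : ∀ w x, w ≠ 0 → gP.π w x ∈ AddSubgroup.closure {z | ∃ i r y, 0 < i ∧ z = gR.π i r • y}
  S : Type
  [acS : AddCommGroup S]
  [mKS : Module k S]
  [mRS : Module R S]
  [twS : IsScalarTower k R S]
  ε : PP →ₗ[R] S
  ε0 : ∀ x, ε (gP.π 0 x) = ε x
  ex1 : ∀ x, δ x = 0 → ε x = 0 → ∃ y, δ y = x
  ex0 : ∀ s, ∃ x, gP.π 0 x = x ∧ δ x = 0 ∧ ε x = s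
  bij : Function.Bijective (fun l : Λ => (ε ∘ₗ act l : PP →ₗ[R] S))
  m : ℕ
  e : Fin m → R
  eorth : ∀ i j, e i * e j = if i = j then e i else 0
  esum : ∑ i, e i = 1
  edeg : ∀ i, gR.π 0 (e i) = e i
  espan : ∀ r, ∃ c : Fin m → k, gR.π 0 r = ∑ i, c i • e i
  s0 : S
  e0 : R
  e0e0 : e0 * e0 = e0
  e0deg : gR.π 0 e0 = e0
  gen0 : ∀ s : S, ∃ r : R, r • s0 = s
  Splus : ∀ i r (s : S), 0 < i → gR.π i r • s = 0
  e0S : ∀ s : S, e0 • s = s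
  ann : ∀ r : R, r • s0 = 0 → gR.π 0 r * e0 = 0

attribute [instance] Stp.ac Stp.mK Stp.mR Stp.tw Stp.proj Stp.acS Stp.mKS Stp.mRS Stp.twS

variable {k R : Type} [Field k] [Ring R] [Algebra k R] {gR : GRg k R} {Λ : Type 1} [Ring Λ]

namespace Stp
variable (s : Stp gR Λ)

section GG
variable (M : Type) [AddCommGroup M] [Module k M] [Module R M] [IsScalarTower k R M]
  (W : Type 1) [AddCommGroup W] [Module k W]

/-- The dual of the space of homomorphisms from the resolution. -/
def GG : Type 1 := (s.PP →ₗ[R] M) →ₗ[k] W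

instance : AddCommGroup (s.GG M W) := inferInstanceAs (AddCommGroup ((s.PP →ₗ[R] M) →ₗ[k] W))

/-- precomposition as a `k`-linear map -/
def pre (t : s.PP →ₗ[R] s.PP) : (s.PP →ₗ[R] M) →ₗ[k] (s.PP →ₗ[R] M) where
  toFun φ := φ ∘ₗ t
  map_add' _ _ := rfl
  map_smul' _ _ := rfl

instance : Module Λ (s.GG M W) where
  smul l g := LinearMap.comp (σ₁₂ := RingHom.id k) (show (s.PP →ₗ[R] M) →ₗ[k] W from g) (s.pre M (s.act l))
  one_smul g := by
    refine LinearMap.ext (fun φ => ?_)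
    change (show (s.PP →ₗ[R] M) →ₗ[k] W from g) (φ ∘ₗ s.act 1) = _
    rw [map_one]; rfl
  mul_smul a b g := by
    refine LinearMap.ext (fun φ => ?_)
    change (show (s.PP →ₗ[R] M) →ₗ[k] W from g) (φ ∘ₗ s.act (a * b)) = _
    rw [map_mul]; rfl
  smul_zero a := rfl
  smul_add a g h := rfl
  add_smul a b g := by
    refine LinearMap.ext (fun φ => ?_)
    change (show (s.PP →ₗ[R] M) →ₗ[k] W from g) (φ ∘ₗ s.act (a + b)) = _
    rw [map_add]
    exact (congrArg _ (LinearMap.comp_add _ _ _)).trans (LinearMap.map_add _ _ _)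
  zero_smul g := by
    refine LinearMap.ext (fun φ => ?_)
    change (show (s.PP →ₗ[R] M) →ₗ[k] W from g) (φ ∘ₗ s.act 0) = _
    rw [map_zero]
    exact (congrArg _ (LinearMap.comp_zero _)).trans (LinearMap.map_zero _)

variable {M W}

/-- evaluation -/
def ev (g : s.GG M W) : (s.PP →ₗ[R] M) →ₗ[k] W := g
/-- constructor -/
def mkG (g : (s.PP →ₗ[R] M) →ₗ[k] W) : s.GG M W := g

@[simp] lemma ev_mkG (g : (s.PP →ₗ[R] M) →ₗ[k] W) : s.ev (s.mkG g) = g := rfl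
@[simp] lemma ev_add (g h : s.GG M W) : s.ev (g + h) = s.ev g + s.ev h := rfl
@[simp] lemma ev_sub (g h : s.GG M W) : s.ev (g - h) = s.ev g - s.ev h := rfl
@[simp] lemma ev_zero : s.ev (0 : s.GG M W) = 0 := rfl
@[simp] lemma ev_smul (l : Λ) (g : s.GG M W) (φ) : s.ev (l • g) φ = s.ev g (φ ∘ₗ s.act l) := rfl
lemma ev_ext {g h : s.GG M W} (H : ∀ φ, s.ev g φ = s.ev h φ) : g = h := LinearMap.ext H

/-- dual of a `k`-linear map of hom spaces commuting with the action -/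
def dual {N : Type} [AddCommGroup N] [Module k N] [Module R N] [IsScalarTower k R N]
    (T : (s.PP →ₗ[R] M) →ₗ[k] (s.PP →ₗ[R] N))
    (hT : ∀ l φ, T (φ ∘ₗ s.act l) = T φ ∘ₗ s.act l) : s.GG N W →ₗ[Λ] s.GG M W where
  toFun g := s.mkG (s.ev g ∘ₗ T)
  map_add' g h := rfl
  map_smul' l g := by
    refine s.ev_ext (fun φ => ?_)
    change s.ev g (T φ ∘ₗ s.act l) = s.ev g (T (φ ∘ₗ s.act l))
    rw [hT]

@[simp] lemma ev_dual {N : Type} [AddCommGroup N] [Module k N] [Module R N] [IsScalarTower k R N]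
    (T : (s.PP →ₗ[R] M) →ₗ[k] (s.PP →ₗ[R] N))
    (hT : ∀ l φ, T (φ ∘ₗ s.act l) = T φ ∘ₗ s.act l) (g : s.GG N W) (φ) :
    s.ev (s.dual (W := W) T hT g) φ = s.ev g (T φ) := rfl

/-- postcomposition as a `k`-linear map -/
def post {N : Type} [AddCommGroup N] [Module k N] [Module R N] [IsScalarTower k R N]
    (h : M →ₗ[R] N) : (s.PP →ₗ[R] M) →ₗ[k] (s.PP →ₗ[R] N) where
  toFun φ := h ∘ₗ φ
  map_add' φ ψ := LinearMap.comp_add _ _ _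
  map_smul' c φ := by
    ext x
    change h (c • φ x) = c • h (φ x)
    exact (h.restrictScalars k).map_smul c _

end GG

/-- component as a linear map -/
def compT (X : GMod gR) (j : ℤ) : (s.PP →ₗ[R] X.M) →ₗ[k] (s.PP →ₗ[R] X.M) where
  toFun φ := compR s.cP X.cp j φ
  map_add' φ ψ := by
    ext x
    apply X.g.ext'; intro m
    simp only [compR_pi, LinearMap.add_apply, map_add]
  map_smul' c φ := by
    ext x
    apply X.g.ext'; intro m
    simp only [compR_pi, LinearMap.smul_apply, map_smul, RingHom.id_apply]

lemma compT_pi (X : GMod gR) (j m : ℤ) (φ : s.PP →ₗ[R] X.M) (x) :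
    X.g.π m (s.compT X j φ x) = X.g.π m (φ (s.gP.π (m - j) x)) := compR_pi s.cP X.cp _ _ _ _

/-- The dg module attached to a graded module. -/
def GD (X : GMod gR) (W : Type 1) [AddCommGroup W] [Module k W] : DGM Λ where
  G := s.GG X.M W
  pr j := s.dual (s.compT X (-j)) (fun l φ => by
    ext x
    apply X.g.ext'; intro m
    rw [compT_pi, LinearMap.comp_apply, LinearMap.comp_apply, compT_pi, s.act_w])
  D := s.dual (s.pre X.M s.δ) (fun l φ => by
    ext x
    change φ (s.act l (s.δ x)) = φ (s.δ (s.act l x))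
    rw [s.δ_act])
  orth i j x := by
    refine s.ev_ext (fun φ => ?_)
    rw [ev_dual, ev_dual]
    have : s.compT X (-j) (s.compT X (-i) φ) = if i = j then s.compT X (-j) φ else 0 := by
      ext x
      apply X.g.ext'; intro m
      rw [compT_pi, compT_pi, s.gP.orth]
      by_cases h : i = j
      · subst h
        rw [if_pos rfl, if_pos rfl, compT_pi]
      · rw [if_neg (by omega), if_neg h]; simp
    rw [this]
    split_ifs
    · rfl
    · rw [map_zero]; rfl
  Dpr j x := by
    refine s.ev_ext (fun φ => ?_)
    rw [ev_dual, ev_dual, ev_dual, ev_dual]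
    congr 1
    ext x
    apply X.g.ext'; intro m
    change _ = X.g.π m (s.compT X (-(j + 1)) φ (s.δ x))
    rw [compT_pi, compT_pi]
    change X.g.π m (φ (s.δ _)) = _
    rw [s.δ_w]
    congr 4
    ring
  DD x := by
    refine s.ev_ext (fun φ => ?_)
    rw [ev_dual, ev_dual]
    have : s.pre X.M s.δ (s.pre X.M s.δ φ) = 0 := by
      ext x
      change φ (s.δ (s.δ x)) = 0
      rw [s.δδ, map_zero]
    rw [this, map_zero]; rfl

/-- functoriality -/
def GDm {X Y : GMod gR} (h : X.M →ₗ[R] Y.M) (hh : ∀ i x, h (X.g.π i x) = Y.g.π i (h x))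
    (W : Type 1) [AddCommGroup W] [Module k W] : DGM.Mor (s.GD Y W) (s.GD X W) where
  f := s.dual (s.post h) (fun l φ => rfl)
  fpr j g := by
    refine s.ev_ext (fun φ => ?_)
    change s.ev g (s.compT Y (-j) (h ∘ₗ φ)) = s.ev g (h ∘ₗ (s.compT X (-j) φ))
    congr 1
    ext x
    apply Y.g.ext'; intro m
    rw [compT_pi, LinearMap.comp_apply, LinearMap.comp_apply, ← hh, ← hh, compT_pi]
  fD g := rfl

variable [HasDerivedCategory.{2} (ModuleCat.{1} Λ)]

/-- uniform vanishing -/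
def E (X : GMod gR) : Prop := ∃ n0 : ℕ, ∀ (W : Type 1) [AddCommGroup W] [Module k W],
  DGM.VanD (s.GD X W) n0

section ses
variable {X Y Z : GMod gR} (h : X.M →ₗ[R] Y.M) (hh : ∀ i x, h (X.g.π i x) = Y.g.π i (h x))
  (q : Y.M →ₗ[R] Z.M) (hq : ∀ i x, q (Y.g.π i x) = Z.g.π i (q x))
  (hinj : Function.Injective h) (hsurj : Function.Surjective q) (hqh : ∀ x, q (h x) = 0)
  (hex : ∀ y, q y = 0 → ∃ x, h x = y)

lemma ses_inj (W : Type 1) [AddCommGroup W] [Module k W] (hsurj : Function.Surjective q) :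
    Function.Injective (s.GDm q hq W).f := by
  rw [injective_iff_map_eq_zero]
  intro g hg
  refine s.ev_ext (fun φ => ?_)
  obtain ⟨ψ, hψ⟩ := Module.projective_lifting_property q φ hsurj
  rw [← hψ]
  exact LinearMap.congr_fun hg ψ

lemma ses_surj (W : Type 1) [AddCommGroup W] [Module k W] (hinj : Function.Injective h) :
    Function.Surjective (s.GDm h hh W).f := by
  intro g
  have hi : Function.Injective (s.post h) := by
    intro a b hab
    ext x
    exact hinj (LinearMap.congr_fun hab x)
  obtain ⟨r, hr⟩ := LinearMap.exists_leftInverse_of_injective (s.post h) (LinearMap.ker_eq_bot.2 hi)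
  refine ⟨s.mkG (s.ev g ∘ₗ r), s.ev_ext (fun φ => ?_)⟩
  change s.ev g (r (s.post h φ)) = _
  exact congrArg (s.ev g) (LinearMap.congr_fun hr φ)

lemma ses_exact (W : Type 1) [AddCommGroup W] [Module k W] (hinj : Function.Injective h)
    (hsurj : Function.Surjective q) (hqh : ∀ x, q (h x) = 0) (hex : ∀ y, q y = 0 → ∃ x, h x = y)
    (g) (hg : (s.GDm h hh W).f g = 0) : ∃ g', (s.GDm q hq W).f g' = g := by
  have hs : Function.Surjective (s.post q) := by
    intro φ
    obtain ⟨ψ, hψ⟩ := Module.projective_lifting_property q φ hsurj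
    exact ⟨ψ, hψ⟩
  obtain ⟨r, hr⟩ := LinearMap.exists_rightInverse_of_surjective (s.post q) (LinearMap.range_eq_top.2 hs)
  refine ⟨s.mkG (s.ev g ∘ₗ r), s.ev_ext (fun φ => ?_)⟩
  change s.ev g (r (s.post q φ)) = _
  rw [← sub_eq_zero, ← map_sub]
  have h1 : s.post q (r (s.post q φ) - φ) = 0 := by
    rw [map_sub, sub_eq_zero]
    exact LinearMap.congr_fun hr _
  let e := LinearEquiv.ofInjective h hinj
  have h2 : ∀ x, (r (s.post q φ) - φ) x ∈ LinearMap.range h := by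
    intro x
    obtain ⟨y, hy⟩ := hex _ (LinearMap.congr_fun h1 x)
    exact ⟨y, hy⟩
  let ψ : s.PP →ₗ[R] X.M := e.symm.toLinearMap ∘ₗ ((r (s.post q φ) - φ).codRestrict _ h2)
  have h3 : s.post h ψ = r (s.post q φ) - φ := by
    ext x
    have := e.apply_symm_apply ((r (s.post q φ) - φ).codRestrict _ h2 x)
    exact congrArg Subtype.val this
  rw [← h3]
  exact LinearMap.congr_fun hg ψ


end ses

lemma E.ses₂ {X Y Z : GMod gR} (h : X.M →ₗ[R] Y.M) (hh : ∀ i x, h (X.g.π i x) = Y.g.π i (h x))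
    (q : Y.M →ₗ[R] Z.M) (hq : ∀ i x, q (Y.g.π i x) = Z.g.π i (q x))
    (hinj : Function.Injective h) (hsurj : Function.Surjective q) (hqh : ∀ x, q (h x) = 0)
    (hex : ∀ y, q y = 0 → ∃ x, h x = y) (h1 : s.E X) (h3 : s.E Z) : s.E Y := by
  obtain ⟨n1, h1⟩ := h1
  obtain ⟨n3, h3⟩ := h3
  refine ⟨n1 + n3, fun W _ _ => ?_⟩
  refine DGM.VanD.ses₂ (s.GDm q hq W) (s.GDm h hh W) ?_ (s.ses_inj q hq W hsurj)
    (s.ses_surj h hh W hinj) (s.ses_exact h hh q hq W hinj hsurj hqh hex)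
    ((h3 W).mono (by push_cast; omega)) ((h1 W).mono (by push_cast; omega))
  intro g
  refine s.ev_ext (fun φ => ?_)
  change s.ev g (q ∘ₗ h ∘ₗ φ) = 0
  have : q ∘ₗ h ∘ₗ φ = 0 := by ext x; exact hqh _
  rw [this, map_zero]

lemma E.ses₁ {X Y Z : GMod gR} (h : X.M →ₗ[R] Y.M) (hh : ∀ i x, h (X.g.π i x) = Y.g.π i (h x))
    (q : Y.M →ₗ[R] Z.M) (hq : ∀ i x, q (Y.g.π i x) = Z.g.π i (q x))
    (hinj : Function.Injective h) (hsurj : Function.Surjective q) (hqh : ∀ x, q (h x) = 0)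
    (hex : ∀ y, q y = 0 → ∃ x, h x = y) (h2 : s.E Y) (h3 : s.E Z) : s.E X := by
  obtain ⟨n1, h2⟩ := h2
  obtain ⟨n3, h3⟩ := h3
  refine ⟨n1 + n3, fun W _ _ => ?_⟩
  refine DGM.VanD.ses₃ (s.GDm q hq W) (s.GDm h hh W) ?_ (s.ses_inj q hq W hsurj)
    (s.ses_surj h hh W hinj) (s.ses_exact h hh q hq W hinj hsurj hqh hex)
    ((h3 W).mono (by push_cast; omega)) ((h2 W).mono (by push_cast; omega))
  intro g
  refine s.ev_ext (fun φ => ?_)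
  change s.ev g (q ∘ₗ h ∘ₗ φ) = 0
  have : q ∘ₗ h ∘ₗ φ = 0 := by ext x; exact hqh _
  rw [this, map_zero]

lemma E.acyclic (X : GMod gR)
    (h : ∀ φ : s.PP →ₗ[R] X.M, φ ∘ₗ s.δ = 0 → ∃ ψ : s.PP →ₗ[R] X.M, φ = ψ ∘ₗ s.δ) : s.E X := by
  refine ⟨0, fun W _ _ => DGM.VanD.acyclic _ (fun g hg => ?_) _⟩
  let d := s.pre X.M s.δ
  have hg' : ∀ φ, s.ev g (d φ) = 0 := fun φ => LinearMap.congr_fun hg φ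
  -- g kills the range of d, which is the kernel of d
  have hk : LinearMap.ker d ≤ LinearMap.ker (s.ev g) := by
    intro φ hφ
    obtain ⟨ψ, hψ⟩ := h φ hφ
    rw [LinearMap.mem_ker, hψ]
    exact hg' ψ
  obtain ⟨u, hu⟩ : ∃ u : (s.PP →ₗ[R] X.M) →ₗ[k] W, u ∘ₗ d = s.ev g := by
    let g0 := (LinearMap.ker d).liftQ (s.ev g) hk
    let g1 := g0 ∘ₗ d.quotKerEquivRange.symm.toLinearMap
    obtain ⟨u, hu⟩ := LinearMap.exists_extend g1
    refine ⟨u, ?_⟩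
    ext φ
    have h1 : u (d φ) = g1 ⟨d φ, LinearMap.mem_range_self d φ⟩ :=
      LinearMap.congr_fun hu ⟨d φ, LinearMap.mem_range_self d φ⟩
    have h2 : d.quotKerEquivRange.symm ⟨d φ, LinearMap.mem_range_self d φ⟩ =
        (LinearMap.ker d).mkQ φ := by
      rw [LinearEquiv.symm_apply_eq]; rfl
    rw [LinearMap.comp_apply, h1]
    change g0 (d.quotKerEquivRange.symm ⟨d φ, LinearMap.mem_range_self d φ⟩) = _
    rw [h2]; rfl
  exact ⟨s.mkG u, hu⟩

end Stp
end YGr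
end

noncomputable section
namespace YGr
set_option linter.unusedSectionVars false
open YDg

universe uu in
lemma baer_of_sum {Λ : Type uu} [Ring Λ] {G G' : Type uu} [AddCommGroup G] [Module Λ G]
    [AddCommGroup G'] [Module Λ G'] {ι : Type*} (t : Finset ι) (a : ι → G' →ₗ[Λ] G)
    (b : ι → G →ₗ[Λ] G') (h : ∀ x, ∑ i ∈ t, a i (b i x) = x)
    (hG : Injective (ModuleCat.of Λ G')) : Injective (ModuleCat.of Λ G) := by
  have h1 : Module.Injective Λ G' := (Module.injective_iff_injective_object Λ G').2 hG
  have h2 : Module.Baer Λ G' := Module.Baer.of_injective h1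
  have h3 : Module.Baer Λ G := by
    intro I φ
    choose v hv using fun i => h2 I ((b i) ∘ₗ φ)
    refine ⟨∑ i ∈ t, a i ∘ₗ v i, fun x hx => ?_⟩
    rw [LinearMap.sum_apply]
    conv_rhs => rw [← h (φ ⟨x, hx⟩)]
    refine Finset.sum_congr rfl (fun i _ => ?_)
    rw [LinearMap.comp_apply, hv i x hx, LinearMap.comp_apply]
  exact (Module.injective_iff_injective_object Λ G).1 h3.injective

variable {k R : Type} [Field k] [Ring R] [Algebra k R] {gR : GRg k R} {Λ : Type 1} [Ring Λ]

namespace Stp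
variable (s : Stp gR Λ)

/-- the bijection -/
def Φ (l : Λ) : s.PP →ₗ[R] s.S := s.ε ∘ₗ s.act l

lemma Φ_inj {a b : Λ} (h : s.Φ a = s.Φ b) : a = b := s.bij.1 h

/-- inverse of the bijection -/
def Ψ (φ : s.PP →ₗ[R] s.S) : Λ := (s.bij.2 φ).choose

@[simp] lemma Φ_Ψ (φ) : s.Φ (s.Ψ φ) = φ := (s.bij.2 φ).choose_spec
@[simp] lemma Ψ_Φ (l) : s.Ψ (s.Φ l) = l := s.Φ_inj (s.Φ_Ψ _)

lemma Φ_add (a b) : s.Φ (a + b) = s.Φ a + s.Φ b := by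
  unfold Φ; rw [map_add]; exact LinearMap.comp_add _ _ _

lemma Φ_mul (a b) : s.Φ (a * b) = s.Φ a ∘ₗ s.act b := by
  unfold Φ; rw [map_mul]; rfl

lemma Φ_one : s.Φ 1 = s.ε := by
  unfold Φ; rw [map_one]; rfl

lemma Φ_zero : s.Φ 0 = 0 := by
  unfold Φ; rw [map_zero]; exact LinearMap.comp_zero _

lemma smul_comp' (c : k) (φ : s.PP →ₗ[R] s.S) (t : s.PP →ₗ[R] s.PP) :
    (c • φ) ∘ₗ t = c • (φ ∘ₗ t) := rfl

/-- scalars in the Yoneda ring -/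
def κ : k →+* Λ where
  toFun c := s.Ψ (c • s.ε)
  map_one' := s.Φ_inj (by rw [Φ_Ψ, Φ_one, one_smul])
  map_zero' := s.Φ_inj (by rw [Φ_Ψ, Φ_zero, zero_smul])
  map_add' a b := s.Φ_inj (by rw [Φ_add, Φ_Ψ, Φ_Ψ, Φ_Ψ, add_smul])
  map_mul' a b := s.Φ_inj (by
    rw [Φ_mul, Φ_Ψ, Φ_Ψ, smul_comp']
    change _ = a • s.Φ (s.Ψ (b • s.ε))
    rw [Φ_Ψ, mul_smul])

lemma Φ_κ (c : k) : s.Φ (s.κ c) = c • s.ε := s.Φ_Ψ _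
lemma Φ_κ_mul (c : k) (l : Λ) : s.Φ (s.κ c * l) = c • s.Φ l := by
  rw [Φ_mul, Φ_κ]; rfl

lemma GG_S_inj (W : Type 1) [AddCommGroup W] [Module k W] :
    Injective (ModuleCat.of Λ (s.GG s.S W)) := by
  refine injective_of_coind s.κ (W := W)
    { toFun := fun g => s.ev g s.ε, map_zero' := rfl, map_add' := fun _ _ => rfl } ?_ ?_ ?_
  · intro c g
    change s.ev g (s.Φ (s.κ c)) = c • s.ev g s.ε
    rw [Φ_κ, map_smul]
  · intro u hu
    refine ⟨s.mkG
      { toFun := fun φ => u (s.Ψ φ)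
        map_add' := fun a b => ?_
        map_smul' := fun c a => ?_ }, fun l => ?_⟩
    · rw [← map_add]; congr 1
      exact s.Φ_inj (by rw [Φ_add, Φ_Ψ, Φ_Ψ, Φ_Ψ])
    · rw [RingHom.id_apply, ← hu]; congr 1
      exact s.Φ_inj (by rw [Φ_κ_mul, Φ_Ψ, Φ_Ψ])
    · change u (s.Ψ (s.Φ l)) = _
      rw [Ψ_Φ]
  · intro g hg
    refine s.ev_ext (fun φ => ?_)
    rw [← s.Φ_Ψ φ]
    exact hg (s.Ψ φ)

section onedeg
variable {N : Type} [AddCommGroup N] [Module k N] [Module R N] [IsScalarTower k R N]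
  [Module.Finite k N]

lemma deg_zero_smul {N : Type} [AddCommGroup N] [Module R N]
    (hN : ∀ i r (x : N), 0 < i → gR.π i r • x = 0) (r : R) (x : N) :
    r • x = gR.π 0 r • x := by
  refine gR.induct (p := fun r => r • x = gR.π 0 r • x) ?_ ?_ ?_ r
  · intro a b ha hb
    rw [map_add, add_smul, add_smul, ha, hb]
  · simp
  · intro i r
    rw [gR.orth]
    rcases lt_trichotomy i 0 with h | h | h
    · rw [gR.neg i r h]; simp
    · subst h; simp
    · rw [if_neg h.ne, hN i r x h]; simp

lemma exists_alpha (hN : ∀ i r (x : N), 0 < i → gR.π i r • x = 0) (he : ∀ x : N, s.e0 • x = x)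
    (m : N) : ∃ α : s.S →ₗ[R] N, ∀ r : R, α (r • s.s0) = r • m := by
  let p := LinearMap.toSpanSingleton R s.S s.s0
  let q := LinearMap.toSpanSingleton R N m
  have hp : Function.Surjective p := s.gen0
  have hk : LinearMap.ker p ≤ LinearMap.ker q := by
    intro r hr
    have h1 := s.ann r hr
    change r • m = 0
    rw [deg_zero_smul hN, ← he m, ← mul_smul, h1, zero_smul]
  refine ⟨(LinearMap.ker p).liftQ q hk ∘ₗ (p.quotKerEquivOfSurjective hp).symm.toLinearMap,
    fun r => ?_⟩
  have h2 : (p.quotKerEquivOfSurjective hp).symm (r • s.s0) = (LinearMap.ker p).mkQ r := by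
    rw [LinearEquiv.symm_apply_eq]; rfl
  change (LinearMap.ker p).liftQ q hk ((p.quotKerEquivOfSurjective hp).symm (r • s.s0)) = _
  rw [h2]; rfl

lemma csmul {N : Type} [AddCommGroup N] [Module k N] [Module R N] [IsScalarTower k R N]
    (c : k) (r : R) (x : N) : r • c • x = c • r • x := smul_comm _ _ _

lemma e_span_smul {N : Type} [AddCommGroup N] [Module k N] [Module R N] [IsScalarTower k R N]
    (hN : ∀ i r (x : N), 0 < i → gR.π i r • x = 0) (r : R) (c : Fin s.m → k)
    (hc : gR.π 0 r = ∑ i, c i • s.e i) (i) (x : N) : s.e i • r • x = c i • s.e i • x ∧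
      r • s.e i • x = c i • s.e i • x := by
  constructor
  · rw [deg_zero_smul hN r, hc, ← mul_smul, Finset.mul_sum]
    rw [Finset.sum_eq_single i]
    · rw [mul_smul_comm, s.eorth, if_pos rfl, smul_assoc]
    · intro j _ hj
      rw [mul_smul_comm, s.eorth, if_neg hj.symm, smul_zero]
    · simp
  · rw [deg_zero_smul hN r, hc, ← mul_smul, Finset.sum_mul]
    rw [Finset.sum_eq_single i]
    · rw [smul_mul_assoc, s.eorth, if_pos rfl, smul_assoc]
    · intro j _ hj
      rw [smul_mul_assoc, s.eorth, if_neg hj, smul_zero]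
    · simp

/-- maps to the semisimple module from functionals -/
def beta (hN : ∀ i r (x : N), 0 < i → gR.π i r • x = 0) (ξ : N →ₗ[k] k) : N →ₗ[R] s.S where
  toFun m := ∑ i, ξ (s.e i • m) • s.e i • s.s0
  map_add' a b := by
    simp only [smul_add, map_add, add_smul, Finset.sum_add_distrib]
  map_smul' r a := by
    obtain ⟨c, hc⟩ := s.espan r
    rw [RingHom.id_apply, Finset.smul_sum]
    refine Finset.sum_congr rfl (fun i _ => ?_)
    rw [(s.e_span_smul hN r c hc i a).1, csmul, (s.e_span_smul s.Splus r c hc i s.s0).2,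
      map_smul, smul_smul, smul_eq_mul, mul_comm]

lemma GG_inj (hN : ∀ i r (x : N), 0 < i → gR.π i r • x = 0) (he : ∀ x : N, s.e0 • x = x)
    (W : Type 1) [AddCommGroup W] [Module k W] :
    Injective (ModuleCat.of Λ (s.GG N W)) := by
  let b := Module.finBasis k N
  choose α hα using fun i => s.exists_alpha hN he (b i)
  refine baer_of_sum Finset.univ (fun i => s.dual (s.post (s.beta hN (b.coord i))) (fun _ _ => rfl))
    (fun i => s.dual (s.post (α i)) (fun _ _ => rfl)) ?_ (s.GG_S_inj W)
  intro g
  refine s.ev_ext (fun φ => ?_)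
  have key : ∑ i, s.post (α i) (s.post (s.beta hN (b.coord i)) φ) = φ := by
    ext x
    rw [LinearMap.sum_apply]
    change ∑ i, α i (s.beta hN (b.coord i) (φ x)) = φ x
    generalize φ x = y
    have h1 : ∀ i, α i (s.beta hN (b.coord i) y) = ∑ j, s.e j • (b.repr (s.e j • y) i • b i) := by
      intro i
      change α i (∑ j : Fin s.m, _) = _
      rw [map_sum]
      refine Finset.sum_congr rfl (fun j _ => ?_)
      rw [csmul, ← hα]
      exact ((α i).restrictScalars k).map_smul _ _
    simp only [h1]
    rw [Finset.sum_comm]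
    simp only [← Finset.smul_sum, b.sum_repr, ← mul_smul, s.eorth, if_true]
    rw [← Finset.sum_smul, s.esum, one_smul]
  have h2 : ∀ (t : Finset (Fin (Module.finrank k N))) (F : Fin (Module.finrank k N) → s.GG N W),
      s.ev (∑ i ∈ t, F i) φ = ∑ i ∈ t, s.ev (F i) φ := by
    intro t F
    exact map_sum (AddMonoidHom.mk' (fun g : s.GG N W => s.ev g φ) (fun _ _ => rfl)) F t
  rw [h2]
  conv_rhs => rw [← key, map_sum]
  rfl

end onedeg

variable [HasDerivedCategory.{2} (ModuleCat.{1} Λ)] [HasExt.{2} (ModuleCat.{1} Λ)]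

lemma E_onedeg (X : GMod gR) (t : ℤ) (ht : ∀ x, X.g.π t x = x) (he : ∀ x : X.M, s.e0 • x = x) :
    s.E X := by
  have hN : ∀ i r (x : X.M), 0 < i → gR.π i r • x = 0 := by
    intro i r x hi
    rw [← ht (gR.π i r • x), X.cp.c, ← ht x, X.g.orth, if_neg (by omega), smul_zero]
  have h0 : ∀ (φ : s.PP →ₗ[R] X.M) w x, w ≠ 0 → φ (s.gP.π w x) = 0 := by
    intro φ w x hw
    have h1 := s.gen w x hw
    refine AddSubgroup.closure_induction (p := fun z _ => φ z = 0) ?_ (map_zero _) ?_ ?_ h1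
    · rintro z ⟨i, r, y, hi, rfl⟩
      rw [map_smul, hN i r _ hi]
    · intro a b _ _ ha hb
      rw [map_add, ha, hb, add_zero]
    · intro a _ ha
      rw [map_neg, ha, neg_zero]
  have h1 : ∀ (φ : s.PP →ₗ[R] X.M) x, φ (s.gP.π 0 x) = φ x := by
    intro φ x
    refine s.gP.induct (p := fun x => φ (s.gP.π 0 x) = φ x) ?_ (by simp) ?_ x
    · intro a b ha hb
      rw [map_add, map_add, map_add, ha, hb]
    · intro i x
      by_cases hi : i = 0
      · subst hi; rw [s.gP.same]
      · rw [h0 φ i x hi, h0' s.gP hi, map_zero]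
  have h2 : ∀ φ, s.compT X t φ = φ := by
    intro φ
    ext x
    apply X.g.ext'; intro m
    rw [compT_pi]
    by_cases hm : m = t
    · subst hm
      rw [sub_self, h1]
    · rw [← ht (φ _), ← ht (φ x), X.g.orth, X.g.orth, if_neg hm, if_neg hm]
  refine ⟨(-t).toNat, fun W _ _ => ?_⟩
  refine DGM.VanD.mono ?_ (Int.self_le_toNat (-t))
  refine DGM.VanD.conc _ (-t) (fun g => ?_) (s.GG_inj hN he W)
  refine s.ev_ext (fun φ => ?_)
  change s.ev g (s.compT X (- -t) φ) = _
  rw [neg_neg, h2]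
where
  h0' {M : Type} [AddCommGroup M] [Module k M] (g : Grd k M) {i : ℤ} (hi : i ≠ 0) {x : M} :
      g.π 0 (g.π i x) = 0 := by rw [g.orth, if_neg hi.symm]

lemma E_of_e0 (n : ℕ) : ∀ (X : GMod gR) (hn : Module.finrank k X.M ≤ n)
    (he : ∀ x : X.M, s.e0 • x = x), s.E X := by
  classical
  induction n with
  | zero =>
    intro X hn he
    have : Subsingleton X.M := Module.finrank_zero_iff.1 (Nat.le_zero.1 hn)
    exact E.acyclic s X (fun φ _ => ⟨0, by ext x; exact Subsingleton.elim _ _⟩)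
  | succ n ih =>
    intro X hn he
    by_cases hs : Subsingleton X.M
    · exact E.acyclic s X (fun φ _ => ⟨0, by ext x; exact Subsingleton.elim _ _⟩)
    let T := (Finset.Icc (-(X.g.b : ℤ)) X.g.b).filter (fun i => X.g.π i ≠ 0)
    have hT : T.Nonempty := by
      by_contra hT
      rw [Finset.not_nonempty_iff_eq_empty] at hT
      refine hs ⟨fun x y => X.g.ext' (fun i => ?_)⟩
      by_cases hi : i ∈ Finset.Icc (-(X.g.b : ℤ)) X.g.b
      · have : i ∉ T := by rw [hT]; simp
        have h3 : X.g.π i = 0 := by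
          by_contra h4
          exact this (Finset.mem_filter.2 ⟨hi, h4⟩)
        rw [h3]; rfl
      · rw [X.g.supp i _ hi, X.g.supp i _ hi]
    let t := T.max' hT
    have ht : X.g.π t ≠ 0 := (Finset.mem_filter.1 (T.max'_mem hT)).2
    have ht' : ∀ i x, t < i → X.g.π i x = 0 := by
      intro i x hi
      by_cases h4 : i ∈ Finset.Icc (-(X.g.b : ℤ)) X.g.b
      · by_contra h3
        have h5 : i ∈ T := Finset.mem_filter.2 ⟨h4, fun h6 => h3 (by rw [h6]; rfl)⟩
        exact absurd (T.le_max' i h5) (not_le.2 hi)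
      · exact X.g.supp i x h4
    let S : Submodule R X.M :=
      { carrier := {x | X.g.π t x = x}
        add_mem' := fun {a b} ha hb => by
          change X.g.π t (a + b) = a + b
          rw [map_add]; exact congrArg₂ _ ha hb
        zero_mem' := map_zero _
        smul_mem' := fun r x hx => by
          change X.g.π t (r • x) = r • x
          have hx' : X.g.π t x = x := hx
          refine gR.induct (p := fun r => X.g.π t (r • x) = r • x) ?_ ?_ ?_ r
          · intro a b ha hb
            rw [add_smul, map_add, ha, hb]
          · simp
          · intro i r
            rcases lt_trichotomy i 0 with h | h | h
            · rw [gR.neg i r h]; simp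
            · subst h
              rw [X.cp.c, sub_zero, hx']
            · have h7 : gR.π i r • x = 0 := by
                rw [← hx', ← X.cp, ht' _ _ (by omega)]
              rw [h7, map_zero] }
    have hS : ∀ i, ∀ x ∈ S, X.g.π i x ∈ S := by
      intro i x hx
      have hx' : X.g.π t x = x := hx
      change X.g.π t (X.g.π i x) = X.g.π i x
      rw [X.g.orth]
      split_ifs with h
      · rfl
      · rw [← hx', X.g.orth, if_neg (Ne.symm h)]
    have hN : s.E (X.sub S hS) := s.E_onedeg _ t (fun x => Subtype.ext x.2)
      (fun x => Subtype.ext (he x.1))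
    have hQ : s.E (X.quot S hS) := by
      refine ih _ ?_ ?_
      · have h8 := Submodule.finrank_quotient_add_finrank (S.restrictScalars k)
        have h9 : 0 < Module.finrank k (S.restrictScalars k) := by
          rw [Module.finrank_pos_iff]
          obtain ⟨x, hx⟩ : ∃ x, X.g.π t x ≠ 0 := by
            by_contra h
            push Not at h
            exact ht (LinearMap.ext h)
          exact ⟨⟨X.g.π t x, X.g.same t x⟩, 0, fun h => hx (congrArg Subtype.val h)⟩
        have h10 : Module.finrank k (X.quot S hS).M = Module.finrank k (X.M ⧸ S.restrictScalars k) := rfl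
        omega
      · intro x
        obtain ⟨x, rfl⟩ := Submodule.Quotient.mk_surjective _ x
        exact congrArg S.mkQ (he x)
    exact E.ses₂ s (X := X.sub S hS) (Z := X.quot S hS) S.subtype (fun _ _ => rfl) S.mkQ
      (fun _ _ => rfl) S.injective_subtype S.mkQ_surjective
      (fun x => (Submodule.Quotient.mk_eq_zero S).2 x.2)
      (fun y hy => ⟨⟨y, (Submodule.Quotient.mk_eq_zero S).1 hy⟩, rfl⟩) hN hQ

end Stp
end YGr
end

noncomputable section
namespace YGr
set_option linter.unusedSectionVars false
open YDg

/-- A ring identified with the corner of an idempotent. -/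
structure Cor {R : Type} [Ring R] (f : R) (Γ : Type) [Ring Γ] where
  τ : Γ →+ R
  mul : ∀ a b, τ (a * b) = τ a * τ b
  inj : Function.Injective τ
  one : τ 1 = f
  rng : ∀ x, f * x * f = x → ∃ g, τ g = x

namespace Cor
variable {R : Type} [Ring R] {f : R} {Γ : Type} [Ring Γ] (c : Cor f Γ)

lemma f_τ (g) : f * c.τ g = c.τ g := by
  have := c.mul 1 g
  rw [c.one, one_mul] at this; exact this.symm
lemma τ_f (g) : c.τ g * f = c.τ g := by
  have := c.mul g 1
  rw [c.one, mul_one] at this; exact this.symm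
lemma ff (c : Cor f Γ) : f * f = f := by
  have := c.f_τ 1
  rwa [c.one] at this
lemma f_τ_f (g) : f * c.τ g * f = c.τ g := by rw [f_τ, τ_f]

/-- inverse -/
def inv (x : R) : Γ := (c.rng (f * x * f) (by
  simp only [mul_assoc, c.ff]; simp only [← mul_assoc, c.ff])).choose

lemma τ_inv (x : R) : c.τ (c.inv x) = f * x * f := (c.rng (f * x * f) (by
  simp only [mul_assoc, c.ff]; simp only [← mul_assoc, c.ff])).choose_spec

lemma inv_τ (g) : c.inv (c.τ g) = g := c.inj (by rw [τ_inv, f_τ_f])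
lemma inv_add (x y) : c.inv (x + y) = c.inv x + c.inv y := c.inj (by
  rw [map_add, τ_inv, τ_inv, τ_inv, mul_add, add_mul])

/-- The image of a module under the idempotent. -/
def FM (c : Cor f Γ) (M : Type) [AddCommGroup M] [Module R M] : AddSubgroup M where
  carrier := {m | f • m = m}
  add_mem' {a b} ha hb := by
    change f • (a + b) = a + b
    rw [smul_add]; exact congrArg₂ _ ha hb
  zero_mem' := smul_zero _
  neg_mem' {a} ha := by
    change f • (-a) = -a
    rw [smul_neg]; exact congrArg _ ha

variable {M N : Type} [AddCommGroup M] [Module R M] [AddCommGroup N] [Module R N]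

lemma fx (x : c.FM M) : f • x.1 = x.1 := x.2

/-- projection -/
def pj (m : M) : c.FM M := ⟨f • m, by change f • f • m = _; rw [← mul_smul, c.ff]⟩

instance : Module Γ (c.FM M) where
  smul g x := ⟨c.τ g • x.1, by change f • c.τ g • x.1 = _; rw [← mul_smul, c.f_τ]⟩
  one_smul x := Subtype.ext (by change c.τ 1 • x.1 = _; rw [c.one]; exact x.2)
  mul_smul a b x := Subtype.ext (by change c.τ (a * b) • x.1 = _; rw [c.mul, mul_smul]; rfl)
  smul_zero a := Subtype.ext (smul_zero _)
  smul_add a x y := Subtype.ext (smul_add _ _ _)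
  add_smul a b x := Subtype.ext (by change c.τ (a + b) • x.1 = _; rw [map_add, add_smul]; rfl)
  zero_smul x := Subtype.ext (by change c.τ 0 • x.1 = _; rw [map_zero, zero_smul]; rfl)

lemma smul_val (g : Γ) (x : c.FM M) : (g • x).1 = c.τ g • x.1 := rfl

/-- functoriality -/
def map (h : M →ₗ[R] N) : c.FM M →ₗ[Γ] c.FM N where
  toFun x := ⟨h x.1, by change f • h x.1 = _; rw [← map_smul]; exact congrArg h x.2⟩
  map_add' x y := Subtype.ext (map_add h _ _)
  map_smul' g x := Subtype.ext (map_smul h _ _)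

lemma map_val (h : M →ₗ[R] N) (x : c.FM M) : (c.map h x).1 = h x.1 := rfl

end Cor

variable {k R : Type} [Field k] [Ring R] [Algebra k R] {gR : GRg k R} {Λ : Type 1} [Ring Λ]

/-- Coinduced module. -/
def CoI (k R M : Type) [Field k] [Ring R] [Algebra k R] [AddCommGroup M] [Module k M] : Type :=
  R →ₗ[k] M

namespace CoI
variable {M : Type} [AddCommGroup M] [Module k M]
instance : AddCommGroup (CoI k R M) := inferInstanceAs (AddCommGroup (R →ₗ[k] M))
instance : Module k (CoI k R M) := inferInstanceAs (Module k (R →ₗ[k] M))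
instance [Module.Finite k R] [Module.Finite k M] : Module.Finite k (CoI k R M) :=
  inferInstanceAs (Module.Finite k (R →ₗ[k] M))
/-- evaluation -/
def ap (h : CoI k R M) : R →ₗ[k] M := h
/-- constructor -/
def mk (h : R →ₗ[k] M) : CoI k R M := h
lemma ext {h g : CoI k R M} (H : ∀ x, h.ap x = g.ap x) : h = g := LinearMap.ext H
@[simp] lemma ap_mk (h : R →ₗ[k] M) : (mk h).ap = h := rfl
@[simp] lemma ap_add (h g : CoI k R M) : (h + g).ap = h.ap + g.ap := rfl
@[simp] lemma ap_zero : (0 : CoI k R M).ap = 0 := rfl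
@[simp] lemma ap_ksmul (c : k) (h : CoI k R M) : (c • h).ap = c • h.ap := rfl
instance : Module R (CoI k R M) where
  smul r h := mk (h.ap ∘ₗ LinearMap.mulRight k r)
  one_smul h := ext (fun x => by change h.ap (x * 1) = _; rw [mul_one])
  mul_smul a b h := ext (fun x => by change h.ap (x * (a * b)) = h.ap (x * a * b); rw [mul_assoc])
  smul_zero r := rfl
  smul_add r h g := rfl
  add_smul a b h := ext (fun x => by
    change h.ap (x * (a + b)) = h.ap (x * a) + h.ap (x * b); rw [mul_add, map_add])
  zero_smul h := ext (fun x => by change h.ap (x * 0) = _; rw [mul_zero, map_zero]; rfl)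
@[simp] lemma ap_smul (r : R) (h : CoI k R M) (x) : (r • h).ap x = h.ap (x * r) := rfl
instance : IsScalarTower k R (CoI k R M) where
  smul_assoc c r h := ext (fun x => by
    change h.ap (x * (c • r)) = c • h.ap (x * r)
    rw [mul_smul_comm, map_smul])

/-- the grading -/
def gr (gR : GRg k R) (g : Grd k M) : Grd k (CoI k R M) := Grd.hom gR.toGrd g

lemma gr_pi (gR : GRg k R) (g : Grd k M) (j m : ℤ) (h : CoI k R M) (x : R) :
    g.π m (((gr gR g).π j h).ap x) = g.π m (h.ap (gR.π (m - j) x)) :=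
  Grd.pi_comp gR.toGrd g j m h.ap x

lemma mul_pi (gR : GRg k R) (n i : ℤ) (x a : R) :
    gR.π n (x * gR.π i a) = gR.π (n - i) x * gR.π i a := by
  refine gR.induct (p := fun x => gR.π n (x * gR.π i a) = gR.π (n - i) x * gR.π i a) ?_ ?_ ?_ x
  · intro x y hx hy
    rw [add_mul, map_add, hx, hy, map_add, add_mul]
  · simp
  · intro l x
    have h1 : gR.π n (gR.π l x * gR.π i a) = gR.π l x * gR.π (n - l) (gR.π i a) := by
      have := gR.cpt l (n - l) x (gR.π i a)
      rwa [add_sub_cancel] at this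
    rw [h1, gR.orth, gR.orth]
    by_cases h : n - l = i
    · rw [if_pos h, if_pos (by omega)]
    · rw [if_neg h, if_neg (by omega)]; simp

lemma cpt (gR : GRg k R) (g : Grd k M) : Cpt gR (gr gR g) := by
  intro i j a h
  refine ext (fun x => ?_)
  apply g.ext'; intro m
  rw [gr_pi, ap_smul, ap_smul, gr_pi, mul_pi]
  rw [show m - (i + j) = m - j - i by ring]

end CoI

lemma GRg.self_cpt (gR : GRg k R) : Cpt gR gR.toGrd := gR.cpt

lemma GRg.mul_zero_left (gR : GRg k R) {f : R} (hf : gR.π 0 f = f) (m : ℤ) (x : R) :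
    gR.π m (f * x) = f * gR.π m x := gR.self_cpt.zero m hf x

variable [Module.Finite k R]

/-- coinduced graded module -/
def GMod.coI (X : GMod gR) : GMod gR where
  M := CoI k R X.M
  g := CoI.gr gR X.g
  cp := CoI.cpt gR X.g

section cosub
variable (f : R) (hf : f * f = f) (hf0 : gR.π 0 f = f)

/-- first submodule -/
def If (M : Type) [AddCommGroup M] [Module k M] : Submodule R (CoI k R M) where
  carrier := {h | ∀ x, h.ap (f * x) = h.ap x}
  add_mem' {a b} ha hb x := by
    rw [CoI.ap_add, LinearMap.add_apply, LinearMap.add_apply, ha, hb]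
  zero_mem' x := rfl
  smul_mem' r h hh x := by
    rw [CoI.ap_smul, CoI.ap_smul, mul_assoc]; exact hh _

/-- second submodule -/
def Co (M : Type) [AddCommGroup M] [Module k M] [Module R M] : Submodule R (CoI k R M) where
  carrier := {h | (∀ x, h.ap (f * x) = h.ap x) ∧ (∀ x, f • h.ap x = h.ap x) ∧
    ∀ r x, h.ap (f * r * f * x) = (f * r * f) • h.ap x}
  add_mem' {a b} ha hb := by
    refine ⟨fun x => by rw [CoI.ap_add, LinearMap.add_apply, LinearMap.add_apply, ha.1, hb.1], fun x => ?_, fun r x => ?_⟩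
    · rw [CoI.ap_add, LinearMap.add_apply, smul_add, ha.2.1, hb.2.1]
    · rw [CoI.ap_add, LinearMap.add_apply, LinearMap.add_apply, smul_add, ha.2.2, hb.2.2]
  zero_mem' := ⟨fun x => rfl, fun x => smul_zero _, fun r x => (smul_zero _).symm⟩
  smul_mem' r h hh := by
    refine ⟨fun x => ?_, fun x => hh.2.1 _, fun t x => ?_⟩
    · rw [CoI.ap_smul, CoI.ap_smul, mul_assoc]; exact hh.1 _
    · rw [CoI.ap_smul, CoI.ap_smul, mul_assoc _ x r]; exact hh.2.2 _ _

/-- the unit -/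
def eta (M : Type) [AddCommGroup M] [Module k M] [Module R M] [IsScalarTower k R M] :
    M →ₗ[R] CoI k R M where
  toFun m := CoI.mk
    { toFun := fun x => f • x • m
      map_add' := fun x y => by rw [add_smul, smul_add]
      map_smul' := fun c x => by rw [RingHom.id_apply, smul_assoc, smul_comm] }
  map_add' a b := CoI.ext (fun x => by
    change f • x • (a + b) = f • x • a + f • x • b
    rw [smul_add, smul_add])
  map_smul' r a := CoI.ext (fun x => by
    change f • x • r • a = f • (x * r) • a
    rw [mul_smul])

lemma eta_ap (M : Type) [AddCommGroup M] [Module k M] [Module R M] [IsScalarTower k R M]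
    (m : M) (x : R) : (eta (k := k) f M m).ap x = f • x • m := rfl

lemma eta_gr (hf0 : gR.π 0 f = f) (X : GMod gR) (i : ℤ) (m : X.M) :
    eta (k := k) f X.M (X.g.π i m) = X.coI.g.π i (eta f X.M m) := by
  refine CoI.ext (fun x => ?_)
  apply X.g.ext'; intro n
  refine Eq.trans ?_ (CoI.gr_pi gR X.g i n (eta f X.M m) x).symm
  rw [eta_ap, eta_ap, X.cp.zero _ hf0, X.cp.zero _ hf0]
  congr 1
  refine gR.induct (p := fun x => X.g.π n (x • X.g.π i m) = X.g.π n (gR.π (n - i) x • m)) ?_ ?_ ?_ x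
  · intro a b ha hb
    rw [add_smul, map_add, ha, hb, map_add, add_smul, map_add]
  · simp
  · intro l x
    rw [X.cp.c, X.g.orth, gR.orth]
    by_cases h : n - l = i
    · rw [if_pos h, if_pos (by omega), X.cp.c, h]
    · rw [if_neg h, if_neg (by omega)]; simp

lemma If_hom (hf0 : gR.π 0 f = f) (X : GMod gR) : ∀ i, ∀ x ∈ If (k := k) f X.M,
    X.coI.g.π i x ∈ If (k := k) f X.M := by
  intro i h hh x
  apply X.g.ext'; intro m
  refine (CoI.gr_pi gR X.g i m h _).trans (Eq.trans ?_ (CoI.gr_pi gR X.g i m h _).symm)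
  rw [gR.mul_zero_left hf0, hh]

lemma Co_hom (hf0 : gR.π 0 f = f) (X : GMod gR) : ∀ i, ∀ x ∈ Co (k := k) f X.M,
    X.coI.g.π i x ∈ Co (k := k) f X.M := by
  intro i h hh
  refine ⟨?_, ?_, ?_⟩
  · intro x
    apply X.g.ext'; intro m
    refine (CoI.gr_pi gR X.g i m h _).trans (Eq.trans ?_ (CoI.gr_pi gR X.g i m h _).symm)
    rw [gR.mul_zero_left hf0, hh.1]
  · intro x
    apply X.g.ext'; intro m
    rw [X.cp.zero _ hf0]
    refine (congrArg (f • ·) (CoI.gr_pi gR X.g i m h _)).trans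
      (Eq.trans ?_ (CoI.gr_pi gR X.g i m h _).symm)
    change f • _ = _
    rw [← X.cp.zero _ hf0, hh.2.1]
  · intro r x
    refine gR.induct (p := fun r => (X.coI.g.π i h).ap (f * r * f * x) =
      (f * r * f) • (X.coI.g.π i h).ap x) ?_ ?_ ?_ r
    · intro a b ha hb
      rw [mul_add, add_mul, add_mul, map_add, ha, hb, add_smul]
    · simp
    · intro j r
      apply X.g.ext'; intro m
      have h1 : f * gR.π j r * f = gR.π j (f * r * f) := by
        rw [← hf0, CoI.mul_pi, sub_zero, hf0, gR.mul_zero_left hf0]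
      refine (CoI.gr_pi gR X.g i m h _).trans ?_
      rw [h1, X.cp.c]
      refine Eq.trans ?_ (congrArg (gR.π j (f * r * f) • ·) (CoI.gr_pi gR X.g i _ h _).symm)
      change _ = gR.π j (f * r * f) • _
      have h2 : gR.π (m - i) (gR.π j (f * r * f) * x) = gR.π j (f * r * f) * gR.π (m - i - j) x :=
        gR.self_cpt.c _ _ _ _
      rw [h2, ← X.cp.c, ← h1, hh.2.2, sub_right_comm]

end cosub

/-- graded module version -/
def GMod.iF (f : R) (hf0 : gR.π 0 f = f) (X : GMod gR) : GMod gR :=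
  X.coI.sub (If f X.M) (If_hom f hf0 X)

/-- graded module version -/
def GMod.cO (f : R) (hf0 : gR.π 0 f = f) (X : GMod gR) : GMod gR :=
  X.coI.sub (Co f X.M) (Co_hom f hf0 X)

/-- unit map -/
def GMod.etaI (f : R) (hf0 : gR.π 0 f = f) (hf : f * f = f) (X : GMod gR) :
    X.M →ₗ[R] (X.iF f hf0).M :=
  LinearMap.codRestrict (If f X.M) (eta f X.M) (fun m x => by
    rw [eta_ap, eta_ap, mul_smul, ← mul_smul f f, hf])

/-- unit map -/
def GMod.etaC (f : R) (hf0 : gR.π 0 f = f) (hf : f * f = f) (X : GMod gR) :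
    X.M →ₗ[R] (X.cO f hf0).M :=
  LinearMap.codRestrict (Co f X.M) (eta f X.M) (fun m => by
    refine ⟨fun x => ?_, fun x => ?_, fun r x => ?_⟩
    · rw [eta_ap, eta_ap, mul_smul, ← mul_smul f f, hf]
    · rw [eta_ap, ← mul_smul f f, hf]
    · rw [eta_ap, eta_ap, ← mul_smul, ← mul_smul, ← mul_smul]
      congr 1
      simp only [← mul_assoc, hf]
      rw [mul_assoc _ f f, hf])

lemma etaI_gr (f : R) (hf0 : gR.π 0 f = f) (hf : f * f = f) (X : GMod gR) (i : ℤ) (m : X.M) :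
    X.etaI f hf0 hf (X.g.π i m) = (X.iF f hf0).g.π i (X.etaI f hf0 hf m) :=
  Subtype.ext (eta_gr f hf0 X i m)

lemma etaC_gr (f : R) (hf0 : gR.π 0 f = f) (hf : f * f = f) (X : GMod gR) (i : ℤ) (m : X.M) :
    X.etaC f hf0 hf (X.g.π i m) = (X.cO f hf0).g.π i (X.etaC f hf0 hf m) :=
  Subtype.ext (eta_gr f hf0 X i m)

namespace Stp
variable (s : Stp gR Λ) [HasDerivedCategory.{2} (ModuleCat.{1} Λ)] [HasExt.{2} (ModuleCat.{1} Λ)]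

lemma rng_hom {X Y : GMod gR} (h : X.M →ₗ[R] Y.M) (hh : ∀ i x, h (X.g.π i x) = Y.g.π i (h x)) :
    ∀ i, ∀ x ∈ LinearMap.range h, Y.g.π i x ∈ LinearMap.range h := by
  rintro i _ ⟨x, rfl⟩
  exact ⟨X.g.π i x, hh i x⟩

lemma ker_hom {X Y : GMod gR} (h : X.M →ₗ[R] Y.M) (hh : ∀ i x, h (X.g.π i x) = Y.g.π i (h x)) :
    ∀ i, ∀ x ∈ LinearMap.ker h, X.g.π i x ∈ LinearMap.ker h := by
  intro i x hx
  rw [LinearMap.mem_ker] at *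
  rw [hh, hx, map_zero]

lemma E_of_map {X Y : GMod gR} (h : X.M →ₗ[R] Y.M) (hh : ∀ i x, h (X.g.π i x) = Y.g.π i (h x))
    (hk : ∀ x, h x = 0 → s.e0 • x = x) (hY : s.E Y)
    (hQ : s.E (Y.quot (LinearMap.range h) (rng_hom h hh))) : s.E X := by
  let S := LinearMap.range h
  have hR : s.E (Y.sub S (rng_hom h hh)) :=
    E.ses₁ s (X := Y.sub S (rng_hom h hh)) (Z := Y.quot S (rng_hom h hh)) S.subtype
      (fun _ _ => rfl) S.mkQ
      (fun _ _ => rfl) S.injective_subtype S.mkQ_surjective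
      (fun x => (Submodule.Quotient.mk_eq_zero S).2 x.2)
      (fun y hy => ⟨⟨y, (Submodule.Quotient.mk_eq_zero S).1 hy⟩, rfl⟩) hY hQ
  have hK : s.E (X.sub (LinearMap.ker h) (ker_hom h hh)) :=
    s.E_of_e0 _ _ le_rfl (fun x => Subtype.ext (hk x.1 x.2))
  exact E.ses₂ s (X := X.sub (LinearMap.ker h) (ker_hom h hh)) (Z := Y.sub S (rng_hom h hh))
    (LinearMap.ker h).subtype (fun _ _ => rfl) h.rangeRestrict
    (fun i x => Subtype.ext (hh i x)) (Submodule.injective_subtype _) h.surjective_rangeRestrict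
    (fun x => Subtype.ext x.2) (fun y hy => ⟨⟨y, congrArg Subtype.val hy⟩, rfl⟩) hK hR

variable {Γ : Type} [Ring Γ] (c : Cor (1 - s.e0) Γ)

lemma f_deg : gR.π 0 (1 - s.e0) = 1 - s.e0 := by rw [map_sub, gR.one, s.e0deg]

lemma f_zero_iff {M : Type} [AddCommGroup M] [Module R M] (x : M) :
    (1 - s.e0) • x = 0 ↔ s.e0 • x = x := by
  rw [sub_smul, one_smul, sub_eq_zero, eq_comm]

end Stp
end YGr
end

noncomputable section
namespace YGr
set_option linter.unusedSectionVars false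
open YDg
variable {k R : Type} [Field k] [Ring R] [Algebra k R] {gR : GRg k R} {Λ : Type 1} [Ring Λ]

namespace Cor
variable {f : R} {Γ : Type} [Ring Γ] (c : Cor f Γ)

/-- scalars in the corner -/
def κ : k →+* Γ where
  toFun a := c.inv (a • f)
  map_one' := c.inj (by rw [c.τ_inv, c.one, one_smul, c.ff, c.ff])
  map_zero' := c.inj (by rw [c.τ_inv, map_zero, zero_smul]; simp)
  map_add' a b := by rw [add_smul, c.inv_add]
  map_mul' a b := c.inj (by
    rw [c.mul, c.τ_inv, c.τ_inv, c.τ_inv]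
    simp only [mul_smul_comm, smul_mul_assoc, c.ff, smul_smul, mul_comm b a])

lemma τ_κ (a : k) : c.τ (c.κ a) = a • f := by
  refine (c.τ_inv _).trans ?_
  simp only [mul_smul_comm, smul_mul_assoc, c.ff]

lemma If_inj (M : Type) [AddCommGroup M] [Module k M] :
    Injective (ModuleCat.of Γ (c.FM (If (k := k) f M))) := by
  have hfix : ∀ (h : c.FM (If (k := k) f M)) x, h.1.1.ap (x * f) = h.1.1.ap x := by
    intro h x
    exact congrArg (fun z : If (k := k) f M => z.1.ap x) h.2
  have hfix2 : ∀ (h : c.FM (If (k := k) f M)) x, h.1.1.ap (f * x) = h.1.1.ap x := fun h x => h.1.2 x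
  refine injective_of_coind (c.κ (k := k)) (W := M)
    { toFun := fun h => h.1.1.ap 1, map_zero' := rfl, map_add' := fun _ _ => rfl } ?_ ?_ ?_
  · intro a h
    change h.1.1.ap (1 * c.τ (c.κ a)) = a • h.1.1.ap 1
    have h2 := hfix h 1
    rw [one_mul] at h2
    rw [one_mul, c.τ_κ, map_smul, h2]
  · intro u hu
    have hk : ∀ (a : k) x, u (c.inv (a • x)) = a • u (c.inv x) := by
      intro a x
      rw [← hu]; congr 1
      apply c.inj
      rw [c.mul, c.τ_inv, c.τ_inv, c.τ_κ]
      simp only [mul_smul_comm, smul_mul_assoc, ← mul_assoc, c.ff]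
    let h : CoI k R M := CoI.mk
      { toFun := fun x => u (c.inv x)
        map_add' := fun x y => by rw [c.inv_add, map_add]
        map_smul' := fun a x => hk a x }
    have h1 : ∀ x, h.ap (f * x) = h.ap x := by
      intro x
      change u (c.inv (f * x)) = u (c.inv x)
      congr 1; apply c.inj
      rw [c.τ_inv, c.τ_inv, ← mul_assoc, c.ff]
    refine ⟨⟨⟨h, h1⟩, ?_⟩, ?_⟩
    · apply Subtype.ext
      refine CoI.ext (fun x => ?_)
      change u (c.inv (x * f)) = u (c.inv x)
      congr 1; apply c.inj
      rw [c.τ_inv, c.τ_inv, ← mul_assoc, mul_assoc _ f f, c.ff]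
    · intro l
      change u (c.inv (1 * c.τ l)) = u l
      rw [one_mul, c.inv_τ]
  · intro h hh
    apply Subtype.ext; apply Subtype.ext
    refine CoI.ext (fun x => ?_)
    have h1 : h.1.1.ap (1 * c.τ (c.inv x)) = 0 := hh (c.inv x)
    rw [one_mul, c.τ_inv, hfix, hfix2] at h1
    exact h1

end Cor
variable [Module.Finite k R]
namespace Stp
variable (s : Stp gR Λ) [HasDerivedCategory.{2} (ModuleCat.{1} Λ)] [HasExt.{2} (ModuleCat.{1} Λ)]
variable {Γ : Type} [Ring Γ] (c : Cor (1 - s.e0) Γ)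

lemma E_Co (X : GMod gR) (hX : Module.Injective Γ (c.FM X.M)) :
    s.E (X.cO (1 - s.e0) s.f_deg) := by
  refine E.acyclic s _ (fun φ hφ => ?_)
  let φ' : s.PP →ₗ[R] Co (k := k) (1 - s.e0) X.M := φ
  have hφ0 : ∀ y, φ' (s.δ y) = 0 := fun y => LinearMap.congr_fun hφ y
  let u : c.FM s.PP →ₗ[Γ] c.FM X.M :=
    { toFun := fun y => ⟨(φ' y.1).1.ap 1, (φ' y.1).2.2.1 1⟩
      map_add' := fun y z => by
        apply Subtype.ext
        change (φ' (y.1 + z.1)).1.ap 1 = _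
        rw [map_add]; rfl
      map_smul' := fun g y => by
        apply Subtype.ext
        change (φ' (c.τ g • y.1)).1.ap 1 = c.τ g • (φ' y.1).1.ap 1
        rw [map_smul]
        change (φ' y.1).1.ap (1 * c.τ g) = _
        have := (φ' y.1).2.2.2 (c.τ g) 1
        rw [c.f_τ_f, mul_one] at this
        rw [one_mul, this] }
  let d := c.map s.δ
  have hS : ∀ x : s.S, (1 - s.e0) • x = 0 := fun x => (s.f_zero_iff x).2 (s.e0S x)
  have hk : LinearMap.ker d ≤ LinearMap.ker u := by
    intro y hy
    have h1 : s.δ y.1 = 0 := congrArg Subtype.val hy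
    have h2 : s.ε y.1 = 0 := by
      rw [← c.fx y, map_smul, hS]
    obtain ⟨z, hz⟩ := s.ex1 _ h1 h2
    apply Subtype.ext
    change (φ' y.1).1.ap 1 = 0
    rw [← hz, hφ0]; rfl
  obtain ⟨v, hv⟩ := hX.out ((LinearMap.ker d).liftQ d le_rfl)
    (LinearMap.ker_eq_bot.1 (Submodule.ker_liftQ_eq_bot _ _ _ le_rfl))
    ((LinearMap.ker d).liftQ u hk)
  have hv' : ∀ y, v (d y) = u y := fun y => hv ((LinearMap.ker d).mkQ y)
  have hvk : ∀ (a : k) (y : s.PP), (v (c.pj (a • y))).1 = a • (v (c.pj y)).1 := by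
    intro a y
    have h1 : c.pj (a • y) = c.κ a • c.pj y := by
      apply Subtype.ext
      change (1 - s.e0) • a • y = c.τ (c.κ a) • (1 - s.e0) • y
      rw [c.τ_κ, csmul, smul_assoc, ← mul_smul _ _ y, c.ff]
    rw [h1, map_smul, c.smul_val, c.τ_κ, smul_assoc, c.fx]
  have pj_add : ∀ a b : s.PP, c.pj (a + b) = c.pj a + c.pj b := by
    intro a b; apply Subtype.ext; exact smul_add _ _ _
  have pj_f : ∀ a : s.PP, c.pj ((1 - s.e0) • a) = c.pj a := by
    intro a; apply Subtype.ext
    change (1 - s.e0) • (1 - s.e0) • a = (1 - s.e0) • a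
    rw [← mul_smul, c.ff]
  let ψ0 : s.PP →ₗ[R] CoI k R X.M :=
    { toFun := fun y => CoI.mk
        { toFun := fun x => (v (c.pj (x • y))).1
          map_add' := fun a b => by rw [add_smul, pj_add, map_add]; rfl
          map_smul' := fun a x => by rw [smul_assoc, hvk]; rfl }
      map_add' := fun a b => by
        refine CoI.ext (fun x => ?_)
        change (v (c.pj (x • (a + b)))).1 = (v (c.pj (x • a))).1 + (v (c.pj (x • b))).1
        rw [smul_add, pj_add, map_add]; rfl
      map_smul' := fun r a => by
        refine CoI.ext (fun x => ?_)
        change (v (c.pj (x • r • a))).1 = (v (c.pj ((x * r) • a))).1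
        rw [mul_smul] }
  have hψ0 : ∀ y, ψ0 y ∈ Co (k := k) (1 - s.e0) X.M := by
    intro y
    refine ⟨fun x => ?_, fun x => (v (c.pj (x • y))).2, fun r x => ?_⟩
    · change (v (c.pj ((_ * x) • y))).1 = (v (c.pj (x • y))).1
      rw [mul_smul, pj_f]
    · change (v (c.pj ((_ * x) • y))).1 = _ • (v (c.pj (x • y))).1
      rw [← c.τ_inv, ← c.smul_val, ← map_smul]
      congr 2
      apply Subtype.ext
      change (1 - s.e0) • (c.τ (c.inv r) * x) • y = c.τ (c.inv r) • (1 - s.e0) • x • y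
      rw [← mul_smul, ← mul_smul, ← mul_smul, ← mul_assoc, c.f_τ, c.τ_f]
  refine ⟨ψ0.codRestrict _ hψ0, ?_⟩
  ext y
  refine Subtype.ext (CoI.ext (fun x => ?_))
  change (φ' y).1.ap x = (v (c.pj (x • s.δ y))).1
  have h3 : c.pj (x • s.δ y) = d (c.pj (x • y)) := by
    apply Subtype.ext
    change (1 - s.e0) • x • s.δ y = s.δ ((1 - s.e0) • x • y)
    rw [map_smul, map_smul]
  rw [h3, hv']
  change _ = (φ' ((1 - s.e0) • x • y)).1.ap 1
  rw [map_smul, map_smul]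
  change _ = (φ' y).1.ap (1 * (1 - s.e0) * x)
  rw [one_mul, (φ' y).2.1]

lemma E_inj (X : GMod gR) (hX : Module.Injective Γ (c.FM X.M)) : s.E X := by
  refine s.E_of_map (X.etaC (1 - s.e0) s.f_deg c.ff) (etaC_gr _ _ _ X) ?_ (s.E_Co c X hX) ?_
  · intro x hx
    have h1 : (eta (k := k) (1 - s.e0) X.M x).ap 1 = 0 :=
      congrArg (fun z : Co (k := k) (1 - s.e0) X.M => z.1.ap 1) hx
    rw [eta_ap, one_smul] at h1
    exact (s.f_zero_iff x).1 h1
  · refine s.E_of_e0 _ _ le_rfl (fun y => ?_)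
    rw [← s.f_zero_iff]
    obtain ⟨h, rfl⟩ := Submodule.Quotient.mk_surjective _ y
    refine (Submodule.Quotient.mk_eq_zero _).2 ?_
    let h' : Co (k := k) (1 - s.e0) X.M := h
    refine ⟨h'.1.ap 1, Subtype.ext (CoI.ext (fun x => ?_))⟩
    change (1 - s.e0) • x • h'.1.ap 1 = h'.1.ap (x * (1 - s.e0))
    have h1 := h'.2.2.2 x 1
    rw [mul_one, mul_assoc, h'.2.1] at h1
    rw [h1, mul_smul, mul_smul, h'.2.2.1]

lemma FM_ses {M N Q : Type} [AddCommGroup M] [AddCommGroup N] [AddCommGroup Q] [Module R M]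
    [Module R N] [Module R Q] {f : R} (c : Cor f Γ) (h : M →ₗ[R] N) (q : N →ₗ[R] Q)
    (hinj : ∀ x, h x = 0 → f • x = 0) (hsurj : Function.Surjective q) (hqh : ∀ x, q (h x) = 0)
    (hex : ∀ y, q y = 0 → ∃ x, h x = y) :
    (ShortComplex.mk (ModuleCat.ofHom (c.map h)) (ModuleCat.ofHom (c.map q)) (by
      refine ModuleCat.hom_ext (LinearMap.ext (fun x => ?_)); exact Subtype.ext (hqh x.1))).ShortExact := by
  refine { exact := ?_, mono_f := ?_, epi_g := ?_ }
  · rw [ShortComplex.moduleCat_exact_iff]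
    intro y hy
    obtain ⟨x, hx⟩ := hex y.1 (congrArg Subtype.val hy)
    refine ⟨c.pj x, Subtype.ext ?_⟩
    change h (f • x) = y.1
    rw [map_smul, hx, c.fx]
  · rw [ModuleCat.mono_iff_injective]
    change Function.Injective (c.map h)
    rw [injective_iff_map_eq_zero]
    intro x hx
    have := hinj x.1 (congrArg Subtype.val hx)
    rw [c.fx] at this
    exact Subtype.ext this
  · rw [ModuleCat.epi_iff_surjective]
    intro z
    obtain ⟨y, hy⟩ := hsurj z.1
    refine ⟨c.pj y, Subtype.ext ?_⟩
    change q (f • y) = z.1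
    rw [map_smul, hy, c.fx]

lemma E_of_injdim (n : ℕ) : ∀ (X : GMod gR)
    (hX : HasInjectiveDimensionLT (ModuleCat.of Γ (c.FM X.M)) (n + 1)), s.E X := by
  induction n with
  | zero =>
    intro X hX
    rw [zero_add, ← injective_iff_hasInjectiveDimensionLT_one] at hX
    exact s.E_inj c X ((Module.injective_iff_injective_object _ _).2 hX)
  | succ n ih =>
    intro X hX
    have hI := c.If_inj (k := k) X.M
    have hk : ∀ x, X.etaI (1 - s.e0) s.f_deg c.ff x = 0 → (1 - s.e0) • x = 0 := by
      intro x hx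
      have h1 : (eta (k := k) (1 - s.e0) X.M x).ap 1 = 0 :=
        congrArg (fun z : If (k := k) (1 - s.e0) X.M => z.1.ap 1) hx
      rwa [eta_ap, one_smul] at h1
    refine s.E_of_map (X.etaI (1 - s.e0) s.f_deg c.ff) (etaI_gr _ _ _ X) ?_ ?_ ?_
    · intro x hx
      exact (s.f_zero_iff x).1 (hk x hx)
    · exact s.E_inj c _ ((Module.injective_iff_injective_object Γ _).2 hI)
    · apply ih
      have hse := FM_ses c (X.etaI (1 - s.e0) s.f_deg c.ff)
        (LinearMap.range (X.etaI (1 - s.e0) s.f_deg c.ff)).mkQ hk (Submodule.mkQ_surjective _)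
        (fun x => (Submodule.Quotient.mk_eq_zero _).2 ⟨x, rfl⟩)
        (fun y hy => (Submodule.Quotient.mk_eq_zero _).1 hy)
      have := hse.hasInjectiveDimensionLT_X₃_iff n hI
      exact this.2 hX

end Stp
end YGr
end

noncomputable section
namespace YGr
set_option linter.unusedSectionVars false
open YDg
variable {k R : Type} [Field k] [Ring R] [Algebra k R] {gR : GRg k R} {Λ : Type 1} [Ring Λ]

/-- trivial grading -/
def Grd.triv (k M : Type) [Field k] [AddCommGroup M] [Module k M] : Grd k M where
  π i := if i = 0 then LinearMap.id else 0
  b := 0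
  orth i j x := by
    by_cases hi : i = 0 <;> by_cases hj : j = 0
    · subst hi; subst hj; simp
    · subst hi; rw [if_neg hj, if_neg (Ne.symm hj)]; simp
    · subst hj; rw [if_neg hi, if_neg hi]; simp
    · rw [if_neg hi, if_neg hj]; simp
  supp i x hi := by
    have : i ≠ 0 := by rintro rfl; simp at hi
    rw [if_neg this]; rfl
  tot x := by simp

/-- The dual of the ring. -/
def J0 (gR : GRg k R) [Module.Finite k R] : GMod gR where
  M := CoI k R k
  g := CoI.gr gR (Grd.triv k k)
  cp := CoI.cpt gR _

lemma exists_factor {V V' W : Type*} [AddCommGroup V] [Module k V] [AddCommGroup V']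
    [Module k V'] [AddCommGroup W] [Module k W] (d : V →ₗ[k] V') (g : V →ₗ[k] W)
    (hk : ∀ x, d x = 0 → g x = 0) : ∃ u : V' →ₗ[k] W, ∀ x, u (d x) = g x := by
  have hk' : LinearMap.ker d ≤ LinearMap.ker g := hk
  let g0 := (LinearMap.ker d).liftQ g hk
  let g1 := g0 ∘ₗ d.quotKerEquivRange.symm.toLinearMap
  obtain ⟨u, hu⟩ := LinearMap.exists_extend g1
  refine ⟨u, fun φ => ?_⟩
  have h1 : u (d φ) = g1 ⟨d φ, LinearMap.mem_range_self d φ⟩ :=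
    LinearMap.congr_fun hu ⟨d φ, LinearMap.mem_range_self d φ⟩
  have h2 : d.quotKerEquivRange.symm ⟨d φ, LinearMap.mem_range_self d φ⟩ =
      (LinearMap.ker d).mkQ φ := by
    rw [LinearEquiv.symm_apply_eq]; rfl
  rw [h1]
  change g0 (d.quotKerEquivRange.symm ⟨d φ, LinearMap.mem_range_self d φ⟩) = _
  rw [h2]; rfl

variable [Module.Finite k R]
namespace Stp
variable (s : Stp gR Λ)

/-- functional of a map -/
def U (φ : s.PP →ₗ[R] (J0 gR).M) : s.PP →ₗ[k] k where
  toFun y := CoI.ap (φ y) 1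
  map_add' x y := by rw [map_add]; rfl
  map_smul' c x := by
    have : φ (c • x) = c • φ x := (φ.restrictScalars k).map_smul c x
    rw [this]; rfl

lemma U_apply (φ : s.PP →ₗ[R] (J0 gR).M) (y) : s.U φ y = CoI.ap (φ y) 1 := rfl

/-- map of a functional -/
def V (u : s.PP →ₗ[k] k) : s.PP →ₗ[R] (J0 gR).M where
  toFun y := CoI.mk
    { toFun := fun x => u (x • y)
      map_add' := fun a b => by rw [add_smul, map_add]
      map_smul' := fun c a => by rw [smul_assoc, map_smul]; rfl }
  map_add' a b := CoI.ext (fun x => by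
    change u (x • (a + b)) = u (x • a) + u (x • b)
    rw [smul_add, map_add])
  map_smul' r a := CoI.ext (fun x => by
    change u (x • r • a) = u ((x * r) • a)
    rw [mul_smul])

@[simp] lemma U_V (u) : s.U (s.V u) = u := by
  ext y
  change u ((1 : R) • y) = u y
  rw [one_smul]

lemma U_inj {φ ψ : s.PP →ₗ[R] (J0 gR).M} (h : s.U φ = s.U ψ) : φ = ψ := by
  ext y
  refine CoI.ext (fun x => ?_)
  have h1 := LinearMap.congr_fun h (x • y)
  rw [U_apply, U_apply, map_smul, map_smul] at h1
  change CoI.ap (φ y) (1 * x) = CoI.ap (ψ y) (1 * x) at h1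
  rwa [one_mul] at h1

lemma U_pre (φ : s.PP →ₗ[R] (J0 gR).M) (t : s.PP →ₗ[R] s.PP) (y) :
    s.U (φ ∘ₗ t) y = s.U φ (t y) := rfl
lemma U_add (φ ψ : s.PP →ₗ[R] (J0 gR).M) (y) : s.U (φ + ψ) y = s.U φ y + s.U ψ y := rfl
lemma U_sub (φ ψ : s.PP →ₗ[R] (J0 gR).M) (y) : s.U (φ - ψ) y = s.U φ y - s.U ψ y := rfl
lemma U_smul (c : k) (φ : s.PP →ₗ[R] (J0 gR).M) (y) : s.U (c • φ) y = c * s.U φ y := rfl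

lemma J0_pi_one (h : (J0 gR).M) : CoI.ap ((J0 gR).g.π 0 h) 1 = CoI.ap h 1 := by
  have := CoI.gr_pi gR (Grd.triv k k) 0 0 h 1
  rw [sub_zero, gR.one] at this
  exact this

lemma U_compT (j : ℤ) (φ : s.PP →ₗ[R] (J0 gR).M) (y) :
    s.U (s.compT (J0 gR) j φ) y = s.U φ (s.gP.π (-j) y) := by
  rw [U_apply, U_apply, ← J0_pi_one, compT_pi, J0_pi_one, zero_sub]

/-- semisimple part: the section -/
def σ (t : s.S) : s.PP := (s.ex0 t).choose
lemma σ0 (t) : s.gP.π 0 (s.σ t) = s.σ t := (s.ex0 t).choose_spec.1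
lemma σδ (t) : s.δ (s.σ t) = 0 := (s.ex0 t).choose_spec.2.1
lemma εσ (t) : s.ε (s.σ t) = t := (s.ex0 t).choose_spec.2.2

lemma Z0_ext {x y : s.PP} (hx : s.gP.π 0 x = x) (hy : s.gP.π 0 y = y) (hx' : s.δ x = 0)
    (hy' : s.δ y = 0) (h : s.ε x = s.ε y) : x = y := by
  obtain ⟨z, hz⟩ := s.ex1 (x - y) (by rw [map_sub, hx', hy', sub_self])
    (by rw [map_sub, h, sub_self])
  have h1 : x - y = 0 := by
    have h2 : s.gP.π 0 (x - y) = x - y := by rw [map_sub, hx, hy]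
    rw [← h2, ← hz]
    have := s.δ_w (-1) z
    rw [s.pos _ _ (by norm_num), map_zero] at this
    exact this.symm
  exact sub_eq_zero.1 h1

lemma σ_ε {x : s.PP} (hx : s.gP.π 0 x = x) (hx' : s.δ x = 0) : s.σ (s.ε x) = x :=
  s.Z0_ext (s.σ0 _) hx (s.σδ _) hx' (s.εσ _)

lemma σ_add (a b) : s.σ (a + b) = s.σ a + s.σ b :=
  s.Z0_ext (s.σ0 _) (by rw [map_add, σ0, σ0]) (s.σδ _) (by rw [map_add, σδ, σδ, add_zero])
    (by rw [εσ, map_add, εσ, εσ])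

lemma ε_ksmul (c : k) (x) : s.ε (c • x) = c • s.ε x := (s.ε.restrictScalars k).map_smul c x
lemma δ_ksmul (c : k) (x) : s.δ (c • x) = c • s.δ x := (s.δ.restrictScalars k).map_smul c x

lemma σ_smul (c : k) (b) : s.σ (c • b) = c • s.σ b :=
  s.Z0_ext (s.σ0 _) (by rw [map_smul, σ0]) (s.σδ _) (by rw [δ_ksmul, σδ, smul_zero])
    (by rw [εσ, ε_ksmul, εσ])

lemma σ_smul0 {r : R} (hr : gR.π 0 r = r) (b) : s.σ (r • b) = r • s.σ b :=
  s.Z0_ext (s.σ0 _) (by rw [s.cP.zero _ hr, σ0]) (s.σδ _) (by rw [map_smul, σδ, smul_zero])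
    (by rw [εσ, map_smul, εσ])

lemma act_σ (l : Λ) (t) : s.act l (s.σ t) = s.σ (s.ε (s.act l (s.σ t))) :=
  (s.σ_ε (by rw [s.act_w, σ0]) (by rw [s.δ_act, σδ, map_zero])).symm

/-- reduction of an element of the Yoneda ring -/
def bar (l : Λ) : s.S →ₗ[R] s.S where
  toFun t := s.ε (s.act l (s.σ t))
  map_add' a b := by rw [σ_add, map_add, map_add]
  map_smul' r a := by
    have h0 : gR.π 0 (gR.π 0 r) = gR.π 0 r := gR.same 0 r
    rw [RingHom.id_apply, deg_zero_smul s.Splus, deg_zero_smul s.Splus r, σ_smul0 s h0, map_smul,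
      map_smul]

lemma bar_apply (l t) : s.bar l t = s.ε (s.act l (s.σ t)) := rfl
lemma act_σ' (l : Λ) (t) : s.act l (s.σ t) = s.σ (s.bar l t) := s.act_σ l t

lemma bar_mul (a b t) : s.bar (a * b) t = s.bar a (s.bar b t) := by
  rw [bar_apply, bar_apply, ← act_σ', map_mul]; rfl
lemma bar_add (a b t) : s.bar (a + b) t = s.bar a t + s.bar b t := by
  rw [bar_apply, map_add]; exact map_add s.ε _ _
lemma bar_sub (a b t) : s.bar (a - b) t = s.bar a t - s.bar b t := by
  rw [bar_apply, map_sub]; exact map_sub s.ε _ _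
lemma bar_one (t) : s.bar 1 t = t := by
  rw [bar_apply, map_one]; exact s.εσ t
lemma bar_zero (t) : s.bar 0 t = 0 := by
  rw [bar_apply, map_zero]; exact map_zero s.ε
lemma bar_sum {ι : Type} (S : Finset ι) (l : ι → Λ) (t) :
    s.bar (∑ i ∈ S, l i) t = ∑ i ∈ S, s.bar (l i) t := by
  exact map_sum (AddMonoidHom.mk' (fun a => s.bar a t) (fun a b => s.bar_add a b t)) l S
lemma bar_Φ (l t) : s.bar l t = s.Φ l (s.σ t) := rfl
lemma bar_κ (c t) : s.bar (s.κ c) t = c • t := by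
  rw [bar_Φ, Φ_κ]; change c • s.ε (s.σ t) = _; rw [εσ]

lemma bar_ext {a b : s.S →ₗ[R] s.S} (h : a s.s0 = b s.s0) : a = b := by
  ext t
  obtain ⟨r, rfl⟩ := s.gen0 t
  rw [map_smul, map_smul, h]

/-- multiplication by an idempotent -/
def ee (i : Fin s.m) : s.S →ₗ[R] s.S where
  toFun t := s.e i • t
  map_add' a b := smul_add _ _ _
  map_smul' r a := by
    obtain ⟨c, hc⟩ := s.espan r
    rw [RingHom.id_apply, (s.e_span_smul s.Splus r c hc i a).1, (s.e_span_smul s.Splus r c hc i a).2]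

/-- lift of an idempotent -/
def et (i : Fin s.m) : Λ := s.Ψ (s.ee i ∘ₗ s.ε)

lemma bar_et (i t) : s.bar (s.et i) t = s.e i • t := by
  rw [bar_Φ, et, Φ_Ψ]; change s.e i • s.ε (s.σ t) = _; rw [εσ]

lemma exists_c (t : s.S) : ∃ c : Fin s.m → k, ∀ i, s.e i • t = c i • s.e i • s.s0 := by
  obtain ⟨r, rfl⟩ := s.gen0 t
  obtain ⟨c, hc⟩ := s.espan r
  exact ⟨c, fun i => (s.e_span_smul s.Splus r c hc i s.s0).1⟩

/-- The kernel of the reduction. -/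
def K (l : Λ) : Prop := s.bar l s.s0 = 0

lemma K_iff (l) : s.K l ↔ s.bar l = 0 := by
  constructor
  · intro h
    exact s.bar_ext h
  · intro h
    rw [K, h]; rfl

lemma K_mul_right {a : Λ} (ha : s.K a) (b) : s.K (a * b) := by
  rw [K, bar_mul, (s.K_iff a).1 ha]; rfl

section core
variable {N : Type 1} [AddCommGroup N] [Module Λ N]

lemma smul_eq (hN : ∀ l (n : N), s.K l → l • n = 0) {a b : Λ} (h : s.bar a s.s0 = s.bar b s.s0) (n : N) : a • n = b • n := by
  rw [← sub_eq_zero, ← sub_smul]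
  exact hN _ _ (by rw [K, bar_sub, h, sub_self])

end core

end Stp
end YGr
end

noncomputable section
namespace YGr
set_option linter.unusedSectionVars false
open YDg
variable {k R : Type} [Field k] [Ring R] [Algebra k R] {gR : GRg k R} {Λ : Type 1} [Ring Λ]
variable [Module.Finite k R]
namespace Stp
variable (s : Stp gR Λ)

lemma ev_pr (W : Type 1) [AddCommGroup W] [Module k W] (j) (g : s.GG (J0 gR).M W) (φ) :
    s.ev ((s.GD (J0 gR) W).pr j g) φ = s.ev g (s.compT (J0 gR) (-j) φ) := rfl
lemma ev_D (W : Type 1) [AddCommGroup W] [Module k W] (g : s.GG (J0 gR).M W) (φ) :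
    s.ev ((s.GD (J0 gR) W).D g) φ = s.ev g (φ ∘ₗ s.δ) := rfl
lemma U_compT' (j : ℤ) (φ : s.PP →ₗ[R] (J0 gR).M) (y) :
    s.U (s.compT (J0 gR) (-j) φ) y = s.U φ (s.gP.π j y) := by
  rw [U_compT, neg_neg]

lemma ker_factor (j : ℤ) (u : s.PP →ₗ[k] k)
    (h : ∀ x, s.δ x = 0 → s.gP.π j x = x → u x = 0) :
    ∃ w : s.PP →ₗ[k] k, ∀ x, w (s.δ x) = u (s.gP.π j x) := by
  refine exists_factor (s.δ.restrictScalars k) (u ∘ₗ s.gP.π j) (fun x hx => ?_)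
  have hx' : s.δ x = 0 := hx
  refine h _ ?_ ?_
  · rw [s.δ_w, hx', map_zero]
  · rw [s.gP.orth, if_pos rfl]

lemma hneg (W : Type 1) [AddCommGroup W] [Module k W] (j) (x : s.GG (J0 gR).M W) (hj : j < 0) :
    (s.GD (J0 gR) W).pr j x = 0 := by
  refine s.ev_ext (fun φ => ?_)
  rw [ev_pr]
  have : s.compT (J0 gR) (-j) φ = 0 := by
    apply s.U_inj
    ext y
    rw [U_compT', s.pos _ _ hj, map_zero]; rfl
  rw [this, map_zero]; rfl

lemma hexJ (W : Type 1) [AddCommGroup W] [Module k W] (j) (x : s.GG (J0 gR).M W) (hj : 0 < j)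
    (hx : x ∈ (s.GD (J0 gR) W).deg j) (hD : (s.GD (J0 gR) W).D x = 0) :
    ∃ y, (s.GD (J0 gR) W).D y = x := by
  have hD' : ∀ φ, s.ev x (φ ∘ₗ s.δ) = 0 := fun φ => by
    rw [← ev_D, hD]; rfl
  obtain ⟨u, hu⟩ := exists_factor (s.pre (J0 gR).M s.δ) (s.ev x) (fun φ hφ => by
    have h1 : s.ev x φ = s.ev x (s.compT (J0 gR) (-j) φ) := by
      rw [← ev_pr, DGM.mem_deg.1 hx]
    rw [h1]
    have hφ' : φ ∘ₗ s.δ = 0 := hφ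
    obtain ⟨w, hw⟩ := s.ker_factor j (s.U φ) (fun y hy hyj => by
      obtain ⟨z, rfl⟩ := s.ex1 y hy (by
        rw [← hyj, ← s.ε0, s.gP.orth, if_neg (by omega), map_zero])
      rw [← U_pre, hφ']; rfl)
    have : s.compT (J0 gR) (-j) φ = s.V w ∘ₗ s.δ := by
      apply s.U_inj
      ext y
      rw [U_compT', U_pre, U_V, hw]
    rw [this, hD'])
  exact ⟨s.mkG u, s.ev_ext hu⟩

lemma Z_kill (W : Type 1) [AddCommGroup W] [Module k W] (g : s.GG (J0 gR).M W)
    (hg : g ∈ (s.GD (J0 gR) W).Z) (φ) (hφ : ∀ t, s.U φ (s.σ t) = 0) : s.ev g φ = 0 := by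
  have h0 : (s.GD (J0 gR) W).pr 0 g = g := hg.1
  have hD : (s.GD (J0 gR) W).D g = 0 := hg.2
  rw [← h0, ev_pr]
  obtain ⟨w, hw⟩ := s.ker_factor 0 (s.U φ) (fun y hy hyj => by
    rw [← s.σ_ε hyj hy, hφ])
  have : s.compT (J0 gR) (-0) φ = s.V w ∘ₗ s.δ := by
    apply s.U_inj
    ext y
    rw [U_compT', U_pre, U_V, hw]
  rw [this, ← ev_D, hD]; rfl

/-- coefficient lemma -/
lemma exists_coef (l : Λ) : ∃ c : Fin s.m → k, ∀ i t, s.e i • s.bar l t = c i • s.e i • t := by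
  obtain ⟨c, hc⟩ := s.exists_c (s.bar l s.s0)
  refine ⟨c, fun i t => ?_⟩
  exact LinearMap.congr_fun (s.bar_ext (a := s.ee i ∘ₗ s.bar l) (b := c i • s.ee i) (hc i)) t

lemma exists_xi : ∃ ξ : Fin s.m → (s.S →ₗ[k] k), (∀ i t, ξ i (s.e i • t) = ξ i t) ∧
    ∀ i, s.e i • s.s0 ≠ 0 → ξ i s.s0 = 1 := by
  have : ∀ i, ∃ ξ : s.S →ₗ[k] k, (∀ t, ξ (s.e i • t) = ξ t) ∧
      (s.e i • s.s0 ≠ 0 → ξ s.s0 = 1) := by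
    intro i
    by_cases h : s.e i • s.s0 = 0
    · exact ⟨0, fun t => rfl, fun h' => absurd h h'⟩
    · obtain ⟨q, hq⟩ := LinearMap.exists_leftInverse_of_injective
        (LinearMap.toSpanSingleton k s.S (s.e i • s.s0)) (LinearMap.ker_toSpanSingleton k h)
      refine ⟨q ∘ₗ ((s.ee i).restrictScalars k), fun t => ?_, fun _ => ?_⟩
      · change q (s.e i • s.e i • t) = q (s.e i • t)
        rw [smul_smul, s.eorth, if_pos rfl]
      · have := LinearMap.congr_fun hq 1
        change q ((1 : k) • s.e i • s.s0) = 1 at this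
        rw [one_smul] at this
        exact this
  choose ξ h1 h2 using this
  exact ⟨ξ, h1, h2⟩

section core
variable {N : Type 1} [AddCommGroup N] [Module Λ N]

lemma ee_ksmul (i) (c : k) (t : s.S) : s.e i • c • t = c • s.e i • t :=
  ((s.ee i).restrictScalars k).map_smul c t

lemma bar_e_smul (l i t) : s.bar l (s.e i • t) = s.e i • s.bar l t := map_smul _ _ _

lemma retract (hN : ∀ l (n : N), s.K l → l • n = 0) : ∃ (_ : Module k N)
    (i : N →ₗ[Λ] (s.GD (J0 gR) N).Z)
    (p : (s.GD (J0 gR) N).Z →ₗ[Λ] N), ∀ n, p (i n) = n := by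
  let _ : Module k N := Module.compHom N s.κ
  have hk : ∀ (c : k) (n : N), c • n = s.κ c • n := fun _ _ => rfl
  obtain ⟨ξ, hξ, hξ1⟩ := s.exists_xi
  let gn : N → s.GG (J0 gR).M N := fun n => s.mkG
    { toFun := fun φ => ∑ i, s.U φ (s.σ (s.e i • s.s0)) • s.et i • n
      map_add' := fun φ ψ => by
        rw [← Finset.sum_add_distrib]
        exact Finset.sum_congr rfl (fun i _ => by rw [U_add, add_smul])
      map_smul' := fun c φ => by
        rw [RingHom.id_apply, Finset.smul_sum]
        exact Finset.sum_congr rfl (fun i _ => by rw [U_smul, mul_smul]) }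
  have hgn : ∀ n φ, s.ev (gn n) φ = ∑ i, s.U φ (s.σ (s.e i • s.s0)) • s.et i • n :=
    fun _ _ => rfl
  have hZ : ∀ n, gn n ∈ (s.GD (J0 gR) N).Z := by
    intro n
    refine ⟨?_, ?_⟩
    · refine s.ev_ext (fun φ => ?_)
      rw [ev_pr, hgn, hgn]
      exact Finset.sum_congr rfl (fun i _ => by rw [U_compT', σ0])
    · refine s.ev_ext (fun φ => ?_)
      rw [ev_D, hgn]
      refine Finset.sum_eq_zero (fun i _ => ?_)
      rw [U_pre, σδ, map_zero, zero_smul]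
  let i : N →ₗ[Λ] (s.GD (J0 gR) N).Z :=
    { toFun := fun n => ⟨gn n, hZ n⟩
      map_add' := fun a b => by
        refine Subtype.ext (s.ev_ext (fun φ => ?_))
        change s.ev (gn (a + b)) φ = s.ev (gn a) φ + s.ev (gn b) φ
        rw [hgn, hgn, hgn, ← Finset.sum_add_distrib]
        exact Finset.sum_congr rfl (fun i _ => by rw [smul_add, smul_add])
      map_smul' := fun l n => by
        refine Subtype.ext (s.ev_ext (fun φ => ?_))
        change s.ev (gn (l • n)) φ = s.ev (gn n) (φ ∘ₗ s.act l)
        rw [hgn, hgn]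
        obtain ⟨c, hc⟩ := s.exists_coef l
        refine Finset.sum_congr rfl (fun i _ => ?_)
        rw [U_pre, act_σ', bar_e_smul, hc, σ_smul, map_smul, smul_eq_mul, mul_comm, mul_smul]
        congr 1
        rw [hk, ← mul_smul, ← mul_smul]
        refine s.smul_eq hN ?_ n
        rw [bar_mul, bar_mul, bar_κ, bar_et, bar_et, hc] }
  let φi : Fin s.m → (s.PP →ₗ[R] (J0 gR).M) := fun i => s.V (ξ i ∘ₗ s.ε.restrictScalars k)
  have hφi : ∀ i y, s.U (φi i) y = ξ i (s.ε y) := fun i y => by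
    change s.U (s.V _) y = _
    rw [U_V]; rfl
  let p : (s.GD (J0 gR) N).Z →ₗ[Λ] N :=
    { toFun := fun g => ∑ i, s.et i • s.ev g.1 (φi i)
      map_add' := fun a b => by
        rw [← Finset.sum_add_distrib]
        exact Finset.sum_congr rfl (fun i _ => smul_add _ _ _)
      map_smul' := fun l g => by
        rw [RingHom.id_apply, Finset.smul_sum]
        obtain ⟨c, hc⟩ := s.exists_coef l
        refine Finset.sum_congr rfl (fun i _ => ?_)
        change s.et i • s.ev g.1 (φi i ∘ₗ s.act l) = _
        have h1 : s.ev g.1 (φi i ∘ₗ s.act l - c i • φi i) = 0 := by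
          refine s.Z_kill N g.1 g.2 _ (fun t => ?_)
          rw [U_sub, U_smul, U_pre, hφi, hφi, act_σ', εσ, εσ, sub_eq_zero, ← hξ, hc, map_smul,
            hξ, smul_eq_mul]
        rw [map_sub, sub_eq_zero, map_smul] at h1
        rw [h1, hk, ← mul_smul, ← mul_smul]
        refine s.smul_eq hN ?_ _
        rw [bar_mul, bar_mul, bar_κ, bar_et, bar_et, bar_e_smul, hc, ee_ksmul] }
  refine ⟨inferInstance, i, p, fun n => ?_⟩
  change ∑ i, s.et i • s.ev (gn n) (φi i) = n
  have h1 : ∀ i, s.et i • s.ev (gn n) (φi i) = s.et i • n := by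
    intro i
    by_cases h : s.e i • s.s0 = 0
    · have hK : s.K (s.et i) := by rw [K, bar_et, h]
      rw [hN _ _ hK, hN _ _ hK]
    · have h2 : s.ev (gn n) (φi i) = s.et i • n := by
        rw [hgn, Finset.sum_eq_single i]
        · rw [hφi, εσ, hξ, hξ1 i h, one_smul]
        · intro j _ hj
          rw [hφi, εσ, ← hξ, smul_smul, s.eorth, if_neg hj.symm, zero_smul, map_zero, zero_smul]
        · intro h; exact absurd (Finset.mem_univ _) h
      rw [h2, ← mul_smul]
      refine s.smul_eq hN ?_ _
      rw [bar_mul, bar_et, bar_et, smul_smul, s.eorth, if_pos rfl]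
  rw [Finset.sum_congr rfl (fun i _ => h1 i), ← Finset.sum_smul]
  conv_rhs => rw [← one_smul Λ n]
  refine s.smul_eq hN ?_ _
  rw [bar_sum, bar_one, Finset.sum_congr rfl (fun i _ => s.bar_et i s.s0), ← Finset.sum_smul,
    s.esum, one_smul]

end core

variable [HasDerivedCategory.{2} (ModuleCat.{1} Λ)] [HasExt.{2} (ModuleCat.{1} Λ)]

lemma injdim_killed (n0 : ℕ) (hE : ∀ (W : Type 1) [AddCommGroup W] [Module k W],
    DGM.VanD (s.GD (J0 gR) W) n0) (N : ModuleCat.{1} Λ) (hN : ∀ l (n : N), s.K l → l • n = 0) :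
    HasInjectiveDimensionLT N (n0 + 1) := by
  obtain ⟨_, i, p, hip⟩ := s.retract hN
  have : HasInjectiveDimensionLT (ModuleCat.of Λ (s.GD (J0 gR) N).Z) (n0 + 1) := by
    rw [hasInjectiveDimensionLT_iff]
    intro j hj Y e
    have := DGM.Z_injdim (s.GD (J0 gR) N) (fun j x h => s.hneg N j x h) (fun j x h h1 h2 => s.hexJ N j x h h1 h2) n0 (hE N) Y j hj
    exact Subsingleton.elim _ _
  let r : Retract N (ModuleCat.of Λ (s.GD (J0 gR) N).Z) :=
    { i := ModuleCat.ofHom i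
      r := ModuleCat.ofHom p
      retract := by
        ext n
        exact hip n }
  exact r.hasInjectiveDimensionLT _

/-- being killed by a power of the kernel -/
def kill {N : Type 1} [AddCommGroup N] [Module Λ N] : ℕ → N → Prop
  | 0, x => x = 0
  | j + 1, x => ∀ l, s.K l → kill j (l • x)

lemma kill_map {N N' : Type 1} [AddCommGroup N] [Module Λ N] [AddCommGroup N'] [Module Λ N']
    (f : N →ₗ[Λ] N') (j : ℕ) : ∀ x, s.kill j x → s.kill j (f x) := by
  induction j with
  | zero => intro x hx; change x = 0 at hx; rw [hx]; exact map_zero f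
  | succ j ih => intro x hx l hl; rw [← map_smul]; exact ih _ (hx l hl)

lemma kill_of_one (j : ℕ) (h : s.kill j (1 : Λ)) {N : Type 1} [AddCommGroup N] [Module Λ N]
    (x : N) : s.kill j x := by
  have := s.kill_map (LinearMap.toSpanSingleton Λ N x) j 1 h
  rwa [LinearMap.toSpanSingleton_apply, one_smul] at this

lemma K_mul_left {a : Λ} (ha : s.K a) (b) : s.K (b * a) := by
  rw [K, bar_mul, ha, map_zero]

lemma kill_add {N : Type 1} [AddCommGroup N] [Module Λ N] (j : ℕ) : ∀ x y : N, s.kill j x →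
    s.kill j y → s.kill j (x + y) := by
  induction j with
  | zero => intro x y hx hy; change x = 0 at hx; change y = 0 at hy; rw [hx, hy]; exact add_zero 0
  | succ j ih => intro x y hx hy l hl; rw [smul_add]; exact ih _ _ (hx l hl) (hy l hl)

/-- submodule of elements killed by a power -/
def killSub (N : Type 1) [AddCommGroup N] [Module Λ N] (j : ℕ) : Submodule Λ N where
  carrier := {x | s.kill j x}
  add_mem' {a b} ha hb := s.kill_add j a b ha hb
  zero_mem' := by
    change s.kill j (0 : N)
    have : ∀ j, s.kill j (0 : N) := by
      intro j
      induction j with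
      | zero => rfl
      | succ j ih => intro l hl; rw [smul_zero]; exact ih
    exact this j
  smul_mem' c x hx := by
    cases j with
    | zero =>
      change x = 0 at hx
      change c • x = 0
      rw [hx, smul_zero]
    | succ j =>
      intro l hl
      rw [← mul_smul]
      exact hx _ (s.K_mul_right hl c)

lemma injdim_kill (n0 : ℕ) (hE : ∀ (W : Type 1) [AddCommGroup W] [Module k W],
    DGM.VanD (s.GD (J0 gR) W) n0) (j : ℕ) : ∀ (N : ModuleCat.{1} Λ)
    (hN : ∀ x : N, s.kill j x),
    HasInjectiveDimensionLT N (n0 + 1) := by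
  induction j with
  | zero =>
    intro N hN
    refine s.injdim_killed n0 hE N (fun l n _ => hN _)
  | succ j ih =>
    intro N hN
    let N' := s.killSub N j
    have hex : Function.Exact N'.subtype N'.mkQ := by
      rw [LinearMap.exact_iff]; simp
    let S : ShortComplex (ModuleCat.{1} Λ) :=
      ShortComplex.mk (ModuleCat.ofHom N'.subtype) (ModuleCat.ofHom N'.mkQ) (by
        ext x
        exact (hex (N'.subtype x)).2 ⟨x, rfl⟩)
    have hS : S.ShortExact := by
      refine ShortComplex.ShortExact.mk' ?_ ?_ ?_
      · exact (ShortComplex.ShortExact.moduleCat_exact_iff_function_exact S).2 hex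
      · exact (ModuleCat.mono_iff_injective _).2 Subtype.val_injective
      · exact (ModuleCat.epi_iff_surjective _).2 N'.mkQ_surjective
    refine hS.hasInjectiveDimensionLT_X₂ (n0 + 1) (ih _ ?_) (s.injdim_killed n0 hE _ ?_)
    · rintro ⟨x, hx⟩
      have hx' : s.kill j x := hx
      have : ∀ (j : ℕ) (x : N'), s.kill j x.1 → s.kill j x := by
        intro j
        induction j with
        | zero => intro x hx; exact Subtype.ext hx
        | succ j ih => intro x hx l hl; exact ih _ (hx l hl)
      exact this j _ hx'
    · intro l n hl
      obtain ⟨n, rfl⟩ := N'.mkQ_surjective n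
      rw [← map_smul]
      exact (Submodule.Quotient.mk_eq_zero N').2 (hN n l hl)

theorem core (j : ℕ) (hj : s.kill j (1 : Λ)) {Γ : Type} [Ring Γ] (c : Cor (1 - s.e0) Γ)
    (hΓ : ∃ n : ℕ, ∀ (M N : ModuleCat.{0} Γ) (i : ℕ), n < i → Subsingleton (Ext M N i)) :
    ∃ n : ℕ, ∀ (M N : ModuleCat.{1} Λ) (i : ℕ), n < i → Subsingleton (Ext M N i) := by
  obtain ⟨n, hn⟩ := hΓ
  have hE : s.E (J0 gR) := s.E_of_injdim c n (J0 gR) (by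
    rw [hasInjectiveDimensionLT_iff]
    intro i hi Y e
    have := hn Y (ModuleCat.of Γ (c.FM (J0 gR).M)) i hi
    exact Subsingleton.elim _ _)
  obtain ⟨n0, hn0⟩ := hE
  refine ⟨n0, fun M N i hi => ?_⟩
  have := s.injdim_kill n0 hn0 j N (fun x => s.kill_of_one j hj x)
  exact ⟨fun a b => by
    rw [a.eq_zero_of_hasInjectiveDimensionLT (n0 + 1) hi,
      b.eq_zero_of_hasInjectiveDimensionLT (n0 + 1) hi]⟩

end Stp
end YGr
end

noncomputable section
namespace YGr
set_option linter.unusedSectionVars false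

/-- A linear resolution in linear algebra terms. -/
structure Res {k R : Type} [Field k] [Ring R] [Algebra k R] (gR : GRg k R) where
  P : ℕ → Type
  [ac : ∀ n, AddCommGroup (P n)]
  [mK : ∀ n, Module k (P n)]
  [mR : ∀ n, Module R (P n)]
  [tw : ∀ n, IsScalarTower k R (P n)]
  [proj : ∀ n, Module.Projective R (P n)]
  g : ∀ n, Grd k (P n)
  B : ℕ
  gb : ∀ n, (g n).b = B
  c : ∀ n, Cpt gR (g n)
  span : ∀ n, Submodule.span R {x : P n | (g n).π 0 x = x} = ⊤
  d : ∀ n, P (n + 1) →ₗ[R] P n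
  dd : ∀ n x, d n (d (n + 1) x) = 0
  d_w : ∀ n w x, d n ((g (n + 1)).π w x) = (g n).π (w + 1) (d n x)
  S : Type
  [acS : AddCommGroup S]
  [mKS : Module k S]
  [mRS : Module R S]
  [twS : IsScalarTower k R S]
  Splus : ∀ i r (s : S), 0 < i → gR.π i r • s = 0
  ε : P 0 →ₗ[R] S
  εsurj : Function.Surjective ε
  εd : ∀ x, ε (d 0 x) = 0
  ex0 : ∀ x, ε x = 0 → ∃ y, d 0 y = x
  ex : ∀ n x, d n x = 0 → ∃ y, d (n + 1) y = x

attribute [instance] Res.ac Res.mK Res.mR Res.tw Res.proj Res.acS Res.mKS Res.mRS Res.twS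

namespace Res
variable {k R : Type} [Field k] [Ring R] [Algebra k R] {gR : GRg k R} (r : Res gR)

lemma pos {n : ℕ} (w : ℤ) (x : r.P n) (hw : w < 0) : (r.g n).π w x = 0 := by
  have hx : x ∈ Submodule.span R {x : r.P n | (r.g n).π 0 x = x} := by rw [r.span]; trivial
  induction hx using Submodule.closure_induction with
  | zero => exact map_zero _
  | add x y _ _ hx hy => rw [map_add, hx, hy, add_zero]
  | smul_mem a x h =>
    have h' : (r.g n).π 0 x = x := h
    refine gR.induct (p := fun a => (r.g n).π w (a • x) = 0) ?_ ?_ ?_ a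
    · intro a b ha hb; rw [add_smul, map_add, ha, hb, add_zero]
    · rw [zero_smul, map_zero]
    · intro i a
      by_cases hi : i < 0
      · rw [gR.neg _ _ hi, zero_smul, map_zero]
      · rw [(r.c n).c, ← h', (r.g n).orth, if_neg (by omega), smul_zero]

lemma gen {n : ℕ} (w : ℤ) (x : r.P n) (hw : w ≠ 0) :
    (r.g n).π w x ∈ AddSubgroup.closure {z | ∃ i a, ∃ y : r.P n, 0 < i ∧ z = gR.π i a • y} := by
  have hx : x ∈ Submodule.span R {x : r.P n | (r.g n).π 0 x = x} := by rw [r.span]; trivial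
  induction hx using Submodule.closure_induction with
  | zero => rw [map_zero]; exact zero_mem _
  | add x y _ _ hx hy => rw [map_add]; exact add_mem hx hy
  | smul_mem a x h =>
    have h' : (r.g n).π 0 x = x := h
    refine gR.induct (p := fun a => (r.g n).π w (a • x) ∈ AddSubgroup.closure
      {z | ∃ i a, ∃ y : r.P n, 0 < i ∧ z = gR.π i a • y}) ?_ ?_ ?_ a
    · intro a b ha hb; rw [add_smul, map_add]; exact add_mem ha hb
    · rw [zero_smul, map_zero]; exact zero_mem _
    · intro i a
      by_cases hi : i < 0
      · rw [gR.neg _ _ hi, zero_smul, map_zero]; exact zero_mem _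
      · rw [(r.c n).c]
        by_cases hi' : i = 0
        · rw [← h', (r.g n).orth, if_neg (by omega), smul_zero]; exact zero_mem _
        · exact AddSubgroup.subset_closure ⟨i, a, _, by omega, rfl⟩

lemma S_w {n : ℕ} (f : r.P n →ₗ[R] r.S) (w : ℤ) (x : r.P n) (hw : w ≠ 0) :
    f ((r.g n).π w x) = 0 := by
  have := r.gen w x hw
  refine AddSubgroup.closure_induction (p := fun z _ => f z = 0) ?_ ?_ ?_ ?_ this
  · rintro _ ⟨i, a, y, hi, rfl⟩
    rw [map_smul, r.Splus _ _ _ hi]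
  · exact map_zero _
  · intro x y _ _ hx hy; rw [map_add, hx, hy, add_zero]
  · intro x _ hx; rw [map_neg, hx, neg_zero]

lemma S_0 {n : ℕ} (f : r.P n →ₗ[R] r.S) (x : r.P n) : f ((r.g n).π 0 x) = f x := by
  conv_rhs => rw [← (r.g n).tot x, map_sum]
  rw [Finset.sum_eq_single 0]
  · intro w _ hw; exact r.S_w f w x hw
  · intro h
    rw [(r.g n).supp 0 x h, map_zero]

lemma S_d {n : ℕ} (f : r.P n →ₗ[R] r.S) (x) : f (r.d n x) = 0 := by
  rw [← S_0]
  have := r.d_w n (-1) x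
  rw [r.pos _ _ (by norm_num), map_zero] at this
  rw [neg_add_cancel] at this
  rw [← this, map_zero]

/-- vanishing on generators -/
lemma gen_zero {n : ℕ} {N : Type} [AddCommGroup N] [Module R N] (f : r.P n →ₗ[R] N)
    (h : ∀ x, (r.g n).π 0 x = x → f x = 0) : f = 0 := by
  refine LinearMap.ext_on (r.span n) (fun x hx => ?_)
  rw [h x hx]; rfl

/-- total module -/
abbrev PP : Type := Π₀ n, r.P n

/-- inclusion -/
abbrev incl (n : ℕ) : r.P n →ₗ[R] r.PP := DFinsupp.lsingle n

/-- grading on the total module -/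
def gP : Grd k r.PP where
  π w := DFinsupp.mapRange.linearMap (fun n => (r.g n).π w)
  b := r.B
  orth i j x := by
    ext n
    change (r.g n).π i ((r.g n).π j (x n)) = _
    rw [(r.g n).orth]
    split_ifs <;> rfl
  supp i x hi := by
    ext n
    exact (r.g n).supp i (x n) (by rw [r.gb]; exact hi)
  tot x := by
    ext n
    rw [DFinsupp.finsetSum_apply]
    have := (r.g n).tot (x n)
    rw [r.gb] at this
    exact this

lemma gP_apply (w : ℤ) (x : r.PP) (n : ℕ) : r.gP.π w x n = (r.g n).π w (x n) := rfl

lemma gP_incl (w : ℤ) (n : ℕ) (x : r.P n) :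
    r.gP.π w (r.incl n x) = r.incl n ((r.g n).π w x) :=
  DFinsupp.mapRange_single (hf := fun i => map_zero _)

lemma cP : Cpt gR r.gP := by
  intro i j a x
  ext n
  exact r.c n i j a (x n)

/-- pieces of the differential -/
def δn : ∀ n, r.P n →ₗ[R] r.PP
  | 0 => 0
  | n + 1 => ((-1 : ℤ) ^ (n + 1)) • (r.incl n ∘ₗ r.d n)

/-- total differential -/
def δ : r.PP →ₗ[R] r.PP := DFinsupp.lsum ℕ r.δn

lemma δ_incl0 (x : r.P 0) : r.δ (r.incl 0 x) = 0 := DFinsupp.lsum_single ℕ r.δn 0 x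

lemma δ_incl (n : ℕ) (x : r.P (n + 1)) :
    r.δ (r.incl (n + 1) x) = ((-1 : ℤ) ^ (n + 1)) • r.incl n (r.d n x) :=
  DFinsupp.lsum_single ℕ r.δn (n + 1) x

lemma ind {p : r.PP → Prop} (h0 : p 0) (hadd : ∀ x y, p x → p y → p (x + y))
    (hs : ∀ n x, p (r.incl n x)) (x) : p x := by
  induction x using DFinsupp.induction with
  | h0 => exact h0
  | ha i b f _ _ hf => exact hadd _ _ (hs i b) hf

lemma incl_same (n : ℕ) (x : r.P n) : (r.incl n x) n = x := DFinsupp.single_eq_same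
lemma incl_ne {m n : ℕ} (h : m ≠ n) (x : r.P n) : (r.incl n x) m = 0 :=
  DFinsupp.single_eq_of_ne h

lemma δ_apply (x : r.PP) (n : ℕ) : r.δ x n = ((-1 : ℤ) ^ (n + 1)) • r.d n (x (n + 1)) := by
  refine r.ind (p := fun x => r.δ x n = ((-1 : ℤ) ^ (n + 1)) • r.d n (x (n + 1))) ?_ ?_ ?_ x
  · rw [map_zero]; simp
  · intro x y hx hy
    rw [map_add, DFinsupp.add_apply, hx, hy, DFinsupp.add_apply, map_add, smul_add]
  · intro m x
    cases m with
    | zero =>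
      rw [δ_incl0, incl_ne r (by omega), map_zero, smul_zero]; rfl
    | succ m =>
      rw [δ_incl, DFinsupp.smul_apply]
      by_cases h : n = m
      · subst h
        rw [incl_same, incl_same]
      · rw [incl_ne r h, incl_ne r (by omega), map_zero, smul_zero, smul_zero]

lemma δδ (x : r.PP) : r.δ (r.δ x) = 0 := by
  ext n
  rw [δ_apply, δ_apply, map_zsmul, r.dd, smul_zero, smul_zero]; rfl

lemma δ_w (i : ℤ) (x : r.PP) : r.δ (r.gP.π i x) = r.gP.π (i + 1) (r.δ x) := by
  ext n
  rw [δ_apply, gP_apply, gP_apply, δ_apply, r.d_w, map_zsmul]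

lemma ppos (i : ℤ) (x : r.PP) (hi : i < 0) : r.gP.π i x = 0 := by
  ext n
  exact r.pos i (x n) hi

lemma pgen (w : ℤ) (x : r.PP) (hw : w ≠ 0) :
    r.gP.π w x ∈ AddSubgroup.closure {z | ∃ i a, ∃ y : r.PP, 0 < i ∧ z = gR.π i a • y} := by
  refine r.ind (p := fun x => r.gP.π w x ∈ AddSubgroup.closure
    {z | ∃ i a, ∃ y : r.PP, 0 < i ∧ z = gR.π i a • y}) ?_ ?_ ?_ x
  · rw [map_zero]; exact zero_mem _
  · intro x y hx hy; rw [map_add]; exact add_mem hx hy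
  · intro n x
    rw [gP_incl]
    refine AddSubgroup.closure_induction (p := fun z _ => r.incl n z ∈ AddSubgroup.closure
      {z | ∃ i a, ∃ y : r.PP, 0 < i ∧ z = gR.π i a • y}) ?_ ?_ ?_ ?_ (r.gen w x hw)
    · rintro _ ⟨i, a, y, hi, rfl⟩
      exact AddSubgroup.subset_closure ⟨i, a, r.incl n y, hi, map_smul _ _ _⟩
    · rw [map_zero]; exact zero_mem _
    · intro x y _ _ hx hy; rw [map_add]; exact add_mem hx hy
    · intro x _ hx; rw [map_neg]; exact neg_mem hx

/-- augmentation -/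
def aug : r.PP →ₗ[R] r.S := r.ε ∘ₗ DFinsupp.lapply 0

lemma aug_apply (x) : r.aug x = r.ε (x 0) := rfl

lemma aug0 (x) : r.aug (r.gP.π 0 x) = r.aug x := r.S_0 r.ε (x 0)

lemma zsmul_self (n : ℕ) {M : Type} [AddCommGroup M] (x : M) :
    ((-1 : ℤ) ^ n) • ((-1 : ℤ) ^ n) • x = x := by
  rw [smul_smul, ← mul_pow]; simp

lemma pex1 (x : r.PP) (hx : r.δ x = 0) (hx' : r.aug x = 0) : ∃ y, r.δ y = x := by
  have h : ∀ n, ∃ y, r.δ y = r.incl n (x n) := by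
    intro n
    have : ∃ z, r.d n z = x n := by
      cases n with
      | zero => exact r.ex0 _ hx'
      | succ n =>
        refine r.ex n _ ?_
        have := r.δ_apply x n
        rw [hx] at this
        rw [← zsmul_self (n + 1) (r.d n (x (n + 1))), ← this]
        exact smul_zero _
    obtain ⟨z, hz⟩ := this
    refine ⟨((-1 : ℤ) ^ (n + 1)) • r.incl (n + 1) z, ?_⟩
    rw [map_zsmul, δ_incl, zsmul_self, hz]
  have h2 : x ∈ LinearMap.range r.δ := by
    classical
    rw [← DFinsupp.sum_single (f := x)]
    exact Submodule.sum_mem _ (fun n _ => h n)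
  exact h2

lemma pex0 (s : r.S) : ∃ x, r.gP.π 0 x = x ∧ r.δ x = 0 ∧ r.aug x = s := by
  obtain ⟨y, rfl⟩ := r.εsurj s
  refine ⟨r.incl 0 ((r.g 0).π 0 y), ?_, r.δ_incl0 _, ?_⟩
  · rw [gP_incl, (r.g 0).same]
  · rw [aug_apply, incl_same, S_0]

lemma Z0 (x : r.PP) (h0 : r.gP.π 0 x = x) (hδ : r.δ x = 0) (ha : r.aug x = 0) : x = 0 := by
  obtain ⟨y, rfl⟩ := r.pex1 x hδ ha
  have := r.δ_w (-1) y
  rw [r.ppos _ _ (by norm_num), map_zero, neg_add_cancel, h0] at this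
  exact this.symm

/-- good endomorphisms -/
structure Good (t : r.PP →ₗ[R] r.PP) : Prop where
  w : ∀ i x, r.gP.π i (t x) = t (r.gP.π i x)
  δ : ∀ x, r.δ (t x) = t (r.δ x)

lemma Good.sub {r : Res gR} {t t' : r.PP →ₗ[R] r.PP} (h : r.Good t) (h' : r.Good t') :
    r.Good (t - t') where
  w i x := by rw [LinearMap.sub_apply, map_sub, h.w, h'.w]; rfl
  δ x := by rw [LinearMap.sub_apply, map_sub, h.δ, h'.δ]; rfl
lemma Good.add {r : Res gR} {t t' : r.PP →ₗ[R] r.PP} (h : r.Good t) (h' : r.Good t') :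
    r.Good (t + t') where
  w i x := by rw [LinearMap.add_apply, map_add, h.w, h'.w]; rfl
  δ x := by rw [LinearMap.add_apply, map_add, h.δ, h'.δ]; rfl
lemma Good.comp {r : Res gR} {t t' : r.PP →ₗ[R] r.PP} (h : r.Good t) (h' : r.Good t') :
    r.Good (t ∘ₗ t') where
  w i x := by rw [LinearMap.comp_apply, h.w, h'.w]; rfl
  δ x := by rw [LinearMap.comp_apply, h.δ, h'.δ]; rfl
lemma Good.id : r.Good LinearMap.id := ⟨fun _ _ => rfl, fun _ => rfl⟩

/-- homogeneity -/
lemma Good.hom {r : Res gR} {t : r.PP →ₗ[R] r.PP} (h : r.Good t) (a : ℕ)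
    (ha : ∀ m x, m ≠ a → r.aug (t (r.incl m x)) = 0) (m : ℕ) : ∀ (b : ℕ) (x : r.P m),
    m ≠ a + b → t (r.incl m x) b = 0 := by
  induction m with
  | zero =>
    intro b x hm
    refine LinearMap.congr_fun (r.gen_zero ((DFinsupp.lapply b ∘ₗ t) ∘ₗ r.incl 0) (fun x hx => ?_)) x
    change t (r.incl 0 x) b = 0
    rw [← r.incl_same b (t (r.incl 0 x) b)]
    rw [r.Z0 (r.incl b (t (r.incl 0 x) b)) ?_ ?_ ?_]; rfl
    · rw [gP_incl, ← gP_apply, h.w, gP_incl, hx]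
    · cases b with
      | zero => exact r.δ_incl0 _
      | succ b =>
        rw [δ_incl, ← map_zsmul, ← δ_apply, h.δ, δ_incl0, map_zero]; exact map_zero _
    · cases b with
      | zero =>
        rw [aug_apply, incl_same]
        exact ha 0 x hm
      | succ b => rw [aug_apply, incl_ne r (by omega), map_zero]
  | succ m ih =>
    intro b x hm
    refine LinearMap.congr_fun (r.gen_zero ((DFinsupp.lapply b ∘ₗ t) ∘ₗ r.incl (m + 1))
      (fun x hx => ?_)) x
    change t (r.incl (m + 1) x) b = 0
    rw [← r.incl_same b (t (r.incl (m + 1) x) b)]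
    rw [r.Z0 (r.incl b (t (r.incl (m + 1) x) b)) ?_ ?_ ?_]; rfl
    · rw [gP_incl, ← gP_apply, h.w, gP_incl, hx]
    · cases b with
      | zero => exact r.δ_incl0 _
      | succ b =>
        rw [δ_incl, ← map_zsmul, ← δ_apply, h.δ, δ_incl, map_zsmul, DFinsupp.smul_apply,
          ih b _ (by omega), smul_zero, map_zero]
    · cases b with
      | zero =>
        rw [aug_apply, incl_same]
        exact ha (m + 1) x hm
      | succ b => rw [aug_apply, incl_ne r (by omega), map_zero]

lemma Good.uniq0 {r : Res gR} {t : r.PP →ₗ[R] r.PP} (h : r.Good t)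
    (ha : ∀ x, r.aug (t x) = 0) : t = 0 := by
  refine DFinsupp.lhom_ext (fun m x => ?_)
  ext b
  exact h.hom (m + 1) (fun _ _ _ => ha _) m b x (by omega)

lemma Good.uniq {r : Res gR} {t t' : r.PP →ₗ[R] r.PP} (h : r.Good t) (h' : r.Good t')
    (ha : r.aug ∘ₗ t = r.aug ∘ₗ t') : t = t' := by
  refine sub_eq_zero.1 ((h.sub h').uniq0 (fun x => ?_))
  rw [LinearMap.sub_apply, map_sub, sub_eq_zero]
  exact LinearMap.congr_fun ha x

lemma lift1 {n : ℕ} (u : r.P n →ₗ[R] r.PP) (hu : ∀ w x, u ((r.g n).π w x) = r.gP.π (w + 1) (u x))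
    (hδ : ∀ x, r.δ (u x) = 0) (hε : ∀ x, r.aug (u x) = 0) (f : r.P n →ₗ[R] r.S) :
    ∃ t : r.P n →ₗ[R] r.PP, (∀ w x, r.gP.π w (t x) = t ((r.g n).π w x)) ∧
      (∀ x, r.aug (t x) = f x) ∧ ∀ x, r.δ (t x) = u x := by
  let h := LinearMap.prod r.δ r.aug
  let p := LinearMap.prod u f
  have hp : ∀ x, p x ∈ LinearMap.range h := by
    intro x
    obtain ⟨y, hy⟩ := r.pex1 (u x) (hδ x) (hε x)
    obtain ⟨z, _, hz, hz'⟩ := r.pex0 (f x - r.aug y)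
    refine ⟨y + z, Prod.ext ?_ ?_⟩
    · change r.δ (y + z) = u x
      rw [map_add, hy, hz, add_zero]
    · change r.aug (y + z) = f x
      rw [map_add, hz', add_sub_cancel]
  obtain ⟨t1, ht1⟩ := Module.projective_lifting_property h.rangeRestrict (p.codRestrict _ hp)
    h.surjective_rangeRestrict
  have h1 : ∀ x, h (t1 x) = p x := fun x => congrArg Subtype.val (LinearMap.congr_fun ht1 x)
  have hd1 : ∀ x, r.δ (t1 x) = u x := fun x => congrArg Prod.fst (h1 x)
  have he1 : ∀ x, r.aug (t1 x) = f x := fun x => congrArg Prod.snd (h1 x)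
  refine ⟨compR (r.c n) r.cP 0 t1, ?_, ?_, ?_⟩
  · intro w x
    apply r.gP.ext'; intro m
    rw [compR_pi (r.c n) r.cP 0 w, compR_pi (r.c n) r.cP 0 m, (r.g n).orth, r.gP.orth, sub_zero,
      sub_zero]
    by_cases hw : m = w
    · subst hw
      rw [if_pos rfl, if_pos rfl]
    · rw [if_neg hw, if_neg hw, map_zero, map_zero]
  · intro x
    rw [← aug0, compR_pi, aug0, he1, sub_zero, S_0]
  · intro x
    apply r.gP.ext'; intro m
    have e1 : m = (m - 1) + 1 := by ring
    rw [e1, ← δ_w, compR_pi, δ_w, hd1, hu, sub_zero, (r.gP).same]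

lemma exists_good (φ : r.PP →ₗ[R] r.S) : ∃ t, r.Good t ∧ r.aug ∘ₗ t = φ := by
  let Q : ∀ n, (r.P n →ₗ[R] r.PP) → Prop := fun n t =>
    (∀ w x, r.gP.π w (t x) = t ((r.g n).π w x)) ∧
      (∀ x, r.aug (t x) = φ (r.incl n x)) ∧ ∀ y, r.δ (t (r.d n y)) = 0
  have base : ∃ t, Q 0 t ∧ ∀ x, r.δ (t x) = 0 := by
    obtain ⟨t, h1, h2, h3⟩ := r.lift1 (n := 0) 0 (fun w x => by simp) (fun x => by simp)
      (fun x => by simp) (φ ∘ₗ r.incl 0)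
    exact ⟨t, ⟨h1, h2, fun y => h3 _⟩, h3⟩
  have step : ∀ n t, Q n t → ∃ t', Q (n + 1) t' ∧
      ∀ x, r.δ (t' x) = ((-1 : ℤ) ^ (n + 1)) • t (r.d n x) := by
    rintro n t ⟨h1, h2, h3⟩
    obtain ⟨t', h1', h2', h3'⟩ := r.lift1 (n := n + 1) (((-1 : ℤ) ^ (n + 1)) • (t ∘ₗ r.d n))
      (fun w x => by
        change ((-1 : ℤ) ^ (n + 1)) • t (r.d n _) = r.gP.π (w + 1) (((-1 : ℤ) ^ (n + 1)) • t (r.d n x))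
        rw [map_zsmul, h1, r.d_w])
      (fun x => by
        change r.δ (((-1 : ℤ) ^ (n + 1)) • t (r.d n x)) = 0
        rw [map_zsmul, h3, smul_zero])
      (fun x => by
        change r.aug (((-1 : ℤ) ^ (n + 1)) • t (r.d n x)) = 0
        rw [map_zsmul, h2]
        have := r.S_d (φ ∘ₗ r.incl n) x
        rw [LinearMap.comp_apply] at this
        rw [this, smul_zero])
      (φ ∘ₗ r.incl (n + 1))
    refine ⟨t', ⟨h1', h2', fun y => ?_⟩, h3'⟩
    rw [h3']
    change ((-1 : ℤ) ^ (n + 1)) • t (r.d n (r.d (n + 1) y)) = 0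
    rw [r.dd, map_zero, smul_zero]
  choose t0 hQ0 ht0 using base
  choose st hQs hst using step
  let seq : ∀ n, {t // Q n t} := fun n =>
    Nat.rec (motive := fun n => {t // Q n t}) ⟨t0, hQ0⟩ (fun n t => ⟨st n t.1 t.2, hQs n t.1 t.2⟩) n
  have hseq : ∀ n x, r.δ ((seq (n + 1)).1 x) = ((-1 : ℤ) ^ (n + 1)) • (seq n).1 (r.d n x) :=
    fun n x => hst n (seq n).1 (seq n).2 x
  let t : r.PP →ₗ[R] r.PP := DFinsupp.lsum ℕ (fun n => (seq n).1)
  have ht : ∀ n x, t (r.incl n x) = (seq n).1 x := fun n x =>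
    DFinsupp.lsum_single ℕ (fun n => (seq n).1) n x
  refine ⟨t, ⟨fun i => r.ind (by simp) ?_ ?_, r.ind (by simp) ?_ ?_⟩, DFinsupp.lhom_ext ?_⟩
  · intro x y hx hy; simp only [map_add, hx, hy]
  · intro n x
    rw [gP_incl, ht, ht, (seq n).2.1]
  · intro x y hx hy; simp only [map_add, hx, hy]
  · intro n x
    cases n with
    | zero => rw [δ_incl0, ht, map_zero]; exact ht0 x
    | succ n => rw [δ_incl, ht, map_zsmul, ht, hseq]
  · intro n x
    change r.aug (t (r.incl n x)) = φ (r.incl n x)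
    rw [ht, (seq n).2.2.1]

/-- the lift -/
def Θ (φ : r.PP →ₗ[R] r.S) : r.PP →ₗ[R] r.PP := (r.exists_good φ).choose
lemma Θg (φ) : r.Good (r.Θ φ) := (r.exists_good φ).choose_spec.1
lemma aug_Θ (φ) : r.aug ∘ₗ r.Θ φ = φ := (r.exists_good φ).choose_spec.2
lemma Θ_uniq {t φ} (h : r.Good t) (h' : r.aug ∘ₗ t = φ) : r.Θ φ = t :=
  (r.Θg φ).uniq h (by rw [aug_Θ, h'])
lemma Θ_add (φ ψ) : r.Θ (φ + ψ) = r.Θ φ + r.Θ ψ :=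
  r.Θ_uniq ((r.Θg φ).add (r.Θg ψ)) (by rw [LinearMap.comp_add, aug_Θ, aug_Θ])
lemma Θ_aug : r.Θ r.aug = LinearMap.id := r.Θ_uniq (Good.id r) rfl
lemma Θ_comp (φ ψ) : r.Θ φ ∘ₗ r.Θ ψ = r.Θ (φ ∘ₗ r.Θ ψ) :=
  (r.Θ_uniq ((r.Θg φ).comp (r.Θg ψ)) (by rw [← LinearMap.comp_assoc, aug_Θ])).symm

end Res
end YGr
end

noncomputable section
namespace YGr
set_option linter.unusedSectionVars false
universe v u
variable {k R : Type} [Field k] [Ring R] [Algebra k R] {gR : GRg k R}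

/-- Comparison with Ext groups. -/
structure YD (r : Res gR) {C : Type u} [Category.{v} C] [Abelian C] [HasExt.{1} C] (X : C) where
  G : ∀ a : ℕ, (r.P a →ₗ[R] r.S) ≃+ Ext X X a
  G_one : G 0 r.ε = Ext.mk₀ (𝟙 X)
  G_mul : ∀ (a b : ℕ) (f : r.P a →ₗ[R] r.S) (g : r.P b →ₗ[R] r.S) (t : r.PP →ₗ[R] r.PP),
    r.Good t → (∀ x, r.aug (t (r.incl a x)) = f x) →
    (G a f).comp (G b g) rfl = G (a + b) (((g ∘ₗ DFinsupp.lapply b) ∘ₗ t) ∘ₗ r.incl (a + b))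
  N : ℕ
  hN : ∀ a, N < a → Subsingleton (Ext X X a)

/-- Data on the top module. -/
structure SD (r : Res gR) where
  m : ℕ
  e : Fin m → R
  eorth : ∀ i j, e i * e j = if i = j then e i else 0
  esum : ∑ i, e i = 1
  edeg : ∀ i, gR.π 0 (e i) = e i
  espan : ∀ r, ∃ c : Fin m → k, gR.π 0 r = ∑ i, c i • e i
  s0 : r.S
  e0 : R
  e0e0 : e0 * e0 = e0
  e0deg : gR.π 0 e0 = e0
  gen0 : ∀ s : r.S, ∃ a : R, a • s0 = s
  e0S : ∀ s : r.S, e0 • s = s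
  ann : ∀ a : R, a • s0 = 0 → gR.π 0 a * e0 = 0

namespace YD
variable {r : Res gR} {C : Type u} [Category.{v} C] [Abelian C] [HasExt.{1} C] {X : C}
  (y : YD r X)

/-- homogeneous elements of the Ext ring -/
def of (a : ℕ) : Ext X X a →+ ExtRing X := DirectSum.of (fun i : ℕ => Ext X X i) a

lemma of_mul (a b : ℕ) (α : Ext X X a) (β : Ext X X b) :
    (of a α * of b β : ExtRing X) = of (a + b) (α.comp β rfl) :=
  letI := ExtYoneda.gring X
  DirectSum.of_mul_of (A := fun i : ℕ => Ext X X i) α β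

lemma of_one : (1 : ExtRing X) = of 0 (Ext.mk₀ (𝟙 X)) := rfl

lemma ind {p : ExtRing X → Prop} (h0 : p 0) (hadd : ∀ x y, p x → p y → p (x + y))
    (hs : ∀ n x, p (of n x)) (x) : p x :=
  DirectSum.induction_on (motive := p) x h0 hs hadd

/-- associated homomorphism -/
def H (a : ℕ) : Ext X X a →+ (r.PP →ₗ[R] r.S) where
  toFun α := (y.G a).symm α ∘ₗ DFinsupp.lapply a
  map_zero' := by rw [map_zero]; rfl
  map_add' α β := by rw [map_add]; rfl

/-- associated homomorphism -/
def F : ExtRing X →+ (r.PP →ₗ[R] r.S) := DirectSum.toAddMonoid (β := fun i : ℕ => Ext X X i) y.H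

lemma F_of (a α) : y.F (of a α) = (y.G a).symm α ∘ₗ DFinsupp.lapply a :=
  DirectSum.toAddMonoid_of (β := fun i : ℕ => Ext X X i) y.H a α

lemma F_of_incl_same (a α x) : y.F (of a α) (r.incl a x) = (y.G a).symm α x := by
  rw [F_of]
  exact congrArg ((y.G a).symm α) (r.incl_same a x)

lemma F_of_incl_ne {m a} (h : m ≠ a) (α x) : y.F (of a α) (r.incl m x) = 0 := by
  rw [F_of]
  exact (congrArg ((y.G a).symm α) (r.incl_ne h.symm x)).trans (map_zero _)

lemma F_one : y.F 1 = r.aug := by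
  rw [of_one, F_of, ← y.G_one, AddEquiv.symm_apply_apply]; rfl

lemma F_mul (p q : ExtRing X) : y.F (p * q) = y.F q ∘ₗ r.Θ (y.F p) := by
  refine ind (p := fun p => y.F (p * q) = y.F q ∘ₗ r.Θ (y.F p)) ?_ ?_ ?_ p
  · have h0 : r.Θ (0 : r.PP →ₗ[R] r.S) = 0 := by
      have := r.Θ_add 0 0
      rw [add_zero] at this
      exact left_eq_add.1 this
    rw [zero_mul, map_zero, h0, LinearMap.comp_zero]
  · intro p p' hp hp'
    rw [add_mul, map_add, map_add, hp, hp', r.Θ_add, LinearMap.comp_add]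
  · intro a α
    refine ind (p := fun q => y.F (of a α * q) = y.F q ∘ₗ r.Θ (y.F (of a α))) ?_ ?_ ?_ q
    · rw [mul_zero, map_zero, LinearMap.zero_comp]
    · intro p p' hp hp'
      rw [mul_add, map_add, map_add, hp, hp', LinearMap.add_comp]
    · intro b β
      rw [of_mul]
      refine DFinsupp.lhom_ext (fun m x => ?_)
      change y.F _ (r.incl m x) = y.F (of b β) (r.Θ (y.F (of a α)) (r.incl m x))
      have hg := r.Θg (y.F (of a α))
      have hau : ∀ z, r.aug (r.Θ (y.F (of a α)) z) = y.F (of a α) z :=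
        fun z => LinearMap.congr_fun (r.aug_Θ _) z
      by_cases h : m = a + b
      · subst h
        rw [F_of_incl_same]
        have := y.G_mul a b ((y.G a).symm α) ((y.G b).symm β) _ hg (fun x => by
          rw [hau, F_of_incl_same])
        rw [AddEquiv.apply_symm_apply, AddEquiv.apply_symm_apply] at this
        rw [this, AddEquiv.symm_apply_apply, F_of y b β]; rfl
      · rw [F_of_incl_ne y h, F_of y b β]
        have := hg.hom a (fun m x hm => by rw [hau, F_of_incl_ne y hm]) m b x h
        exact ((congrArg ((y.G b).symm β) this).trans (map_zero _)).symm

lemma F_incl (q : ExtRing X) (a : ℕ) (x) :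
    y.F q (r.incl a x) = (y.G a).symm ((show ⨁ i : ℕ, Ext X X i from q) a) x := by
  refine ind (p := fun q => y.F q (r.incl a x) =
    (y.G a).symm ((show ⨁ i : ℕ, Ext X X i from q) a) x) ?_ ?_ ?_ q
  · have : ((show ⨁ i : ℕ, Ext X X i from (0 : ExtRing X)) a) = 0 := rfl
    rw [this, map_zero, map_zero]; rfl
  · intro p p' hp hp'
    have : ((show ⨁ i : ℕ, Ext X X i from (p + p' : ExtRing X)) a) =
      (show ⨁ i : ℕ, Ext X X i from p) a + (show ⨁ i : ℕ, Ext X X i from p') a := rfl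
    rw [this, map_add, map_add]
    exact congrArg₂ (· + ·) hp hp'
  · intro b β
    by_cases h : a = b
    · subst h
      rw [F_of_incl_same]
      congr 2
      exact (DirectSum.of_eq_same (β := fun i : ℕ => Ext X X i) a β).symm
    · rw [F_of_incl_ne y h]
      have : ((show ⨁ i : ℕ, Ext X X i from (of b β : ExtRing X)) a) = 0 :=
        DirectSum.of_eq_of_ne (β := fun i : ℕ => Ext X X i) b a β h
      rw [this, map_zero]; rfl

lemma F_bij : Function.Bijective y.F := by
  constructor
  · rw [injective_iff_map_eq_zero]
    intro q hq
    refine DFinsupp.ext (fun a => ?_)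
    change (show ⨁ i : ℕ, Ext X X i from q) a = 0
    rw [← map_eq_zero_iff _ (y.G a).symm.injective]
    ext x
    rw [← F_incl, hq]; rfl
  · intro φ
    refine ⟨∑ a ∈ Finset.range (y.N + 1), of a (y.G a (φ ∘ₗ r.incl a)), ?_⟩
    refine DFinsupp.lhom_ext (fun m x => ?_)
    change y.F _ (r.incl m x) = φ (r.incl m x)
    rw [map_sum, LinearMap.sum_apply]
    by_cases hm : m ∈ Finset.range (y.N + 1)
    · rw [Finset.sum_eq_single_of_mem m hm, F_of_incl_same, AddEquiv.symm_apply_apply]; rfl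
      intro b _ hb
      exact F_of_incl_ne y hb.symm _ _
    · rw [Finset.sum_eq_zero]
      · rw [Finset.mem_range] at hm
        have := y.hN m (by omega)
        have h1 : φ ∘ₗ r.incl m = 0 := (y.G m).injective (Subsingleton.elim _ _)
        exact (LinearMap.congr_fun h1 x).symm
      · intro b hb
        refine F_of_incl_ne y ?_ _ _
        rintro rfl
        exact hm hb

/-- the action -/
def act : (ExtRing X)ᵐᵒᵖ →+* Module.End R r.PP where
  toFun l := r.Θ (y.F l.unop)
  map_one' := by rw [MulOpposite.unop_one, F_one, r.Θ_aug]; rfl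
  map_mul' a b := by
    rw [MulOpposite.unop_mul, F_mul, ← r.Θ_comp]; rfl
  map_zero' := by
    have := r.Θ_add 0 0
    rw [add_zero] at this
    rw [MulOpposite.unop_zero, map_zero]
    exact left_eq_add.1 this
  map_add' a b := by rw [MulOpposite.unop_add, map_add, r.Θ_add]

lemma aug_act (l) : r.aug ∘ₗ y.act l = y.F l.unop := r.aug_Θ _

/-- The abstract setup. -/
def toStp (sd : SD r) : Stp gR (ExtRing X)ᵐᵒᵖ where
  PP := r.PP
  gP := r.gP
  cP := r.cP
  act := y.act
  act_w l i x := (r.Θg _).w i x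
  δ := r.δ
  δδ := r.δδ
  δ_w := r.δ_w
  δ_act l x := (r.Θg _).δ x
  pos := r.ppos
  gen := r.pgen
  S := r.S
  ε := r.aug
  ε0 := r.aug0
  ex1 := r.pex1
  ex0 := r.pex0
  bij := by
    have : (fun l : (ExtRing X)ᵐᵒᵖ => (r.aug ∘ₗ y.act l : r.PP →ₗ[R] r.S)) =
        y.F ∘ MulOpposite.unop := by
      funext l; exact y.aug_act l
    rw [this]
    exact y.F_bij.comp MulOpposite.unop_bijective
  m := sd.m
  e := sd.e
  eorth := sd.eorth
  esum := sd.esum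
  edeg := sd.edeg
  espan := sd.espan
  s0 := sd.s0
  e0 := sd.e0
  e0e0 := sd.e0e0
  e0deg := sd.e0deg
  gen0 := sd.gen0
  Splus := r.Splus
  e0S := sd.e0S
  ann := sd.ann

/-- filtration -/
def Fil (X : C) (i : ℕ) : AddSubgroup (ExtRing X) :=
  AddSubgroup.closure {q | ∃ a, ∃ α : Ext X X a, i ≤ a ∧ q = of a α}

lemma Fil_mul {i j : ℕ} {p q : ExtRing X} (hp : p ∈ Fil X i) (hq : q ∈ Fil X j) :
    p * q ∈ Fil X (i + j) := by
  refine AddSubgroup.closure_induction (p := fun p _ => p * q ∈ Fil X (i + j)) ?_ ?_ ?_ ?_ hp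
  · rintro _ ⟨a, α, ha, rfl⟩
    refine AddSubgroup.closure_induction (p := fun q _ => of a α * q ∈ Fil X (i + j)) ?_ ?_ ?_ ?_ hq
    · rintro _ ⟨b, β, hb, rfl⟩
      rw [of_mul]
      exact AddSubgroup.subset_closure ⟨a + b, _, by omega, rfl⟩
    · rw [mul_zero]; exact zero_mem _
    · intro x y _ _ hx hy; rw [mul_add]; exact add_mem hx hy
    · intro x _ hx; rw [mul_neg]; exact neg_mem hx
  · rw [zero_mul]; exact zero_mem _
  · intro x y _ _ hx hy; rw [add_mul]; exact add_mem hx hy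
  · intro x _ hx; rw [neg_mul]; exact neg_mem hx

lemma Fil_zero {p : ExtRing X} {i : ℕ} (hi : y.N < i) (hp : p ∈ Fil X i) : p = 0 := by
  refine AddSubgroup.closure_induction (p := fun p _ => p = 0) ?_ rfl ?_ ?_ hp
  · rintro _ ⟨a, α, ha, rfl⟩
    have := y.hN a (by omega)
    rw [Subsingleton.elim α 0, map_zero]
  · rintro x y _ _ rfl rfl; exact add_zero _
  · rintro x _ rfl; exact neg_zero

lemma Fil_top (p : ExtRing X) : p ∈ Fil X 0 :=
  ind (p := fun q => q ∈ Fil X 0) (zero_mem _) (fun _ _ h1 h2 => add_mem h1 h2) (fun a α => AddSubgroup.subset_closure ⟨a, α, by omega, rfl⟩) p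

lemma Fil_one (p : ExtRing X) (hp : (show ⨁ i : ℕ, Ext X X i from p) 0 = 0) : p ∈ Fil X 1 := by
  classical
  have h : (∑ i ∈ DFinsupp.support (show ⨁ i : ℕ, Ext X X i from p),
    (DirectSum.of (fun i : ℕ => Ext X X i) i)
      ((show ⨁ i : ℕ, Ext X X i from p) i) : ⨁ i : ℕ, Ext X X i) = p :=
    DirectSum.sum_support_of (show ⨁ i : ℕ, Ext X X i from p)
  have h2 : (∑ i ∈ DFinsupp.support (show ⨁ i : ℕ, Ext X X i from p),
    of i ((show ⨁ i : ℕ, Ext X X i from p) i) : ExtRing X) ∈ Fil X 1 := by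
    refine sum_mem (fun i _ => ?_)
    by_cases hi : i = 0
    · subst hi
      rw [hp, map_zero]; exact zero_mem _
    · exact AddSubgroup.subset_closure ⟨i, _, by omega, rfl⟩
  have h3 : (∑ i ∈ DFinsupp.support (show ⨁ i : ℕ, Ext X X i from p),
    of i ((show ⨁ i : ℕ, Ext X X i from p) i) : ExtRing X) = p := h
  rw [h3] at h2
  exact h2

lemma K_Fil (sd : SD r) [Module.Finite k R] (l : (ExtRing X)ᵐᵒᵖ) (hl : (y.toStp sd).K l) :
    l.unop ∈ Fil X 1 := by
  apply Fil_one
  rw [← map_eq_zero_iff _ (y.G 0).symm.injective]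
  refine r.gen_zero _ (fun x hx => ?_)
  rw [← F_incl]
  have h1 := ((y.toStp sd).K_iff l).1 hl
  have h2 : (y.toStp sd).σ ((y.toStp sd).ε (r.incl 0 x)) = r.incl 0 x :=
    (y.toStp sd).σ_ε (x := r.incl 0 x) (by
      change r.gP.π 0 (r.incl 0 x) = r.incl 0 x
      rw [r.gP_incl, hx]) (r.δ_incl0 x)
  have h3 := LinearMap.congr_fun h1 ((y.toStp sd).ε (r.incl 0 x))
  rw [Stp.bar_apply, h2] at h3
  rw [← aug_act]
  exact h3

lemma kill_one (sd : SD r) [Module.Finite k R] :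
    (y.toStp sd).kill (y.N + 1) (1 : (ExtRing X)ᵐᵒᵖ) := by
  have : ∀ (j i : ℕ) (l : (ExtRing X)ᵐᵒᵖ), y.N < i + j → l.unop ∈ Fil X i →
      (y.toStp sd).kill j l := by
    intro j
    induction j with
    | zero =>
      intro i l hi hl
      exact MulOpposite.unop_injective (y.Fil_zero hi hl)
    | succ j ih =>
      intro i l hi hl l' hl'
      refine ih (i + 1) _ (by omega) ?_
      exact Fil_mul hl (y.K_Fil sd l' hl')
  exact this _ 0 1 (by omega) (Fil_top _)

theorem main (y : YD r X) (sd : SD r) [Module.Finite k R] [HasExt.{2} (ModuleCat.{1} (ExtRing X)ᵐᵒᵖ)]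
    {Γ : Type} [Ring Γ] (c : Cor (1 - sd.e0) Γ)
    (hΓ : ∃ n : ℕ, ∀ (M N : ModuleCat.{0} Γ) (i : ℕ), n < i → Subsingleton (Ext M N i)) :
    ∃ n : ℕ, ∀ (M N : ModuleCat.{1} (ExtRing X)ᵐᵒᵖ) (i : ℕ), n < i → Subsingleton (Ext M N i) :=
  letI := HasDerivedCategory.standard (ModuleCat.{1} (ExtRing X)ᵐᵒᵖ)
  (y.toStp sd).core _ (y.kill_one sd) c hΓ

end YD
end YGr
end

noncomputable section
namespace YGr
set_option linter.unusedSectionVars false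

section Prj
variable {k M σ : Type} [Field k] [AddCommGroup M] [Module k M] [SetLike σ M]
  [AddSubmonoidClass σ M] (g : ℕ → σ) [DirectSum.Decomposition g]

/-- component as additive map -/
def prA (d : ℤ) : M →+ M where
  toFun x := if 0 ≤ d then ((DirectSum.decompose g x) d.toNat : M) else 0
  map_zero' := by simp
  map_add' x y := by
    split_ifs
    · rw [DirectSum.decompose_add]; rfl
    · rw [add_zero]

lemma prA_mem (d : ℕ) (i : ℤ) (x : M) (hx : x ∈ g d) : prA g i x = if i = d then x else 0 := by
  change (if 0 ≤ i then ((DirectSum.decompose g x) i.toNat : M) else 0) = _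
  by_cases h : i = d
  · subst h
    rw [if_pos (by omega), if_pos rfl]
    exact DirectSum.decompose_of_mem_same g hx
  · rw [if_neg h]
    split_ifs
    · exact DirectSum.decompose_of_mem_ne g hx (by omega)
    · rfl

lemma prA_ind {p : M → Prop} (h0 : p 0) (hadd : ∀ x y, p x → p y → p (x + y))
    (h : ∀ d, ∀ x ∈ g d, p x) (x : M) : p x := by
  induction x using DirectSum.Decomposition.inductionOn g with
  | zero => exact h0
  | homogeneous m => exact h _ _ m.2
  | add x y hx hy => exact hadd _ _ hx hy

lemma prA_prop (d : ℕ) (x : M) : prA g d x ∈ g d := by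
  change (if 0 ≤ (d : ℤ) then ((DirectSum.decompose g x) (d : ℤ).toNat : M) else 0) ∈ _
  rw [if_pos (by omega)]
  exact ((DirectSum.decompose g x) d).2

/-- component as linear map -/
def prK (hk : ∀ d (c : k), ∀ x ∈ g d, c • x ∈ g d) (d : ℤ) : M →ₗ[k] M where
  toFun := prA g d
  map_add' := map_add _
  map_smul' c x := by
    rw [RingHom.id_apply]
    refine prA_ind g (p := fun x => prA g d (c • x) = c • prA g d x) ?_ ?_ ?_ x
    · simp
    · intro x y hx hy; rw [smul_add, map_add, hx, hy, map_add, smul_add]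
    · intro i x hx
      rw [prA_mem g i d x hx, prA_mem g i d _ (hk i c x hx)]
      split_ifs
      · rfl
      · rw [smul_zero]

/-- shifted grading -/
def mkGrd (hk : ∀ d (c : k), ∀ x ∈ g d, c • x ∈ g d) (n B : ℕ)
    (hs : ∀ d, ∀ x ∈ g d, (d : ℤ) - n ∉ Finset.Icc (-(B : ℤ)) B → x = 0) : Grd k M where
  π w := prK g hk (n + w)
  b := B
  orth i j x := by
    refine prA_ind g (p := fun x => prA g (n + i) (prA g (n + j) x) =
      if i = j then prA g (n + j) x else 0) ?_ ?_ ?_ x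
    · simp
    · intro x y hx hy; rw [map_add, map_add, hx, hy]
      split_ifs
      · rfl
      · rw [add_zero]
    · intro d x hx
      rw [prA_mem g d (n + j) x hx]
      by_cases h : (n + j : ℤ) = d
      · rw [if_pos h, prA_mem g d (n + i) x hx]
        by_cases h' : i = j
        · rw [if_pos h', if_pos (by omega)]
        · rw [if_neg h', if_neg (by omega)]
      · rw [if_neg h, map_zero, ite_self]
  supp i x hi := by
    refine prA_ind g (p := fun x => prA g (n + i) x = 0) ?_ ?_ ?_ x
    · simp
    · intro x y hx hy; rw [map_add, hx, hy, add_zero]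
    · intro d x hx
      rw [prA_mem g d _ x hx]
      split_ifs with h
      · refine hs d x hx ?_
        rwa [← h, add_sub_cancel_left]
      · rfl
  tot x := by
    refine prA_ind g (p := fun x => ∑ i ∈ Finset.Icc (-(B : ℤ)) B, prA g (n + i) x = x) ?_ ?_ ?_ x
    · simp
    · intro x y hx hy
      simp only [map_add]
      rw [Finset.sum_add_distrib, hx, hy]
    · intro d x hx
      by_cases h : (d : ℤ) - n ∈ Finset.Icc (-(B : ℤ)) B
      · rw [Finset.sum_eq_single_of_mem _ h]
        · rw [prA_mem g d _ x hx, if_pos (by omega)]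
        · intro i _ hi
          rw [prA_mem g d _ x hx, if_neg (by omega)]
      · rw [hs d x hx h]; simp

lemma mkGrd_π (hk : ∀ d (c : k), ∀ x ∈ g d, c • x ∈ g d) (n B : ℕ) (hs) (w : ℤ) (x : M) :
    (mkGrd g hk n B hs).π w x = prA g (n + w) x := rfl

end Prj

section Alg
variable {k A : Type} [Field k] [Ring A] [Algebra k A] (𝒜 : ℕ → Submodule k A) [GradedRing 𝒜]

lemma exists_bound [FiniteDimensional k A] : ∃ B : ℕ, ∀ j, B < j → 𝒜 j = ⊥ := by
  have h := WellFoundedGT.finite_ne_bot_of_iSupIndep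
    (DirectSum.Decomposition.isInternal 𝒜).submodule_iSupIndep
  obtain ⟨B, hB⟩ := h.bddAbove
  refine ⟨B, fun j hj => ?_⟩
  by_contra hne
  have := hB hne
  omega

/-- grading on the opposite algebra -/
def opGR (B : ℕ) (hB : ∀ j, B < j → 𝒜 j = ⊥) : GRg k Aᵐᵒᵖ where
  π w := (MulOpposite.opLinearEquiv k).toLinearMap ∘ₗ
    prK 𝒜 (fun d c x hx => (𝒜 d).smul_mem c hx) w ∘ₗ
    (MulOpposite.opLinearEquiv k).symm.toLinearMap
  b := B
  orth i j x := by
    have := (mkGrd 𝒜 (fun d (c : k) x hx => (𝒜 d).smul_mem c hx) 0 B (by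
      intro d x hx hd
      have : x ∈ (⊥ : Submodule k A) := hB d (by simp at hd; omega) ▸ hx
      simpa using this)).orth i j x.unop
    rw [mkGrd_π, mkGrd_π, Nat.cast_zero, zero_add, zero_add] at this
    change MulOpposite.op (prA 𝒜 i (prA 𝒜 j x.unop)) = if i = j then MulOpposite.op (prA 𝒜 j x.unop) else 0
    rw [this]
    split_ifs <;> rfl
  supp i x hi := by
    have := (mkGrd 𝒜 (fun d (c : k) x hx => (𝒜 d).smul_mem c hx) 0 B (by
      intro d x hx hd
      have : x ∈ (⊥ : Submodule k A) := hB d (by simp at hd; omega) ▸ hx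
      simpa using this)).supp i x.unop hi
    rw [mkGrd_π, Nat.cast_zero, zero_add] at this
    change MulOpposite.op (prA 𝒜 i x.unop) = _
    rw [this]; rfl
  tot x := by
    have := (mkGrd 𝒜 (fun d (c : k) x hx => (𝒜 d).smul_mem c hx) 0 B (by
      intro d x hx hd
      have : x ∈ (⊥ : Submodule k A) := hB d (by simp at hd; omega) ▸ hx
      simpa using this)).tot x.unop
    simp only [mkGrd_π, Nat.cast_zero, zero_add] at this
    change ∑ i ∈ Finset.Icc (-(B : ℤ)) B, MulOpposite.opLinearEquiv k (prA 𝒜 i x.unop) = x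
    rw [← map_sum]
    exact congrArg MulOpposite.op this
  cpt i j a x := by
    change MulOpposite.op (prA 𝒜 (i + j) (x.unop * prA 𝒜 i a.unop)) =
      MulOpposite.op (prA 𝒜 j x.unop * prA 𝒜 i a.unop)
    congr 1
    generalize a.unop = a
    generalize x.unop = x
    refine prA_ind 𝒜 (p := fun a => prA 𝒜 (i + j) (x * prA 𝒜 i a) = prA 𝒜 j x * prA 𝒜 i a) ?_ ?_ ?_ a
    · simp
    · intro a b ha hb; rw [map_add, mul_add, map_add, ha, hb, mul_add]
    intro d a ha
    rw [prA_mem 𝒜 d i a ha]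
    by_cases h : i = d
    · rw [if_pos h]
      refine prA_ind 𝒜 (p := fun x => prA 𝒜 (i + j) (x * a) = prA 𝒜 j x * a) ?_ ?_ ?_ x
      · simp
      · intro a b ha hb; rw [add_mul, map_add, ha, hb, map_add, add_mul]
      intro q x hx
      rw [prA_mem 𝒜 q j x hx, prA_mem 𝒜 (q + d) (i + j) _ (SetLike.mul_mem_graded hx ha)]
      by_cases h' : j = q
      · rw [if_pos h', if_pos (by push_cast; omega)]
      · rw [if_neg h', if_neg (by push_cast; omega), zero_mul]
    · rw [if_neg h]; simp
  neg i x hi := by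
    change MulOpposite.op (if 0 ≤ i then ((DirectSum.decompose 𝒜 x.unop) i.toNat : A) else 0) = _
    rw [if_neg (by omega)]; rfl
  one := by
    change MulOpposite.op (prA 𝒜 0 1) = _
    have := prA_mem 𝒜 0 0 1 SetLike.GradedOne.one_mem
    rw [this]; rfl

lemma opGR_π (B : ℕ) (hB) (w : ℤ) (x : Aᵐᵒᵖ) :
    (opGR 𝒜 B hB).π w x = MulOpposite.op (prA 𝒜 w x.unop) := rfl

end Alg
end YGr
end

noncomputable section
namespace YGr
set_option linter.unusedSectionVars false
section Rad
variable {k A : Type} [Field k] [Ring A] [Algebra k A] (𝒜 : ℕ → Submodule k A) [GradedRing 𝒜]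

lemma prA_mul_hom (i j : ℤ) (x a : A) :
    prA 𝒜 (i + j) (x * prA 𝒜 i a) = prA 𝒜 j x * prA 𝒜 i a := by
  refine prA_ind 𝒜 (p := fun a => prA 𝒜 (i + j) (x * prA 𝒜 i a) = prA 𝒜 j x * prA 𝒜 i a) ?_ ?_ ?_ a
  · simp
  · intro a b ha hb; rw [map_add, mul_add, map_add, ha, hb, mul_add]
  intro d a ha
  rw [prA_mem 𝒜 d i a ha]
  by_cases h : i = d
  · rw [if_pos h]
    refine prA_ind 𝒜 (p := fun x => prA 𝒜 (i + j) (x * a) = prA 𝒜 j x * a) ?_ ?_ ?_ x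
    · simp
    · intro a b ha hb; rw [add_mul, map_add, ha, hb, map_add, add_mul]
    intro q x hx
    rw [prA_mem 𝒜 q j x hx, prA_mem 𝒜 (q + d) (i + j) _ (SetLike.mul_mem_graded hx ha)]
    by_cases h' : j = q
    · rw [if_pos h', if_pos (by push_cast; omega)]
    · rw [if_neg h', if_neg (by push_cast; omega), zero_mul]
  · rw [if_neg h]; simp

lemma prA_neg (i : ℤ) (hi : i < 0) (x : A) : prA 𝒜 i x = 0 := by
  change (if 0 ≤ i then ((DirectSum.decompose 𝒜 x) i.toNat : A) else 0) = _
  rw [if_neg (by omega)]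

variable {𝒜} {B : ℕ}
lemma prA_tot (hB : ∀ j, B < j → 𝒜 j = ⊥) (x : A) : ∑ i ∈ Finset.Icc (-(B : ℤ)) B, prA 𝒜 i x = x := by
  have := congrArg (MulOpposite.opLinearEquiv k).symm ((opGR 𝒜 B hB).tot (MulOpposite.op x))
  rw [map_sum] at this
  exact this

lemma prA_mul (hB : ∀ j, B < j → 𝒜 j = ⊥) (i : ℤ) (x y : A) :
    prA 𝒜 i (x * y) = ∑ l ∈ Finset.Icc (-(B : ℤ)) B, prA 𝒜 (i - l) x * prA 𝒜 l y := by
  conv_lhs => rw [← prA_tot hB y, Finset.mul_sum, map_sum]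
  refine Finset.sum_congr rfl (fun l _ => ?_)
  rw [← prA_mul_hom, add_sub_cancel]

lemma prA_pow (hB : ∀ j, B < j → 𝒜 j = ⊥) {x : A} (hx : prA 𝒜 0 x = 0) (n : ℕ) :
    ∀ i : ℤ, i < n → prA 𝒜 i (x ^ n) = 0 := by
  induction n with
  | zero => intro i hi; exact prA_neg 𝒜 i (by omega) _
  | succ n ih =>
    intro i hi
    rw [pow_succ, prA_mul hB]
    refine Finset.sum_eq_zero (fun l _ => ?_)
    by_cases hl : l ≤ 0
    · have : prA 𝒜 l x = 0 := by
        rcases hl.lt_or_eq with h | h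
        · exact prA_neg 𝒜 l h x
        · rw [h, hx]
      rw [this, mul_zero]
    · rw [ih _ (by push_cast at hi; omega), zero_mul]

lemma nilp (hB : ∀ j, B < j → 𝒜 j = ⊥) {x : A} (hx : prA 𝒜 0 x = 0) : IsNilpotent x := by
  refine ⟨B + 1, ?_⟩
  rw [← prA_tot hB (x ^ (B + 1))]
  refine Finset.sum_eq_zero (fun l hl => ?_)
  refine prA_pow hB hx _ l ?_
  rw [Finset.mem_Icc] at hl
  push_cast; omega

lemma prA_zero_mul (hB : ∀ j, B < j → 𝒜 j = ⊥) (x y : A) :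
    prA 𝒜 0 (x * y) = prA 𝒜 0 x * prA 𝒜 0 y := by
  rw [prA_mul hB, Finset.sum_eq_single_of_mem (0 : ℤ) (by simp)]
  · simp
  · intro l _ hl
    by_cases h : l < 0
    · rw [prA_neg 𝒜 l h, mul_zero]
    · rw [prA_neg 𝒜 (0 - l) (by omega), zero_mul]

variable (𝒜) in
/-- the semisimple quotient -/
structure Ssq where
  m : ℕ
  ψ : A →+* (Fin m → k)
  ι : (Fin m → k) →ₐ[k] A
  ιψ : ∀ x, ι (ψ x) = prA 𝒜 0 x
  ψι : ∀ x, ψ (ι x) = x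

lemma prA_one : prA 𝒜 0 (1 : A) = 1 := by
  have := prA_mem 𝒜 0 0 1 SetLike.GradedOne.one_mem
  rw [this]; rfl

lemma exists_ssq (hB : ∀ j, B < j → 𝒜 j = ⊥) (h0 : GradeZeroIsProductOfField 𝒜) :
    Nonempty (Ssq 𝒜) := by
  obtain ⟨m, ⟨φ⟩⟩ := h0
  let p : A →+* gradeZeroSubalgebra 𝒜 :=
    { toFun := fun x => ⟨prA 𝒜 0 x, prA_prop 𝒜 0 x⟩
      map_zero' := Subtype.ext (map_zero _)
      map_one' := Subtype.ext prA_one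
      map_add' := fun x y => Subtype.ext (map_add _ x y)
      map_mul' := fun x y => Subtype.ext (prA_zero_mul hB x y) }
  refine ⟨⟨m, (φ : gradeZeroSubalgebra 𝒜 →+* (Fin m → k)).comp p,
    (gradeZeroSubalgebra 𝒜).val.comp φ.symm.toAlgHom, ?_, ?_⟩⟩
  · intro x
    change ((φ.symm (φ (p x)) : gradeZeroSubalgebra 𝒜) : A) = _
    rw [AlgEquiv.symm_apply_apply]
    rfl
  · intro x
    change φ (p ((φ.symm x : gradeZeroSubalgebra 𝒜) : A)) = x
    have : p ((φ.symm x : gradeZeroSubalgebra 𝒜) : A) = φ.symm x := by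
      apply Subtype.ext
      change prA 𝒜 0 _ = _
      have := prA_mem 𝒜 0 0 _ (φ.symm x).2
      rw [this]; rfl
    rw [this, AlgEquiv.apply_symm_apply]

variable (z : Ssq 𝒜)

lemma Ssq.ψ_zero {x : A} : z.ψ x = 0 ↔ prA 𝒜 0 x = 0 := by
  constructor
  · intro h; rw [← z.ιψ, h, map_zero]
  · intro h; rw [← z.ψι (z.ψ x), z.ιψ, h, map_zero]

lemma Ssq.nil (hB : ∀ j, B < j → 𝒜 j = ⊥) {x : A} (hx : z.ψ x = 0) : IsNilpotent x :=
  nilp hB (z.ψ_zero.1 hx)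

lemma Ssq.unit (hB : ∀ j, B < j → 𝒜 j = ⊥) {x : A} (hx : z.ψ x = 1) : IsUnit x := by
  have h : z.ψ (x - 1) = 0 := by rw [map_sub, hx, map_one, sub_self]
  have := (z.nil hB h).isUnit_one_add
  rwa [add_sub_cancel] at this

lemma Ssq.rad (hB : ∀ j, B < j → 𝒜 j = ⊥) (x : A) : x ∈ ringRadical A ↔ z.ψ x = 0 := by
  change x ∈ (⊥ : TwoSidedIdeal A).jacobson ↔ _
  rw [TwoSidedIdeal.mem_jacobson_iff]
  simp only [TwoSidedIdeal.mem_bot]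
  constructor
  · intro h
    ext i
    by_contra hi
    rw [Pi.zero_apply] at hi
    obtain ⟨w, hw⟩ := h (z.ι (fun _ => -(z.ψ x i)⁻¹))
    have := congrArg z.ψ hw
    rw [map_sub, map_add, map_mul, map_mul, z.ψι, map_one, map_zero] at this
    have := congrFun this i
    simp only [Pi.sub_apply, Pi.add_apply, Pi.mul_apply, Pi.one_apply, Pi.zero_apply] at this
    rw [mul_assoc, neg_mul, inv_mul_cancel₀ hi] at this
    simp at this
  · intro h y
    have hu : IsUnit (y * x + 1) := z.unit hB (by rw [map_add, map_mul, h, mul_zero, zero_add, map_one])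
    obtain ⟨u, hu⟩ := hu
    refine ⟨↑u⁻¹, ?_⟩
    rw [mul_assoc, ← mul_add_one, ← hu, Units.inv_mul, sub_self]

variable {e : A}

lemma mem_rightIdeal {x : A} (hx : x ∈ rightIdeal A e) : ∃ a, x = e * a := by
  obtain ⟨a, rfl⟩ := Submodule.mem_span_singleton.1 hx
  exact ⟨a.unop, rfl⟩

/-- the class of an element of `e A` -/
def clS (e a : A) : SeModule A e :=
  Submodule.Quotient.mk ⟨e * a, Submodule.mem_span_singleton.2 ⟨MulOpposite.op a, rfl⟩⟩

lemma clS_surj (s : SeModule A e) : ∃ a, clS e a = s := by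
  obtain ⟨⟨x, hx⟩, rfl⟩ := Submodule.Quotient.mk_surjective _ s
  obtain ⟨a, rfl⟩ := mem_rightIdeal hx
  exact ⟨a, rfl⟩

lemma clS_smul (a b : A) : MulOpposite.op b • clS e a = clS e (a * b) := by
  have h : ∀ (x : rightIdeal A e), MulOpposite.op b • (show SeModule A e from Submodule.Quotient.mk x) =
    (show SeModule A e from Submodule.Quotient.mk (MulOpposite.op b • x)) := fun _ => rfl
  refine (h _).trans ?_
  exact congrArg (Submodule.Quotient.mk (p := (eRad A e).comap (rightIdeal A e).subtype))
    (Subtype.ext (mul_assoc e a b))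

lemma clS_sub (a b : A) : clS e a - clS e b = clS e (a - b) := by
  have h : ∀ (x y : rightIdeal A e), (show SeModule A e from Submodule.Quotient.mk x) -
    (show SeModule A e from Submodule.Quotient.mk y) =
    (show SeModule A e from Submodule.Quotient.mk (x - y)) := fun _ _ => rfl
  refine (h _ _).trans ?_
  exact congrArg (Submodule.Quotient.mk (p := (eRad A e).comap (rightIdeal A e).subtype))
    (Subtype.ext (mul_sub e a b).symm)

lemma eRad_ψ (hB : ∀ j, B < j → 𝒜 j = ⊥) {x : A} (hx : x ∈ eRad A e) : z.ψ x = 0 := by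
  unfold eRad at hx
  induction hx using Submodule.span_induction with
  | mem x h =>
    obtain ⟨a, ha, rfl⟩ := h
    change z.ψ (e * a) = 0
    rw [map_mul, (z.rad hB a).1 ha, mul_zero]
  | zero => exact map_zero _
  | add x y _ _ hx hy => rw [map_add, hx, hy, add_zero]
  | smul a x _ hx =>
    change z.ψ (x * a.unop) = 0
    rw [map_mul, hx, zero_mul]

lemma clS_zero (hB : ∀ j, B < j → 𝒜 j = ⊥) (he : IsIdempotentElem e) (a : A) :
    clS e a = 0 ↔ z.ψ (e * a) = 0 := by
  have h : clS e a = 0 ↔ e * a ∈ eRad A e :=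
    (Submodule.Quotient.mk_eq_zero _)
  rw [h]
  constructor
  · exact eRad_ψ z hB
  · intro h
    refine Submodule.subset_span ⟨e * a, (z.rad hB _).2 h, ?_⟩
    change e * (e * a) = e * a
    rw [← mul_assoc, he.eq]

/-- the corner identification -/
lemma exists_cor (hB : ∀ j, B < j → 𝒜 j = ⊥) (he : IsIdempotentElem e) :
    Nonempty (Cor (1 - MulOpposite.op (z.ι (z.ψ e)) : Aᵐᵒᵖ) (CornerRing (1 - e) he.one_sub)ᵐᵒᵖ) := by
  set f := z.ι (z.ψ e) with hf
  have hff : f * f = f := by rw [hf, ← map_mul, ← map_mul, he.eq]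
  have hψf : z.ψ f = z.ψ e := z.ψι _
  have hψ : z.ψ e * z.ψ e = z.ψ e := by rw [← map_mul, he.eq]
  have hee : e * e = e := he
  have hu : IsUnit (f * e + (1 - f) * (1 - e)) := by
    apply z.unit hB
    simp only [map_add, map_mul, map_sub, map_one, hψf]
    linear_combination 2 * hψ
  obtain ⟨u, hu⟩ := hu
  have h1 : (1 - f) * (u : A) = u * (1 - e) := by
    rw [hu]
    have : (1 - f) * (f * e + (1 - f) * (1 - e)) - (f * e + (1 - f) * (1 - e)) * (1 - e)
       = (f - f * f) * e - (f - f * f) * (1 - e) - f * (e - e * e) + (1 - f) * (e - e * e) := by noncomm_ring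
    rw [hff, hee] at this
    simp only [sub_self, zero_mul, mul_zero, add_zero] at this
    exact sub_eq_zero.1 this
  have h2 : (1 - e) * (↑u⁻¹ : A) = ↑u⁻¹ * (1 - f) := by
    rw [Units.eq_inv_mul_iff_mul_eq, ← mul_assoc, ← h1, mul_assoc, Units.mul_inv, mul_one]
  refine ⟨⟨⟨⟨fun x => MulOpposite.op (u * x.unop.1 * ↑u⁻¹), ?_⟩, ?_⟩, ?_, ?_, ?_, ?_⟩⟩
  · change MulOpposite.op ((u : A) * 0 * ↑u⁻¹) = 0
    simp
  · intro x y
    change MulOpposite.op ((u : A) * (x.unop.1 + y.unop.1) * ↑u⁻¹) = _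
    rw [mul_add, add_mul]; rfl
  · intro x y
    change MulOpposite.op ((u : A) * (y.unop.1 * x.unop.1) * ↑u⁻¹) =
      MulOpposite.op (((u : A) * y.unop.1 * ↑u⁻¹) * ((u : A) * x.unop.1 * ↑u⁻¹))
    simp only [mul_assoc, Units.inv_mul_cancel_left]
  · intro x y h
    have h : MulOpposite.op ((u : A) * x.unop.1 * ↑u⁻¹) = MulOpposite.op ((u : A) * y.unop.1 * ↑u⁻¹) := h
    have h := MulOpposite.op_injective h
    rw [Units.mul_left_inj, Units.mul_right_inj] at h
    exact MulOpposite.unop_injective (Subtype.ext h)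
  · change MulOpposite.op ((u : A) * (1 - e) * ↑u⁻¹) = 1 - MulOpposite.op f
    rw [← h1, mul_assoc, Units.mul_inv, mul_one]; rfl
  · intro x hx
    have hx : (1 - f) * (x.unop * (1 - f)) = x.unop := congrArg MulOpposite.unop hx
    have hf1 : (1 - f) * (1 - f) = 1 - f := (IsIdempotentElem.one_sub hff)
    have hl : (1 - f) * x.unop = x.unop := by
      rw [← hx, ← mul_assoc, hf1]
    have hr : x.unop * (1 - f) = x.unop := by
      rw [← hx, mul_assoc, mul_assoc, hf1]
    refine ⟨MulOpposite.op ⟨↑u⁻¹ * x.unop * u, ?_, ?_⟩, ?_⟩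
    · rw [← mul_assoc, ← mul_assoc, h2, mul_assoc _ _ x.unop, hl]
    · rw [mul_assoc, ← h1, ← mul_assoc, mul_assoc _ x.unop, hr]
    · change MulOpposite.op ((u : A) * (↑u⁻¹ * x.unop * u) * ↑u⁻¹) = x
      simp only [mul_assoc, Units.mul_inv_cancel_left, Units.mul_inv, mul_one]
      rfl

end Rad
end YGr
end

noncomputable section
namespace YGr
set_option linter.unusedSectionVars false
section Conc
variable {k A : Type} [Field k] [Ring A] [Algebra k A] {𝒜 : ℕ → Submodule k A} [GradedRing 𝒜]
  {B : ℕ} (hB : ∀ j, B < j → 𝒜 j = ⊥)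

section One
variable {M : Type} [AddCommGroup M] [Module k M] [Module Aᵐᵒᵖ M] [IsScalarTower k Aᵐᵒᵖ M]
  (g : ℕ → AddSubgroup M) [DirectSum.Decomposition g] {n : ℕ}

lemma hk_of (hc : ∀ (d j : ℕ) (a : A), a ∈ 𝒜 j → ∀ x ∈ g d, (MulOpposite.op a) • x ∈ g (d + j))
    (d : ℕ) (c : k) (x : M) (hx : x ∈ g d) : c • x ∈ g d := by
  have h1 : (1 : A) ∈ 𝒜 0 := SetLike.GradedOne.one_mem
  have := hc d 0 (c • 1) ((𝒜 0).smul_mem c h1) x hx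
  have h2 : MulOpposite.op (c • (1 : A)) • x = c • x := by
    rw [MulOpposite.op_smul, smul_assoc, MulOpposite.op_one, one_smul]
  rwa [h2] at this

lemma hs_of (hB : ∀ j, B < j → 𝒜 j = ⊥)
    (hc : ∀ (d j : ℕ) (a : A), a ∈ 𝒜 j → ∀ x ∈ g d, (MulOpposite.op a) • x ∈ g (d + j))
    (hsp : Submodule.span Aᵐᵒᵖ (g n : Set M) = ⊤)
    (d : ℕ) (x : M) (hx : x ∈ g d) (hd : (d : ℤ) - n ∉ Finset.Icc (-(B : ℤ)) B) : x = 0 := by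
  have h : ∀ y : M, prA g d y = 0 := by
    intro y
    have hy : y ∈ Submodule.span Aᵐᵒᵖ (g n : Set M) := by rw [hsp]; trivial
    induction hy using Submodule.closure_induction with
    | zero => exact map_zero _
    | add x y _ _ hx hy => rw [map_add, hx, hy, add_zero]
    | smul_mem a x h =>
      have h : x ∈ g n := h
      induction a using MulOpposite.rec' with | _ a
      refine prA_ind 𝒜 (p := fun a => prA g d (MulOpposite.op a • x) = 0) ?_ ?_ ?_ a
      · simp
      · intro a b ha hb; rw [MulOpposite.op_add, add_smul, map_add, ha, hb, add_zero]
      · intro j a ha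
        rw [prA_mem g _ _ _ (hc n j a ha x h)]
        split_ifs with hh
        · have hj : B < j := by
            rw [Finset.mem_Icc] at hd
            push_cast at hh; omega
          rw [hB j hj] at ha
          rw [(Submodule.mem_bot k).1 ha]; simp
        · rfl
  rw [← h x, prA_mem g d d x hx, if_pos rfl]

/-- the grading of a term of the resolution -/
def resGrd (hB : ∀ j, B < j → 𝒜 j = ⊥)
    (hc : ∀ (d j : ℕ) (a : A), a ∈ 𝒜 j → ∀ x ∈ g d, (MulOpposite.op a) • x ∈ g (d + j))
    (hsp : Submodule.span Aᵐᵒᵖ (g n : Set M) = ⊤) : Grd k M :=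
  mkGrd g (hk_of g hc) n B (hs_of g hB hc hsp)

lemma resGrd_cpt (hB : ∀ j, B < j → 𝒜 j = ⊥)
    (hc : ∀ (d j : ℕ) (a : A), a ∈ 𝒜 j → ∀ x ∈ g d, (MulOpposite.op a) • x ∈ g (d + j))
    (hsp : Submodule.span Aᵐᵒᵖ (g n : Set M) = ⊤) :
    Cpt (opGR 𝒜 B hB) (resGrd g hB hc hsp) := by
  intro i j a x
  change prA g (n + (i + j)) (MulOpposite.op (prA 𝒜 i a.unop) • x) =
    MulOpposite.op (prA 𝒜 i a.unop) • prA g (n + j) x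
  generalize a.unop = a
  refine prA_ind 𝒜 (p := fun a => prA g (n + (i + j)) (MulOpposite.op (prA 𝒜 i a) • x) =
    MulOpposite.op (prA 𝒜 i a) • prA g (n + j) x) ?_ ?_ ?_ a
  · simp
  · intro a b ha hb
    simp only [map_add, MulOpposite.op_add, add_smul] at *
    rw [ha, hb]
  intro d a ha
  rw [prA_mem 𝒜 d i a ha]
  by_cases h : i = d
  · rw [if_pos h]
    refine prA_ind g (p := fun x => prA g (n + (i + j)) (MulOpposite.op a • x) =
      MulOpposite.op a • prA g (n + j) x) ?_ ?_ ?_ x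
    · simp
    · intro a b ha hb; rw [smul_add, map_add, ha, hb, map_add, smul_add]
    intro q x hx
    rw [prA_mem g q _ x hx, prA_mem g _ _ _ (hc q d a ha x hx)]
    by_cases h' : n + j = (q : ℤ)
    · rw [if_pos h', if_pos (by push_cast; omega)]
    · rw [if_neg h', if_neg (by push_cast; omega), smul_zero]
  · rw [if_neg h]; simp

lemma resGrd_span (hB : ∀ j, B < j → 𝒜 j = ⊥)
    (hc : ∀ (d j : ℕ) (a : A), a ∈ 𝒜 j → ∀ x ∈ g d, (MulOpposite.op a) • x ∈ g (d + j))
    (hsp : Submodule.span Aᵐᵒᵖ (g n : Set M) = ⊤) :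
    Submodule.span Aᵐᵒᵖ {x : M | (resGrd g hB hc hsp).π 0 x = x} = ⊤ := by
  refine le_antisymm le_top ?_
  rw [← hsp]
  refine Submodule.span_mono (fun x hx => ?_)
  change prA g (n + 0) x = x
  rw [prA_mem g n _ x hx, if_pos (add_zero _)]

end One

lemma d_of {M N : Type} [AddCommGroup M] [AddCommGroup N] (g : ℕ → AddSubgroup M)
    [DirectSum.Decomposition g] (g' : ℕ → AddSubgroup N) [DirectSum.Decomposition g']
    (f : M →+ N) (hf : ∀ d, ∀ x ∈ g d, f x ∈ g' d) (i : ℤ) (x : M) :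
    f (prA g i x) = prA g' i (f x) := by
  refine prA_ind g (p := fun x => f (prA g i x) = prA g' i (f x)) ?_ ?_ ?_ x
  · simp
  · intro x y hx hy; rw [map_add, map_add, map_add, map_add, hx, hy]
  · intro d x hx
    rw [prA_mem g d i x hx, prA_mem g' d i _ (hf d x hx)]
    split_ifs
    · rfl
    · exact map_zero _

/-- The abstract resolution. -/
def mkRes (z : Ssq 𝒜) (hB : ∀ j, B < j → 𝒜 j = ⊥) {e : A} (he : IsIdempotentElem e)
    (P : CategoryTheory.ProjectiveResolution (Se A e))
    (g : ∀ n : ℕ, ℕ → AddSubgroup (P.complex.X n))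
    (hI : ∀ n : ℕ, DirectSum.IsInternal (g n))
    (hc : ∀ (n d j : ℕ) (a : A), a ∈ 𝒜 j → ∀ x ∈ g n d,
      (MulOpposite.op a) • x ∈ g n (d + j))
    (hd : ∀ (n d : ℕ), ∀ x ∈ g (n + 1) d, P.complex.d (n + 1) n x ∈ g n d)
    (hsp : ∀ n : ℕ, Submodule.span Aᵐᵒᵖ ((g n n : Set (P.complex.X n))) = ⊤) :
    Res (opGR 𝒜 B hB) :=
  letI (n : ℕ) : Module k (P.complex.X n) := Module.compHom _ (algebraMap k Aᵐᵒᵖ)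
  haveI (n : ℕ) : IsScalarTower k Aᵐᵒᵖ (P.complex.X n) := ⟨fun c r x => by
    rw [Algebra.smul_def, mul_smul]; rfl⟩
  letI mk : Module k (Se A e) := Module.compHom _ (algebraMap k Aᵐᵒᵖ)
  haveI tw : IsScalarTower k Aᵐᵒᵖ (Se A e) := ⟨fun c r x => by
    rw [Algebra.smul_def, mul_smul]; rfl⟩
  haveI (n : ℕ) : Module.Projective Aᵐᵒᵖ (P.complex.X n) :=
    (IsProjective.iff_projective _).2 (P.projective n)
  letI (n : ℕ) : DirectSum.Decomposition (g n) := (hI n).chooseDecomposition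
  { P := fun n => P.complex.X n
    g := fun n => resGrd (g n) hB (hc n) (hsp n)
    B := B
    gb := fun n => rfl
    c := fun n => resGrd_cpt (g n) hB (hc n) (hsp n)
    span := fun n => resGrd_span (g n) hB (hc n) (hsp n)
    d := fun n => (P.complex.d (n + 1) n).hom
    dd := fun n x => by
      have := P.complex.d_comp_d (n + 1 + 1) (n + 1) n
      exact LinearMap.congr_fun (congrArg ModuleCat.Hom.hom this) x
    d_w := fun n w x => by
      have := d_of (g (n + 1)) (g n) (P.complex.d (n + 1) n).hom.toAddMonoidHom (hd n)
        ((n + 1 : ℕ) + w) x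
      refine this.trans ?_
      have h : (((n + 1 : ℕ) : ℤ) + w) = n + (w + 1) := by push_cast; ring
      rw [h]; rfl
    S := Se A e
    mKS := mk
    mRS := (Se A e).isModule
    twS := tw
    Splus := fun i r s hi => by
      obtain ⟨a, rfl⟩ := clS_surj (e := e) s
      refine (clS_smul (e := e) a _).trans ((clS_zero z hB he _).2 ?_)
      have h : z.ψ (prA 𝒜 i r.unop) = 0 := by
        rw [z.ψ_zero]
        have := (opGR 𝒜 B hB).orth 0 i r
        rw [if_neg (by omega)] at this
        exact congrArg MulOpposite.unop this
      rw [map_mul, map_mul]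
      erw [h]
      rw [mul_zero, mul_zero]
    ε := (P.π.f 0).hom
    εsurj := (ModuleCat.epi_iff_surjective (P.π.f 0)).1 inferInstance
    εd := fun x => LinearMap.congr_fun (congrArg ModuleCat.Hom.hom P.complex_d_comp_π_f_zero) x
    ex0 := fun x hx => by
      have := P.exact₀
      rw [ShortComplex.moduleCat_exact_iff] at this
      exact this x hx
    ex := fun n x hx => by
      have := P.exact_succ n
      rw [ShortComplex.moduleCat_exact_iff] at this
      exact this x hx }

end Conc
end YGr
end

noncomputable section
namespace YGr
set_option linter.unusedSectionVars false
section Cmp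
variable {k A : Type} [Field k] [Ring A] [Algebra k A] {𝒜 : ℕ → Submodule k A} [GradedRing 𝒜]
  {B : ℕ} (z : Ssq 𝒜) (hB : ∀ j, B < j → 𝒜 j = ⊥) {e : A} (he : IsIdempotentElem e)
    (P : CategoryTheory.ProjectiveResolution (Se A e))
    (g : ∀ n : ℕ, ℕ → AddSubgroup (P.complex.X n))
    (hI : ∀ n : ℕ, DirectSum.IsInternal (g n))
    (hc : ∀ (n d j : ℕ) (a : A), a ∈ 𝒜 j → ∀ x ∈ g n d,
      (MulOpposite.op a) • x ∈ g n (d + j))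
    (hd : ∀ (n d : ℕ), ∀ x ∈ g (n + 1) d, P.complex.d (n + 1) n x ∈ g n d)
    (hsp : ∀ n : ℕ, Submodule.span Aᵐᵒᵖ ((g n n : Set (P.complex.X n))) = ⊤)

/-- maps to the top -/
def tH (a : ℕ) (f : (mkRes z hB he P g hI hc hd hsp).P a →ₗ[Aᵐᵒᵖ]
    (mkRes z hB he P g hI hc hd hsp).S) : P.complex.X a ⟶ Se A e :=
  ModuleCat.ofHom (X := P.complex.X a) (Y := Se A e) f

/-- maps to the top, backwards -/
def fH (a : ℕ) (f : P.complex.X a ⟶ Se A e) : (mkRes z hB he P g hI hc hd hsp).P a →ₗ[Aᵐᵒᵖ]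
    (mkRes z hB he P g hI hc hd hsp).S := f.hom

lemma tH_d (a : ℕ) (f) : P.complex.d (a + 1) a ≫ tH z hB he P g hI hc hd hsp a f = 0 := by
  ext x
  exact (mkRes z hB he P g hI hc hd hsp).S_d f x

/-- additive map to Ext -/
def GG (a : ℕ) : ((mkRes z hB he P g hI hc hd hsp).P a →ₗ[Aᵐᵒᵖ]
    (mkRes z hB he P g hI hc hd hsp).S) →+ Ext (Se A e) (Se A e) a where
  toFun f := P.extMk (tH z hB he P g hI hc hd hsp a f) (a + 1) rfl (tH_d z hB he P g hI hc hd hsp a f)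
  map_zero' := P.extMk_zero (a + 1) rfl
  map_add' f f' := (P.add_extMk _ _ (a + 1) rfl (tH_d z hB he P g hI hc hd hsp a f)
    (tH_d z hB he P g hI hc hd hsp a f')).symm

lemma GG_bij (a : ℕ) : Function.Bijective (GG z hB he P g hI hc hd hsp a) := by
  constructor
  · rw [injective_iff_map_eq_zero]
    intro f hf
    have h : tH z hB he P g hI hc hd hsp a f = 0 := by
      cases a with
      | zero => exact YExt.extMk_inj_zero P _ (tH_d z hB he P g hI hc hd hsp 0 f) hf
      | succ a =>
        obtain ⟨f', hf'⟩ := (P.extMk_eq_zero_iff _ _ rfl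
          (tH_d z hB he P g hI hc hd hsp (a + 1) f) a rfl).1 hf
        rw [← hf']
        exact tH_d z hB he P g hI hc hd hsp a (fH z hB he P g hI hc hd hsp a f')
    exact congrArg ModuleCat.Hom.hom h
  · intro α
    obtain ⟨f, hf, rfl⟩ := P.extMk_surjective α (a + 1) rfl
    exact ⟨fH z hB he P g hI hc hd hsp a f, rfl⟩

/-- components of an endomorphism -/
def tC (t : (mkRes z hB he P g hI hc hd hsp).PP →ₗ[Aᵐᵒᵖ] (mkRes z hB he P g hI hc hd hsp).PP)
    (a n : ℕ) : P.complex.X (a + n) ⟶ P.complex.X n :=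
  ModuleCat.ofHom (X := P.complex.X (a + n)) (Y := P.complex.X n)
    ((DFinsupp.lapply n ∘ₗ t) ∘ₗ (mkRes z hB he P g hI hc hd hsp).incl (a + n))

lemma res_comm {gR : GRg k Aᵐᵒᵖ} (r : Res gR) (t : r.PP →ₗ[Aᵐᵒᵖ] r.PP) (ht : r.Good t)
    (a n : ℕ) (x : r.P (a + n + 1)) :
    r.d n ((t (r.incl (a + n + 1) x)) (n + 1)) =
      ((-1 : ℤ) ^ a) • (t (r.incl (a + n) (r.d (a + n) x))) n := by
  have h := congrArg (fun y : r.PP => y n) (ht.δ (r.incl (a + n + 1) x))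
  simp only [r.δ_apply, r.δ_incl, map_zsmul, DFinsupp.smul_apply] at h
  rw [← Res.zsmul_self (n + 1) (r.d n _), h, smul_smul, ← pow_add]
  congr 1
  have : n + 1 + (a + n + 1) = a + 2 * (n + 1) := by ring
  rw [this, pow_add, pow_mul]; simp

lemma tC_comm (t) (ht : (mkRes z hB he P g hI hc hd hsp).Good t) (a n : ℕ) :
    tC z hB he P g hI hc hd hsp t a (n+1) ≫ P.complex.d (n+1) n =
      ((a:ℤ).negOnePow) • P.complex.d (a+n+1) (a+n) ≫ tC z hB he P g hI hc hd hsp t a n := by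
  ext x
  refine (res_comm (mkRes z hB he P g hI hc hd hsp) t ht a n x).trans ?_
  have h : ((a : ℤ).negOnePow : ℤˣ) = (-1 : ℤˣ) ^ a := rfl
  rw [h, Units.smul_def]
  push_cast
  rfl

/-- comparison data -/
def mkYD (N : ℕ) (hN : ∀ a, N < a → Subsingleton (Ext (Se A e) (Se A e) a)) :
    YD (mkRes z hB he P g hI hc hd hsp) (Se A e) where
  G a := AddEquiv.ofBijective (GG z hB he P g hI hc hd hsp a) (GG_bij z hB he P g hI hc hd hsp a)
  G_one := YExt.extMk_pi P P.complex_d_comp_π_f_zero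
  G_mul a b f g' t ht htf :=
    YExt.comp_extMk P a (fun n => tC z hB he P g hI hc hd hsp t a n)
      (tC_comm z hB he P g hI hc hd hsp t ht a) b (tH z hB he P g hI hc hd hsp b g')
      (tH_d z hB he P g hI hc hd hsp b g')
      (tH z hB he P g hI hc hd hsp a f) (tH_d z hB he P g hI hc hd hsp a f)
      (by ext x; exact (htf x).symm)
      (tH_d z hB he P g hI hc hd hsp (a + b) _)
  N := N
  hN := hN

lemma Ssq.op_sum (v : Fin z.m → k) :
    MulOpposite.op (z.ι v) = ∑ i, v i • MulOpposite.op (z.ι (Pi.single i 1)) := by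
  have h : v = ∑ i, v i • (Pi.single i 1 : Fin z.m → k) := by
    conv_lhs => rw [← Finset.univ_sum_single v]
    refine Finset.sum_congr rfl (fun i _ => ?_)
    rw [← Pi.single_smul, smul_eq_mul, mul_one]
  have h2 := congrArg ((MulOpposite.opLinearEquiv k).toLinearMap ∘ₗ z.ι.toLinearMap) h
  rw [map_sum] at h2
  simp only [map_smul] at h2
  exact h2

/-- data on the top -/
def mkSD : SD (mkRes z hB he P g hI hc hd hsp) where
  m := z.m
  e i := MulOpposite.op (z.ι (Pi.single i 1))
  eorth i j := by
    rw [← MulOpposite.op_mul, ← map_mul]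
    by_cases h : i = j
    · subst h
      rw [if_pos rfl, ← Pi.single_mul, one_mul]
    · have h2 : (Pi.single j 1 * Pi.single i 1 : Fin z.m → k) = 0 := by
        ext l
        rw [Pi.mul_apply, Pi.single_apply, Pi.single_apply]
        split_ifs with h3 h4
        · exact absurd (h4.symm.trans h3) h
        · simp
        · simp
        · simp
      rw [if_neg h, h2, map_zero, MulOpposite.op_zero]
  esum := by
    have := z.op_sum 1
    rw [map_one] at this
    simp only [Pi.one_apply, one_smul] at this
    exact this.symm
  edeg i := by
    rw [opGR_π, MulOpposite.unop_op, ← z.ιψ, z.ψι]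
  espan r := by
    refine ⟨z.ψ r.unop, ?_⟩
    rw [opGR_π, ← z.ιψ]
    exact z.op_sum _
  s0 := (clS e 1 : SeModule A e)
  e0 := MulOpposite.op (z.ι (z.ψ e))
  e0e0 := by rw [← MulOpposite.op_mul, ← map_mul, ← map_mul, he.eq]
  e0deg := by rw [opGR_π, MulOpposite.unop_op, ← z.ιψ, z.ψι]
  gen0 s := by
    obtain ⟨a, rfl⟩ := clS_surj (e := e) s
    exact ⟨MulOpposite.op a, (clS_smul 1 a).trans (by rw [one_mul])⟩
  e0S s := by
    obtain ⟨a, rfl⟩ := clS_surj (e := e) s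
    refine (clS_smul a _).trans ?_
    rw [← sub_eq_zero, clS_sub, clS_zero z hB he, map_mul, map_sub, map_mul, z.ψι]
    have hψ : z.ψ e * z.ψ e = z.ψ e := by rw [← map_mul, he.eq]
    linear_combination (z.ψ a) * hψ
  ann a ha := by
    have h : clS e (1 * a.unop) = 0 := (clS_smul 1 a.unop).symm.trans ha
    rw [clS_zero z hB he, one_mul, map_mul] at h
    rw [opGR_π, ← z.ιψ, ← MulOpposite.op_mul, ← map_mul, h, map_zero, MulOpposite.op_zero]

theorem conclude [FiniteDimensional k A] (h0 : GradeZeroIsProductOfField 𝒜)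
    (he : IsIdempotentElem e)
    (hlin : HasLinearGradedProjectiveResolution 𝒜 (Se A e))
    (hA : HasFiniteGlobalDimension A)
    (hGamma : HasFiniteGlobalDimension (CornerRing (1 - e) he.one_sub)) :
    HasFiniteGlobalDimension (YonedaRing A e) := by
  obtain ⟨P, g, hI, hc, hd, hsp⟩ := hlin
  obtain ⟨B, hB⟩ := exists_bound 𝒜
  obtain ⟨z⟩ := exists_ssq hB h0
  obtain ⟨c⟩ := exists_cor z hB he
  obtain ⟨N, hN⟩ := hA
  haveI : Module.Finite k Aᵐᵒᵖ := Module.Finite.equiv (MulOpposite.opLinearEquiv k)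
  exact YD.main (mkYD z hB he P g hI hc hd hsp N (fun a ha => hN _ _ a ha))
    (mkSD z hB he P g hI hc hd hsp) c hGamma

end Cmp
end YGr
end

/-- **Theorem.** Let `A` be a finite dimensional positively graded algebra over a field `k`
such that `S_e` has a linear graded projective resolution. If the global dimensions of `A`
and of `Γ = (1-e)A(1-e)` are both finite, then the Yoneda ring `Y(e)` has finite global
dimension. -/
theorem yonedaRing_finite_global_dimension_of_linear
    (k : Type) [Field k] (A : Type) [Ring A] [Algebra k A] [FiniteDimensional k A]
    (𝒜 : ℕ → Submodule k A) [GradedRing 𝒜] (h0 : GradeZeroIsProductOfField 𝒜)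
    (e : A) (he : IsIdempotentElem e)
    (hlin : HasLinearGradedProjectiveResolution 𝒜 (Se A e))
    (hA : HasFiniteGlobalDimension A)
    (hGamma : HasFiniteGlobalDimension (CornerRing (1 - e) he.one_sub)) :
    HasFiniteGlobalDimension (YonedaRing A e) := by
  exact YGr.conclude h0 he hlin hA hGamma
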